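/- If ν is a general algebraic self-similar measure on the space 𝓜 of M×N real matrices, then ν(BA) = 0, i.e. ν-almost every matrix is not badly approximable. -/

import Mathlib

open MeasureTheory Filter Topology Matrix

noncomputable section

attribute [local instance] Matrix.normedAddCommGroup Matrix.normedSpace

/-- The space of `M × N` real matrices (with the entrywise sup norm as the fixed norm). -/
abbrev MatSpace (M N : ℕ) := Matrix (Fin M) (Fin N) ℝ

instance (M N : ℕ) : MeasurableSpace (MatSpace M N) := borel _
instance (M N : ℕ) : BorelSpace (MatSpace M N) := ⟨rfl⟩

/-- `φ` is an algebraic similarity of the space of `M × N` matrices with scaling ratio `r`: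
`φ(α) = r • (B α C) + δ` with `B, C` orthogonal. -/
def IsAlgebraicSimilarity {M N : ℕ} (r : ℝ) (φ : MatSpace M N → MatSpace M N) : Prop :=
  0 < r ∧ ∃ B ∈ Matrix.orthogonalGroup (Fin M) ℝ, ∃ C ∈ Matrix.orthogonalGroup (Fin N) ℝ,
    ∃ δ : MatSpace M N, ∀ α, φ α = r • (B * α * C) + δ

/-- Irreducibility: no nonempty proper affine subspace of the matrix space is invariant
under all maps of the system. -/
def IrreducibleMatIFS {E : Type*} {M N : ℕ} (φ : E → MatSpace M N → MatSpace M N) : Prop :=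
  ¬ ∃ L : AffineSubspace ℝ (MatSpace M N),
      (L : Set (MatSpace M N)).Nonempty ∧ L ≠ ⊤ ∧
        ∀ e, φ e '' (L : Set (MatSpace M N)) = (L : Set (MatSpace M N))

def seqApply {E X : Type*} (φ : E → X → X) (b : ℕ → E) : ℕ → X → X
  | 0 => id
  | n + 1 => fun x => seqApply φ b n (φ (b n) x)

/-- `β` is the Bernoulli measure `μ^{⊗ℕ}` on `E^ℕ`. -/
def IsBernoulli {E : Type*} [MeasurableSpace E] (μ : Measure E) (β : Measure (ℕ → E)) : Prop :=
  IsProbabilityMeasure β ∧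
    ∀ (F : Finset ℕ) (s : ℕ → Set E), (∀ i ∈ F, MeasurableSet (s i)) →
      β {b | ∀ i ∈ F, b i ∈ s i} = ∏ i ∈ F, μ (s i)

/-- The set of badly approximable `M × N` matrices. -/
def badlyApproximableMat (M N : ℕ) : Set (MatSpace M N) :=
  {α | ∃ c : ℝ, 0 < c ∧ ∀ q : Fin N → ℤ, q ≠ 0 → ∀ p : Fin M → ℤ,
    c * ‖fun j => (q j : ℝ)‖ ^ (-(N : ℝ) / M) ≤
      ‖α.mulVec (fun j => (q j : ℝ)) - fun i => (p i : ℝ)‖}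

set_option linter.unusedSectionVars false
set_option linter.style.haveILetI false
set_option linter.unusedVariables false

section

/-- cast of an integer vector -/
def zc {n : Type*} (v : n → ℤ) : n → ℝ := fun j => (v j : ℝ)

lemma zc_inj {n : Type*} {v w : n → ℤ} (h : zc v = zc w) : v = w := by
  funext j
  have := congrFun h j
  simpa [zc] using this

lemma zc_ne {n : Type*} {v : n → ℤ} (h : v ≠ 0) : zc v ≠ 0 := by
  intro h0
  exact h (zc_inj (h0.trans (by funext j; simp [zc])))

lemma minkowski_box {n : Type*} [Fintype n] [DecidableEq n] [Nonempty n] (A : Matrix n n ℝ)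
    (h : |A.det| = 1) : ∃ v : n → ℤ, v ≠ 0 ∧ ∀ i, |(A *ᵥ zc v) i| ≤ 2 := by
  have hdet : A.det ≠ 0 := by intro h0; rw [h0] at h; simp at h
  have hdet' : LinearMap.det (Matrix.toLin' A) ≠ 0 := by rwa [LinearMap.det_toLin']
  set s : Set (n → ℝ) := (Matrix.toLin' A) ⁻¹' (Metric.ball 0 2) with hs
  have hvol : volume s = 4 ^ (Fintype.card n) := by
    rw [hs, Measure.addHaar_preimage_linearMap _ hdet', LinearMap.det_toLin', abs_inv, h]
    rw [Real.volume_pi_ball _ (by norm_num)]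
    simp only [inv_one, ENNReal.ofReal_one, one_mul]
    norm_num
  let b := Pi.basisFun ℝ n
  have hF := ZSpan.isAddFundamentalDomain b (volume : Measure (n → ℝ))
  have hFv : volume (ZSpan.fundamentalDomain b) = 1 := by
    rw [ZSpan.fundamentalDomain_pi_basisFun, Real.volume_pi_Ico]
    simp
  have hcount : Countable (Submodule.span ℤ (Set.range b)).toAddSubgroup := by
    change Countable (Submodule.span ℤ (Set.range b))
    infer_instance
  obtain ⟨x, hx0, hxs⟩ := exists_ne_zero_mem_lattice_of_measure_mul_two_pow_lt_measure
    (L := (Submodule.span ℤ (Set.range b)).toAddSubgroup) (s := s) hF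
    (by intro x hx; simp only [hs, Set.mem_preimage, map_neg, mem_ball_zero_iff, norm_neg] at hx ⊢; exact hx)
    ((convex_ball (0 : n → ℝ) 2).linear_preimage _)
    (by
      rw [hFv, hvol, Module.finrank_fintype_fun_eq_card, one_mul]
      exact ENNReal.pow_lt_pow_left Fintype.card_ne_zero (by norm_num))
  obtain ⟨x, hxm⟩ := x
  have hxm' : x ∈ Submodule.span ℤ (Set.range b) := hxm
  have hmem := (b.mem_span_iff_repr_mem ℤ x).1 hxm'
  choose v hv using hmem
  have hxv : x = zc v := by
    funext j
    have := hv j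
    simp [b] at this
    simp [zc, ← this]
  refine ⟨v, ?_, ?_⟩
  · rintro rfl
    apply hx0
    ext j
    simp [hxv, zc]
  · intro i
    have h1 : ‖A *ᵥ x‖ < 2 := by simpa [hs] using hxs
    rw [← hxv, ← Real.norm_eq_abs]
    exact (norm_le_pi_norm _ i).trans h1.le

end

section

lemma abs_dot_le {n : Type*} [Fintype n] (x y : n → ℝ) {a b : ℝ} (ha : ∀ i, |x i| ≤ a)
    (hb : ∀ i, |y i| ≤ b) (ha0 : 0 ≤ a) : |x ⬝ᵥ y| ≤ Fintype.card n * (a * b) := by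
  unfold dotProduct
  calc |∑ i, x i * y i| ≤ ∑ i, |x i * y i| := Finset.abs_sum_le_sum_abs _ _
    _ ≤ ∑ _i : n, a * b := by
        apply Finset.sum_le_sum
        intro i _
        rw [abs_mul]
        exact mul_le_mul (ha i) (hb i) (abs_nonneg _) ha0
    _ = _ := by simp

lemma norm_mul_le_card {l m n : Type*} [Fintype l] [Fintype m] [Fintype n] (A : Matrix l m ℝ)
    (B : Matrix m n ℝ) : ‖A * B‖ ≤ Fintype.card m * (‖A‖ * ‖B‖) := by
  rw [Matrix.norm_le_iff (by positivity)]
  intro i j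
  rw [Real.norm_eq_abs, Matrix.mul_apply']
  exact abs_dot_le _ _ (fun k => by simpa using Matrix.norm_entry_le_entrywise_sup_norm A (i := i) (j := k))
    (fun k => by simpa using Matrix.norm_entry_le_entrywise_sup_norm B (i := k) (j := j)) (norm_nonneg _)

lemma squeeze {n : Type*} [Fintype n] [DecidableEq n] [Nonempty n] (g : Matrix n n ℝ)
    (h : |g.det| = 1) (u : n → ℝ) (hu : u ⬝ᵥ u = 1) (s : ℝ) (hs : 0 < s) :
    ∃ v : n → ℤ, v ≠ 0 ∧ ∃ y : n → ℝ, (∀ i, |y i| ≤ 2) ∧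
      g *ᵥ zc v = s • y + ((1 - s ^ Fintype.card n) * (u ⬝ᵥ (g *ᵥ zc v))) • u ∧
      s ^ Fintype.card n * (u ⬝ᵥ (g *ᵥ zc v)) = s * (u ⬝ᵥ y) := by
  set d := Fintype.card n
  set E : Matrix n n ℝ := s⁻¹ • (1 + (s ^ d - 1) • vecMulVec u u) with hE
  have hEdet : E.det = 1 := by
    rw [hE, Matrix.det_smul]
    have : (1 + (s ^ d - 1) • vecMulVec u u : Matrix n n ℝ) = 1 + replicateCol Unit ((s^d-1) • u) * replicateRow Unit u := by
      ext i j
      simp [vecMulVec, Matrix.mul_apply]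
    rw [this, Matrix.det_one_add_replicateCol_mul_replicateRow]
    simp only [dotProduct_smul, hu]
    rw [inv_pow]
    simp only [smul_eq_mul, mul_one]
    rw [add_sub_cancel, inv_mul_cancel₀ (by positivity)]
  have hEx : ∀ x, E *ᵥ x = s⁻¹ • (x + ((s ^ d - 1) * (u ⬝ᵥ x)) • u) := by
    intro x
    rw [hE, Matrix.smul_mulVec, Matrix.add_mulVec, Matrix.one_mulVec, Matrix.smul_mulVec,
      Matrix.vecMulVec_mulVec]
    ext i
    simp only [Pi.smul_apply, Pi.add_apply, smul_eq_mul, MulOpposite.smul_eq_mul_unop, MulOpposite.unop_op]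
    ring
  obtain ⟨v, hv, hy⟩ := minkowski_box (E * g) (by rw [Matrix.det_mul, hEdet, one_mul, h])
  refine ⟨v, hv, (E * g) *ᵥ zc v, hy, ?_, ?_⟩
  · rw [← Matrix.mulVec_mulVec, hEx]
    ext i
    simp
    field_simp
    ring
  · rw [← Matrix.mulVec_mulVec, hEx]
    simp only [dotProduct_smul, dotProduct_add, hu, smul_eq_mul]
    field_simp
    ring

lemma exists_unit_normal {n : Type*} [Fintype n] (S : Submodule ℝ (n → ℝ))
    (hS : S ≠ ⊤) : ∃ u : n → ℝ, u ⬝ᵥ u = 1 ∧ ∀ x ∈ S, u ⬝ᵥ x = 0 := by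
  classical
  obtain ⟨v, hv⟩ : ∃ v, v ∉ S := by
    by_contra hcon
    push Not at hcon
    exact hS (by ext; simp [hcon])
  obtain ⟨f, hf, hker⟩ := Submodule.exists_le_ker_of_notMem hv
  set u0 : n → ℝ := fun i => f (Pi.single i 1)
  have hfu : ∀ x, f x = u0 ⬝ᵥ x := by
    intro x
    rw [LinearMap.pi_apply_eq_sum_univ f x]
    simp only [dotProduct, u0, smul_eq_mul]
    refine Finset.sum_congr rfl fun i _ => ?_
    rw [mul_comm]
    congr 2
    funext j
    simp [Pi.single_apply, eq_comm]
  have hu0 : u0 ≠ 0 := by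
    intro h0
    apply hf
    rw [hfu, h0, zero_dotProduct]
  have hpos : 0 < u0 ⬝ᵥ u0 := by
    have h1 : 0 ≤ u0 ⬝ᵥ u0 := by
      unfold dotProduct
      exact Finset.sum_nonneg fun i _ => mul_self_nonneg _
    rcases h1.lt_or_eq with h | h
    · exact h
    · exact absurd (dotProduct_self_eq_zero.1 h.symm) hu0
  refine ⟨(Real.sqrt (u0 ⬝ᵥ u0))⁻¹ • u0, ?_, ?_⟩
  · rw [dotProduct_smul, smul_dotProduct, smul_eq_mul, smul_eq_mul, ← mul_assoc, ← mul_inv,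
      Real.mul_self_sqrt hpos.le, inv_mul_cancel₀ hpos.ne']
  · intro x hx
    rw [smul_dotProduct, ← hfu x, LinearMap.mem_ker.1 (hker hx), smul_zero]

lemma abs_le_one_of_unit {n : Type*} [Fintype n] {u : n → ℝ} (hu : u ⬝ᵥ u = 1) (i : n) : |u i| ≤ 1 := by
  have : u i * u i ≤ 1 := by
    rw [← hu]
    unfold dotProduct
    exact Finset.single_le_sum (f := fun i => u i * u i) (fun i _ => mul_self_nonneg _) (Finset.mem_univ i)
  rw [abs_le]
  constructor <;> nlinarith

/-- cast of an integer matrix -/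
def zm {n : Type*} (A : Matrix n n ℤ) : Matrix n n ℝ := A.map (Int.cast : ℤ → ℝ)

lemma zm_mul {n : Type*} [Fintype n] (A B : Matrix n n ℤ) : zm (A * B) = zm A * zm B := by
  ext i j; simp [zm, Matrix.mul_apply]

lemma zm_one {n : Type*} [DecidableEq n] : zm (1 : Matrix n n ℤ) = 1 := by
  ext i j; simp [zm, Matrix.one_apply]

lemma zm_det {n : Type*} [Fintype n] [DecidableEq n] (A : Matrix n n ℤ) : (zm A).det = (A.det : ℝ) := by
  have := (Int.castRingHom ℝ).map_det A
  simp [zm] at *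
  exact this.symm

lemma zm_mulVec {n : Type*} [Fintype n] (A : Matrix n n ℤ) (v : n → ℤ) : zm A *ᵥ zc v = zc (A *ᵥ v) := by
  ext i; simp [zm, zc, Matrix.mulVec, dotProduct]

lemma zm_inj {n : Type*} {A B : Matrix n n ℤ} (h : zm A = zm B) : A = B := by
  ext i j
  have := congrFun (congrFun h i) j
  simpa [zm] using this

lemma mahler_sub1 {n : Type*} [Fintype n] [DecidableEq n] [Nonempty n] (c : ℝ) (hc : 0 < c) :
    ∃ R : ℝ, ∀ g : Matrix n n ℝ, |g.det| = 1 → (∀ v : n → ℤ, v ≠ 0 → c ≤ ‖g *ᵥ zc v‖) →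
      ∃ A : Matrix n n ℤ, A.det ≠ 0 ∧ ‖g * zm A‖ ≤ R := by
  set d := Fintype.card n with hd
  set s := c / 4 with hs
  have hs0 : 0 < s := by positivity
  set R : ℝ := 2 * s + |1 - s ^ d| * (s / s ^ d) * (d * 2) with hR
  have hR0 : 0 ≤ R := by positivity
  refine ⟨R, fun g hg hv => ?_⟩
  set X : Set (n → ℝ) := {x | ∃ w : n → ℤ, x = g *ᵥ zc w ∧ ‖x‖ ≤ R} with hX
  have hspan : Submodule.span ℝ X = ⊤ := by
    by_contra hne
    obtain ⟨u, hu, huS⟩ := exists_unit_normal _ hne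
    obtain ⟨v, hv0, y, hy, h1, h2⟩ := squeeze g hg u hu s hs0
    set x := g *ᵥ zc v with hx
    have huy : |u ⬝ᵥ y| ≤ d * 2 := by
      have := abs_dot_le u y (abs_le_one_of_unit hu) hy zero_le_one
      simpa using this
    have hsd : 0 < s ^ d := by positivity
    have hux : |u ⬝ᵥ x| ≤ (s / s ^ d) * (d * 2) := by
      have : u ⬝ᵥ x = (s / s ^ d) * (u ⬝ᵥ y) := by
        field_simp
        linarith
      rw [this, abs_mul, abs_of_pos (by positivity : 0 < s / s ^ d)]
      gcongr
    have hxR : ‖x‖ ≤ R := by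
      rw [pi_norm_le_iff_of_nonneg hR0]
      intro i
      rw [h1, Real.norm_eq_abs]
      calc |(s • y + ((1 - s ^ d) * (u ⬝ᵥ x)) • u) i| = |s * y i + (1 - s ^ d) * (u ⬝ᵥ x) * u i| := by simp
        _ ≤ |s * y i| + |(1 - s ^ d) * (u ⬝ᵥ x) * u i| := abs_add_le _ _
        _ = s * |y i| + |1 - s ^ d| * |u ⬝ᵥ x| * |u i| := by
            rw [abs_mul, abs_mul, abs_mul, abs_of_pos hs0]
        _ ≤ s * 2 + |1 - s ^ d| * ((s / s ^ d) * (d * 2)) * 1 := by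
            gcongr
            · exact hy i
            · exact abs_le_one_of_unit hu i
        _ = R := by rw [hR]; ring
    have hux0 : u ⬝ᵥ x = 0 := huS x (Submodule.subset_span ⟨v, hx, hxR⟩)
    rw [hux0] at h1
    have : ‖x‖ ≤ 2 * s := by
      rw [pi_norm_le_iff_of_nonneg (by positivity)]
      intro i
      rw [h1, Real.norm_eq_abs]
      simp [abs_mul, abs_of_pos hs0]
      nlinarith [hy i]
    have := hv v hv0
    rw [← hx] at this
    linarith
  obtain ⟨f, hfX, -, hfi⟩ := Submodule.exists_fun_fin_finrank_span_eq ℝ X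
  have hcard : Module.finrank ℝ (Submodule.span ℝ X) = Fintype.card n := by
    rw [hspan, finrank_top, Module.finrank_fintype_fun_eq_card]
  let e : n ≃ Fin (Module.finrank ℝ (Submodule.span ℝ X)) := Fintype.equivFinOfCardEq hcard.symm
  choose w hw hwR using fun j : n => hfX (e j)
  set A : Matrix n n ℤ := Matrix.of fun i j => w j i with hA
  have hcol : (g * zm A).col = f ∘ e := by
    funext j i
    rw [Function.comp, hw j]
    simp [Matrix.col, Matrix.mul_apply, zm, zc, Matrix.mulVec, dotProduct, hA]
  refine ⟨A, ?_, ?_⟩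
  · have hunit : IsUnit (g * zm A) := by
      rw [← Matrix.linearIndependent_cols_iff_isUnit, hcol]
      exact hfi.comp _ e.injective
    rw [Matrix.isUnit_iff_isUnit_det, Matrix.det_mul, zm_det] at hunit
    intro h0
    simp [h0] at hunit
  · rw [Matrix.norm_le_iff hR0]
    intro i j
    have := congrFun (congrFun hcol j) i
    simp only [Matrix.col_apply, Function.comp] at this
    rw [this]
    exact (norm_le_pi_norm _ i).trans (hwR j)

lemma cast_zmod_eq {n : Type*} {m : ℕ} {A B : Matrix n n ℤ}
    (h : A.map (Int.cast : ℤ → ZMod m) = B.map (Int.cast : ℤ → ZMod m)) :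
    ∃ K : Matrix n n ℤ, A = B + (m : ℤ) • K := by
  have : ∀ i j, ∃ k : ℤ, A i j = B i j + m * k := by
    intro i j
    have := congrFun (congrFun h i) j
    simp only [Matrix.map_apply] at this
    rw [eq_comm, ZMod.intCast_eq_intCast_iff_dvd_sub] at this
    obtain ⟨k, hk⟩ := this
    exact ⟨k, by linarith⟩
  choose K hK using this
  exact ⟨Matrix.of K, by ext i j; simp [hK]⟩

lemma exists_left_int {n : Type*} [Fintype n] [DecidableEq n] {m : ℕ} {A B : Matrix n n ℤ}
    (h : A.map (Int.cast : ℤ → ZMod m) = B.map (Int.cast : ℤ → ZMod m)) (hB : B.det ∣ (m : ℤ)) :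
    ∃ γ : Matrix n n ℤ, A = γ * B := by
  obtain ⟨K, hK⟩ := cast_zmod_eq h
  obtain ⟨t, ht⟩ := hB
  refine ⟨1 + t • (K * B.adjugate), ?_⟩
  rw [add_mul, one_mul, smul_mul_assoc, mul_assoc, Matrix.adjugate_mul, hK, ht]
  congr 1
  rw [Matrix.mul_smul, mul_one, smul_smul, mul_comm]

theorem mahler_compact {n : Type*} [Fintype n] [DecidableEq n] [Nonempty n] (c : ℝ) (hc : 0 < c) :
    ∃ R : ℝ, ∀ g : Matrix n n ℝ, |g.det| = 1 → (∀ v : n → ℤ, v ≠ 0 → c ≤ ‖g *ᵥ zc v‖) →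
      ∃ γ : (Matrix n n ℤ)ˣ, ‖g * zm γ‖ ≤ R := by
  classical
  obtain ⟨R, hR⟩ := mahler_sub1 (n := n) c hc
  set d := Fintype.card n
  obtain ⟨D, hD⟩ := exists_nat_ge ((d.factorial : ℝ) * R ^ d)
  set m := D.factorial
  have hm : m ≠ 0 := Nat.factorial_ne_zero _
  haveI : NeZero m := ⟨hm⟩
  set Pr : Matrix n n (ZMod m) → Matrix n n ℤ → Prop := fun κ A =>
    A.map (Int.cast : ℤ → ZMod m) = κ ∧ A.det ≠ 0 ∧ A.det ∣ (m : ℤ)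
  set rep : Matrix n n (ZMod m) → Matrix n n ℤ := fun κ => if h : ∃ A, Pr κ A then h.choose else 0
  have hrep : ∀ κ, (∃ A, Pr κ A) → Pr κ (rep κ) := by
    intro κ h
    simp only [rep, dif_pos h]
    exact h.choose_spec
  set Rn : ℝ := ∑ κ, ‖(zm (rep κ))⁻¹‖
  refine ⟨d * (R * Rn), fun g hg hv => ?_⟩
  obtain ⟨A, hA0, hAR⟩ := hR g hg hv
  have hR0 : 0 ≤ R := (norm_nonneg _).trans hAR
  have hAdet : A.det ∣ (m : ℤ) := by
    rw [Int.dvd_natCast]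
    apply Nat.dvd_factorial (by positivity)
    have h1 := Matrix.det_le (A := g * zm A) (abv := AbsoluteValue.abs) (x := R) (fun i j =>
      (Matrix.norm_entry_le_entrywise_sup_norm (g * zm A)).trans hAR)
    simp only [AbsoluteValue.abs_apply, Matrix.det_mul, abs_mul, hg, one_mul, zm_det, nsmul_eq_mul] at h1
    have h2 : ((A.det.natAbs : ℕ) : ℝ) ≤ D := by
      rw [Nat.cast_natAbs, Int.cast_abs]
      exact h1.trans hD
    exact_mod_cast h2
  set κ := A.map (Int.cast : ℤ → ZMod m)
  have hP := hrep κ ⟨A, rfl, hA0, hAdet⟩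
  obtain ⟨hB1, hB0, hBd⟩ := hP
  set B := rep κ with hBdef
  obtain ⟨γ, hγ⟩ := exists_left_int (A := A) (B := B) (m := m) hB1.symm hBd
  obtain ⟨γ', hγ'⟩ := exists_left_int (A := B) (B := A) (m := m) hB1 hAdet
  have hinv : γ' * γ = 1 := by
    have h1 : (γ' * γ) * B = 1 * B := by rw [mul_assoc, ← hγ, ← hγ', one_mul]
    have h2 := congrArg (fun X => zm X * (zm B)⁻¹) h1
    have hu : IsUnit (zm B).det := by rw [zm_det]; simpa using hB0
    simp only [zm_mul (γ' * γ) B, zm_mul 1 B] at h2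
    rw [Matrix.mul_nonsing_inv_cancel_right _ _ hu, Matrix.mul_nonsing_inv_cancel_right _ _ hu] at h2
    exact zm_inj h2
  have hinv' : γ * γ' = 1 := mul_eq_one_comm.1 hinv
  refine ⟨⟨γ, γ', hinv', hinv⟩, ?_⟩
  have hu : IsUnit (zm B).det := by rw [zm_det]; simpa using hB0
  have : g * zm γ = (g * zm A) * (zm B)⁻¹ := by
    rw [hγ, zm_mul, ← mul_assoc, Matrix.mul_nonsing_inv_cancel_right _ _ hu]
  change ‖g * zm γ‖ ≤ _
  rw [this]
  refine (norm_mul_le_card _ _).trans ?_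
  gcongr
  exact Finset.single_le_sum (f := fun κ => ‖(zm (rep κ))⁻¹‖) (fun _ _ => norm_nonneg _) (Finset.mem_univ κ)

end

section

/-- Square matrices of size `M + N`. -/
abbrev BMat (M N : ℕ) := Matrix (Fin M ⊕ Fin N) (Fin M ⊕ Fin N) ℝ

/-- The unipotent matrix attached to `α`. -/
def Um {M N : ℕ} (α : MatSpace M N) : BMat M N := fromBlocks 1 α 0 1

/-- The squared norm form. -/
def nform {M N : ℕ} (x : Fin M ⊕ Fin N → ℝ) : ℝ :=
  ((x ∘ Sum.inl) ⬝ᵥ (x ∘ Sum.inl)) ^ M * ((x ∘ Sum.inr) ⬝ᵥ (x ∘ Sum.inr)) ^ N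

/-- `g` defines a unimodular lattice on which the norm form is bounded below. -/
def Good {M N : ℕ} (c : ℝ) (g : BMat M N) : Prop :=
  |g.det| = 1 ∧ ∀ v : Fin M ⊕ Fin N → ℤ, v ≠ 0 → c ≤ nform (g *ᵥ zc v)

variable {M N : ℕ}

lemma Um_mul (α β : MatSpace M N) : Um α * Um β = Um (α + β) := by
  simp [Um, fromBlocks_multiply, add_comm]

lemma Um_zero : Um (0 : MatSpace M N) = 1 := by simp [Um]

lemma Um_det (α : MatSpace M N) : (Um α).det = 1 := by simp [Um]

lemma Um_cont : Continuous (Um : MatSpace M N → BMat M N) := by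
  unfold Um
  exact continuous_const.matrix_fromBlocks continuous_id continuous_const continuous_const

lemma nform_cont : Continuous (nform : (Fin M ⊕ Fin N → ℝ) → ℝ) := by
  unfold nform dotProduct
  simp only [Function.comp_apply]
  fun_prop

lemma nform_zero [NeZero M] : nform (0 : Fin M ⊕ Fin N → ℝ) = 0 := by
  have : M ≠ 0 := NeZero.ne M
  simp only [nform]
  rw [mul_eq_zero]
  left
  rw [show ((0 : Fin M ⊕ Fin N → ℝ) ∘ Sum.inl) = 0 from rfl, zero_dotProduct, zero_pow this]

lemma mulVec_cont (v : Fin M ⊕ Fin N → ℝ) : Continuous fun g : BMat M N => g *ᵥ v := by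
  fun_prop

lemma Good_closed (c : ℝ) : IsClosed {g : BMat M N | Good c g} := by
  have : {g : BMat M N | Good c g} = {g | |g.det| = 1} ∩ ⋂ v : Fin M ⊕ Fin N → ℤ, ⋂ _ : v ≠ 0,
      {g | c ≤ nform (g *ᵥ zc v)} := by
    ext g; simp [Good]
  rw [this]
  apply IsClosed.inter
  · exact isClosed_eq (continuous_id.matrix_det.abs) continuous_const
  · exact isClosed_iInter fun v => isClosed_iInter fun _ =>
      isClosed_le continuous_const (nform_cont.comp (mulVec_cont _))

lemma zm_unit_det {n : Type*} [Fintype n] [DecidableEq n] (γ : (Matrix n n ℤ)ˣ) : |(zm (γ : Matrix n n ℤ)).det| = 1 := by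
  have h : IsUnit (γ : Matrix n n ℤ).det := (Matrix.isUnit_iff_isUnit_det _).1 γ.isUnit
  rw [zm_det, ← Int.cast_abs]
  rw [Int.isUnit_iff_abs_eq] at h
  simp [h]

lemma zm_inv_mul {n : Type*} [Fintype n] [DecidableEq n] (γ : (Matrix n n ℤ)ˣ) :
    zm (γ : Matrix n n ℤ) * zm (γ⁻¹ : (Matrix n n ℤ)ˣ) = 1 := by
  rw [← zm_mul, Units.mul_inv, zm_one]

lemma Good_zm {c : ℝ} {g : BMat M N} (h : Good c g) (γ : (Matrix (Fin M ⊕ Fin N) (Fin M ⊕ Fin N) ℤ)ˣ) :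
    Good c (g * zm γ) := by
  refine ⟨by rw [Matrix.det_mul, abs_mul, h.1, zm_unit_det, one_mul], fun v hv => ?_⟩
  rw [← Matrix.mulVec_mulVec, zm_mulVec]
  apply h.2
  intro h0
  apply hv
  have := congrArg (fun w => ((γ⁻¹ : (Matrix (Fin M ⊕ Fin N) (Fin M ⊕ Fin N) ℤ)ˣ) : Matrix (Fin M ⊕ Fin N) (Fin M ⊕ Fin N) ℤ) *ᵥ w) h0
  simpa [Matrix.mulVec_mulVec] using this

lemma orth_dot {n : Type*} [Fintype n] [DecidableEq n] {B : Matrix n n ℝ}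
    (hB : B ∈ Matrix.orthogonalGroup n ℝ) (x : n → ℝ) : (B *ᵥ x) ⬝ᵥ (B *ᵥ x) = x ⬝ᵥ x := by
  rw [Matrix.dotProduct_mulVec, Matrix.vecMul_mulVec, ← Matrix.dotProduct_mulVec]
  have : Bᵀ * B = 1 := by
    have := (Matrix.mem_orthogonalGroup_iff' (A := B)).1 hB
    simpa [Matrix.star_eq_conjTranspose] using this
  rw [this, Matrix.one_mulVec]

lemma blk_mulVec_inl (A : Matrix (Fin M) (Fin M) ℝ) (B : MatSpace M N) (C : Matrix (Fin N) (Fin M) ℝ)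
    (D : Matrix (Fin N) (Fin N) ℝ) (x : Fin M ⊕ Fin N → ℝ) :
    (fromBlocks A B C D *ᵥ x) ∘ Sum.inl = A *ᵥ (x ∘ Sum.inl) + B *ᵥ (x ∘ Sum.inr) := by
  rw [Matrix.fromBlocks_mulVec]; rfl

lemma blk_mulVec_inr (A : Matrix (Fin M) (Fin M) ℝ) (B : MatSpace M N) (C : Matrix (Fin N) (Fin M) ℝ)
    (D : Matrix (Fin N) (Fin N) ℝ) (x : Fin M ⊕ Fin N → ℝ) :
    (fromBlocks A B C D *ᵥ x) ∘ Sum.inr = C *ᵥ (x ∘ Sum.inl) + D *ᵥ (x ∘ Sum.inr) := by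
  rw [Matrix.fromBlocks_mulVec]; rfl

/-- Block diagonal matrix. -/
def Dg (t₁ t₂ : ℝ) (B : Matrix (Fin M) (Fin M) ℝ) (C : Matrix (Fin N) (Fin N) ℝ) : BMat M N :=
  fromBlocks (t₁ • B) 0 0 (t₂ • C)

lemma nform_Dg {t₁ t₂ : ℝ} (ht : t₁ ^ M * t₂ ^ N = 1) {B : Matrix (Fin M) (Fin M) ℝ}
    {C : Matrix (Fin N) (Fin N) ℝ} (hB : B ∈ Matrix.orthogonalGroup (Fin M) ℝ)
    (hC : C ∈ Matrix.orthogonalGroup (Fin N) ℝ) (x : Fin M ⊕ Fin N → ℝ) :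
    nform (Dg t₁ t₂ B C *ᵥ x) = nform x := by
  unfold nform Dg
  rw [blk_mulVec_inl, blk_mulVec_inr]
  simp only [Matrix.zero_mulVec, add_zero, zero_add, Matrix.smul_mulVec, dotProduct_smul, smul_dotProduct,
    smul_eq_mul, orth_dot hB, orth_dot hC, ← mul_assoc, mul_pow]
  calc _ = (t₁ ^ M * t₂ ^ N) * (t₁ ^ M * t₂ ^ N) * ((x ∘ Sum.inl ⬝ᵥ x ∘ Sum.inl) ^ M * (x ∘ Sum.inr ⬝ᵥ x ∘ Sum.inr) ^ N) := by ring
    _ = _ := by rw [ht]; ring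

lemma orth_det {n : Type*} [Fintype n] [DecidableEq n] {B : Matrix n n ℝ}
    (hB : B ∈ Matrix.orthogonalGroup n ℝ) : |B.det| = 1 := by
  have h : Bᵀ * B = 1 := by
    have := (Matrix.mem_orthogonalGroup_iff' (A := B)).1 hB
    simpa [Matrix.star_eq_conjTranspose] using this
  have := congrArg Matrix.det h
  rw [Matrix.det_mul, Matrix.det_transpose, Matrix.det_one, ← abs_mul_abs_self] at this
  nlinarith [abs_nonneg B.det]

lemma det_Dg {t₁ t₂ : ℝ} (ht : t₁ ^ M * t₂ ^ N = 1) {B : Matrix (Fin M) (Fin M) ℝ}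
    {C : Matrix (Fin N) (Fin N) ℝ} (hB : B ∈ Matrix.orthogonalGroup (Fin M) ℝ)
    (hC : C ∈ Matrix.orthogonalGroup (Fin N) ℝ) : |(Dg t₁ t₂ B C).det| = 1 := by
  unfold Dg
  rw [Matrix.det_fromBlocks_zero₂₁, Matrix.det_smul, Matrix.det_smul, Fintype.card_fin, Fintype.card_fin,
    abs_mul, abs_mul, abs_mul, orth_det hB, orth_det hC, mul_one, mul_one, ← abs_mul, ht, abs_one]

lemma Good_Dg {c : ℝ} {g : BMat M N} (h : Good c g) {t₁ t₂ : ℝ} (ht : t₁ ^ M * t₂ ^ N = 1) {B : Matrix (Fin M) (Fin M) ℝ}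
    {C : Matrix (Fin N) (Fin N) ℝ} (hB : B ∈ Matrix.orthogonalGroup (Fin M) ℝ)
    (hC : C ∈ Matrix.orthogonalGroup (Fin N) ℝ) : Good c (Dg t₁ t₂ B C * g) := by
  refine ⟨by rw [Matrix.det_mul, abs_mul, det_Dg ht hB hC, h.1, one_mul], fun v hv => ?_⟩
  rw [← Matrix.mulVec_mulVec, nform_Dg ht hB hC]
  exact h.2 v hv

/-- The scaling flow. -/
def el (M N : ℕ) (ρ : ℝ) : BMat M N :=
  Dg (ρ ^ ((N : ℝ) / (M + N))) (ρ ^ (-(M : ℝ) / (M + N))) 1 1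

lemma el_pow_eq (ρ : ℝ) (hρ : 0 < ρ) :
    (ρ ^ ((N : ℝ) / (M + N))) ^ M * (ρ ^ (-(M : ℝ) / (M + N))) ^ N = 1 := by
  rw [← Real.rpow_mul_natCast hρ.le, ← Real.rpow_mul_natCast hρ.le, ← Real.rpow_add hρ]
  rw [show (N : ℝ) / (M + N) * M + -(M : ℝ) / (M + N) * N = 0 by ring, Real.rpow_zero]

lemma Good_el {c : ℝ} {g : BMat M N} (h : Good c g) {ρ : ℝ} (hρ : 0 < ρ) : Good c (el M N ρ * g) :=
  Good_Dg h (el_pow_eq ρ hρ) (one_mem _) (one_mem _)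

lemma el_Um [NeZero M] (ρ : ℝ) (hρ : 0 < ρ) (α : MatSpace M N) : el M N ρ * Um α = Um (ρ • α) * el M N ρ := by
  have h : ρ ^ ((N : ℝ) / (M + N)) = ρ * ρ ^ (-(M : ℝ) / (M + N)) := by
    have hM : (0 : ℝ) < M := by exact_mod_cast Nat.pos_of_ne_zero (NeZero.ne M)
    have hN : (0 : ℝ) ≤ N := by positivity
    nth_rewrite 2 [← Real.rpow_one ρ]
    rw [← Real.rpow_add hρ]
    congr 1
    field_simp
    ring
  unfold el Um Dg
  rw [h]
  simp [fromBlocks_multiply, smul_smul, mul_comm]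

lemma el_mul_inv (ρ : ℝ) (hρ : 0 < ρ) : el M N ρ * el M N ρ⁻¹ = 1 := by
  unfold el Dg
  rw [fromBlocks_multiply]
  simp [smul_smul, Real.inv_rpow hρ.le, ← Real.rpow_neg hρ.le, ← Real.rpow_add hρ]

lemma el_inv_mul (ρ : ℝ) (hρ : 0 < ρ) : el M N ρ⁻¹ * el M N ρ = 1 := by
  have := el_mul_inv (M := M) (N := N) ρ⁻¹ (inv_pos.2 hρ)
  rwa [inv_inv] at this

lemma Good_reduce [NeZero M] (c : ℝ) (hc : 0 < c) : ∃ R : ℝ, ∀ g : BMat M N, Good c g →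
    ∃ γ : (Matrix (Fin M ⊕ Fin N) (Fin M ⊕ Fin N) ℤ)ˣ, ‖g * zm γ‖ ≤ R := by
  have h1 : ∃ δ > 0, ∀ x : Fin M ⊕ Fin N → ℝ, ‖x‖ < δ → nform x < c := by
    have := (nform_cont (M := M) (N := N)).tendsto 0
    rw [nform_zero] at this
    have := this.eventually (gt_mem_nhds hc)
    rw [Metric.eventually_nhds_iff] at this
    obtain ⟨δ, hδ, h⟩ := this
    exact ⟨δ, hδ, fun x hx => h (by simpa using hx)⟩
  obtain ⟨δ, hδ, h⟩ := h1
  obtain ⟨R, hR⟩ := mahler_compact (n := Fin M ⊕ Fin N) δ hδ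
  refine ⟨R, fun g hg => hR g hg.1 fun v hv => ?_⟩
  by_contra hlt
  push Not at hlt
  exact absurd (hg.2 v hv) (not_le.2 (h _ hlt))

lemma el_blocks (ρ : ℝ) (A : Matrix (Fin M) (Fin M) ℝ) (B : MatSpace M N) (C : Matrix (Fin N) (Fin M) ℝ)
    (D : Matrix (Fin N) (Fin N) ℝ) [NeZero M] (hρ : 0 < ρ) :
    el M N ρ * fromBlocks A B C D * el M N ρ⁻¹ = fromBlocks A (ρ • B) (ρ⁻¹ • C) D := by
  have h : ρ ^ ((N : ℝ) / (M + N)) = ρ * ρ ^ (-(M : ℝ) / (M + N)) := by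
    have hM : (0 : ℝ) < M := by exact_mod_cast Nat.pos_of_ne_zero (NeZero.ne M)
    have hN : (0 : ℝ) ≤ N := by positivity
    nth_rewrite 2 [← Real.rpow_one ρ]
    rw [← Real.rpow_add hρ]
    congr 1
    field_simp
    ring
  have h0 : ρ ^ (-(M : ℝ) / (M + N)) ≠ 0 := (Real.rpow_pos_of_pos hρ _).ne'
  unfold el Dg
  rw [Real.inv_rpow hρ.le, Real.inv_rpow hρ.le, h]
  simp only [fromBlocks_multiply, smul_mul_assoc, one_mul, Matrix.mul_smul, mul_one, Matrix.zero_mul, Matrix.mul_zero, add_zero, zero_add, smul_smul, Matrix.one_mul, Matrix.mul_one, Matrix.smul_mul]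
  congr 1
  · rw [mul_inv_cancel₀ (by positivity), one_smul]
  · congr 1; field_simp
  · congr 1; field_simp
  · rw [mul_inv_cancel₀ h0, one_smul]

end

section

/-- The compact group of pairs of orthogonal matrices. -/
abbrev KK (M N : ℕ) := Matrix.orthogonalGroup (Fin M) ℝ × Matrix.orthogonalGroup (Fin N) ℝ

variable {M N : ℕ}

instance orth_top_group (n : ℕ) : IsTopologicalGroup (Matrix.orthogonalGroup (Fin n) ℝ) := 
  inferInstanceAs (IsTopologicalGroup (unitary (Matrix (Fin n) (Fin n) ℝ)))

lemma orth_mul_transpose {n : Type*} [Fintype n] [DecidableEq n] {B : Matrix n n ℝ}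
    (hB : B ∈ Matrix.orthogonalGroup n ℝ) : B * Bᵀ = 1 := by
  have := (Matrix.mem_orthogonalGroup_iff (A := B)).1 hB
  simpa [Matrix.star_eq_conjTranspose] using this

lemma orth_transpose_mul {n : Type*} [Fintype n] [DecidableEq n] {B : Matrix n n ℝ}
    (hB : B ∈ Matrix.orthogonalGroup n ℝ) : Bᵀ * B = 1 := by
  have := (Matrix.mem_orthogonalGroup_iff' (A := B)).1 hB
  simpa [Matrix.star_eq_conjTranspose] using this

lemma orth_transpose_mem {n : Type*} [Fintype n] [DecidableEq n] {B : Matrix n n ℝ}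
    (hB : B ∈ Matrix.orthogonalGroup n ℝ) : Bᵀ ∈ Matrix.orthogonalGroup n ℝ := by
  rw [Matrix.mem_orthogonalGroup_iff]
  simpa [Matrix.star_eq_conjTranspose] using orth_transpose_mul hB

lemma orth_norm_le {n : Type*} [Fintype n] [DecidableEq n] {B : Matrix n n ℝ}
    (hB : B ∈ Matrix.orthogonalGroup n ℝ) : ‖B‖ ≤ 1 := by
  rw [Matrix.norm_le_iff zero_le_one]
  intro i j
  have h := congrFun (congrFun (orth_transpose_mul hB) j) j
  rw [Matrix.mul_apply'] at h
  simp only [Matrix.one_apply_eq] at h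
  have := abs_le_one_of_unit (u := fun i => B i j) (by simpa [dotProduct] using h) i
  simpa using this

instance orth_compact (n : ℕ) : CompactSpace (Matrix.orthogonalGroup (Fin n) ℝ) := by
  have hcl : IsClosed (unitary (Matrix (Fin n) (Fin n) ℝ) : Set (Matrix (Fin n) (Fin n) ℝ)) := isClosed_unitary
  apply (isCompact_iff_compactSpace (s := (Matrix.orthogonalGroup (Fin n) ℝ : Set (Matrix (Fin n) (Fin n) ℝ)))).1
  apply Metric.isCompact_of_isClosed_isBounded
  · exact hcl
  · rw [isBounded_iff_forall_norm_le]
    exact ⟨1, fun x hx => orth_norm_le hx⟩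

/-- Action of `KK` on matrices. -/
def act (k : KK M N) : MatSpace M N →ₗ[ℝ] MatSpace M N where
  toFun α := (k.1 : Matrix (Fin M) (Fin M) ℝ) * α * (k.2 : Matrix (Fin N) (Fin N) ℝ)ᵀ
  map_add' := by intro x y; rw [Matrix.mul_add, Matrix.add_mul]
  map_smul' := by intro x y; simp

lemma act_apply (k : KK M N) (α : MatSpace M N) :
    act k α = (k.1 : Matrix (Fin M) (Fin M) ℝ) * α * (k.2 : Matrix (Fin N) (Fin N) ℝ)ᵀ := rfl

lemma act_one (α : MatSpace M N) : act (1 : KK M N) α = α := by simp [act_apply]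

lemma act_mul (k l : KK M N) (α : MatSpace M N) : act (k * l) α = act k (act l α) := by
  simp [act_apply, Matrix.mul_assoc]

lemma act_inv_act (k : KK M N) (α : MatSpace M N) : act k⁻¹ (act k α) = α := by
  rw [← act_mul, inv_mul_cancel, act_one]

lemma act_act_inv (k : KK M N) (α : MatSpace M N) : act k (act k⁻¹ α) = α := by
  rw [← act_mul, mul_inv_cancel, act_one]

lemma act_cont : Continuous fun p : KK M N × MatSpace M N => act p.1 p.2 := by
  simp only [act_apply]
  apply Continuous.matrix_mul
  · apply Continuous.matrix_mul
    · exact continuous_subtype_val.comp (continuous_fst.comp continuous_fst)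
    · exact continuous_snd
  · exact (continuous_subtype_val.comp (continuous_snd.comp continuous_fst)).matrix_transpose

lemma act_cont' {X : Type*} [TopologicalSpace X] {f : X → KK M N} {g : X → MatSpace M N} (hf : Continuous f)
    (hg : Continuous g) : Continuous fun x => act (f x) (g x) := act_cont.comp (hf.prodMk hg)

/-- block diagonal embedding -/
def kap (k : KK M N) : BMat M N := fromBlocks (k.1 : Matrix (Fin M) (Fin M) ℝ) 0 0 (k.2 : Matrix (Fin N) (Fin N) ℝ)

lemma kap_one : kap (1 : KK M N) = 1 := by simp [kap]

lemma kap_mul (k l : KK M N) : kap (k * l) = kap k * kap l := by simp [kap, fromBlocks_multiply]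

lemma kap_inv_mul (k : KK M N) : kap k⁻¹ * kap k = 1 := by rw [← kap_mul, inv_mul_cancel, kap_one]

lemma kap_mul_inv (k : KK M N) : kap k * kap k⁻¹ = 1 := by rw [← kap_mul, mul_inv_cancel, kap_one]

lemma kap_Um (k : KK M N) (α : MatSpace M N) : kap k * Um α = Um (act k α) * kap k := by
  simp [kap, Um, act_apply, fromBlocks_multiply, Matrix.mul_assoc, orth_transpose_mul k.2.2]

lemma kap_cont : Continuous (kap : KK M N → BMat M N) := by
  unfold kap
  exact Continuous.matrix_fromBlocks (continuous_subtype_val.comp continuous_fst) continuous_const continuous_const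
    (continuous_subtype_val.comp continuous_snd)

lemma Good_kap {c : ℝ} {g : BMat M N} (h : Good c g) (k : KK M N) : Good c (kap k * g) := by
  have := Good_Dg h (t₁ := 1) (t₂ := 1) (by simp) k.1.2 k.2.2
  simpa [Dg, kap] using this

lemma kap_el (k : KK M N) (ρ : ℝ) : kap k * el M N ρ = el M N ρ * kap k := by
  simp [kap, el, Dg, fromBlocks_multiply]

lemma act_norm_le (k : KK M N) (α : MatSpace M N) : ‖act k α‖ ≤ (M * N : ℝ) * ‖α‖ := by
  rw [act_apply]
  have h1 := orth_norm_le k.1.2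
  have h2 := orth_norm_le (orth_transpose_mem k.2.2)
  have h3 := norm_mul_le_card ((k.1 : Matrix (Fin M) (Fin M) ℝ) * α) (k.2 : Matrix (Fin N) (Fin N) ℝ)ᵀ
  have h4 := norm_mul_le_card (k.1 : Matrix (Fin M) (Fin M) ℝ) α
  simp only [Fintype.card_fin] at h3 h4
  calc _ ≤ _ := h3
    _ ≤ N * ((M * (1 * ‖α‖)) * 1) := by
        gcongr
        refine h4.trans ?_
        gcongr
    _ = _ := by ring

lemma norm_le_act (k : KK M N) (α : MatSpace M N) : ‖α‖ ≤ (M * N : ℝ) * ‖act k α‖ := by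
  have := act_norm_le k⁻¹ (act k α)
  rwa [act_inv_act] at this

end

section

/-- A finite homogeneous system of similarities fixing `0` for one distinguished index. -/
structure CD (ι : Type) (M N : ℕ) where
  i0 : ι
  ρ : ℝ
  hρ0 : 0 < ρ
  hρ1 : ρ < 1
  T : ι → KK M N
  δ : ι → MatSpace M N
  hδ : δ i0 = 0

variable {M N : ℕ} {ι : Type}

namespace CD

variable (D : CD ι M N)

/-- rotational part -/
def tau (b : ℕ → ι) : ℕ → KK M N
  | 0 => 1
  | m + 1 => D.T (b m) * tau b m

/-- translation part -/
def ss (b : ℕ → ι) : ℕ → MatSpace M N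
  | 0 => 0
  | m + 1 => D.ρ • act (D.T (b m)) (ss b m) + D.δ (b m)

/-- concatenation -/
def cat (m : ℕ) (b a : ℕ → ι) : ℕ → ι := fun j => if j < m then b j else a (j - m)

/-- splicing -/
def spl (m : ℕ) (a b : ℕ → ι) : ℕ → ι := fun j => if j < m then a j else b j

lemma tau_congr {a b : ℕ → ι} : ∀ {m : ℕ}, (∀ j < m, a j = b j) → D.tau a m = D.tau b m
  | 0, _ => rfl
  | m + 1, h => by
      simp only [tau]
      rw [h m (Nat.lt_succ_self m), tau_congr fun j hj => h j (hj.trans (Nat.lt_succ_self m))]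

lemma ss_congr {a b : ℕ → ι} : ∀ {m : ℕ}, (∀ j < m, a j = b j) → D.ss a m = D.ss b m
  | 0, _ => rfl
  | m + 1, h => by
      simp only [ss]
      rw [h m (Nat.lt_succ_self m), ss_congr fun j hj => h j (hj.trans (Nat.lt_succ_self m))]

lemma tau_spl (m : ℕ) (a b : ℕ → ι) : D.tau (spl m a b) m = D.tau a m :=
  D.tau_congr fun j hj => by simp [spl, hj]

lemma ss_spl (m : ℕ) (a b : ℕ → ι) : D.ss (spl m a b) m = D.ss a m :=
  D.ss_congr fun j hj => by simp [spl, hj]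

lemma tau_cat (m : ℕ) (b a : ℕ → ι) (q : ℕ) : D.tau (cat m b a) (m + q) = D.tau a q * D.tau b m := by
  induction q with
  | zero =>
    simp only [add_zero, tau, one_mul]
    exact D.tau_congr fun j hj => by simp [cat, hj]
  | succ q ih =>
    rw [← add_assoc, tau, ih, tau, mul_assoc]
    simp [cat]

lemma ss_cat (m : ℕ) (b a : ℕ → ι) (q : ℕ) :
    D.ss (cat m b a) (m + q) = D.ρ ^ q • act (D.tau a q) (D.ss b m) + D.ss a q := by
  induction q with
  | zero =>
    simp only [add_zero, tau, ss, pow_zero, one_smul, act_one]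
    exact D.ss_congr fun j hj => by simp [cat, hj]
  | succ q ih =>
    rw [← add_assoc, ss, ih, ss, tau]
    simp only [cat, add_tsub_cancel_left, if_neg (not_lt.2 (Nat.le_add_right m q)), map_add, map_smul, act_mul,
      smul_add, smul_smul, pow_succ']
    abel

lemma ss_const (m : ℕ) : D.ss (fun _ => D.i0) m = 0 := by
  induction m with
  | zero => rfl
  | succ m ih => simp [ss, ih, D.hδ]

lemma tau_const (m : ℕ) : D.tau (fun _ => D.i0) m = D.T D.i0 ^ m := by
  induction m with
  | zero => rfl
  | succ m ih => simp [tau, ih, pow_succ']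

/-- padding on the left by the distinguished letter -/
def pad (m : ℕ) (a : ℕ → ι) : ℕ → ι := cat m (fun _ => D.i0) a

lemma ss_pad (m : ℕ) (a : ℕ → ι) (q : ℕ) : D.ss (D.pad m a) (m + q) = D.ss a q := by
  rw [pad, ss_cat, ss_const]; simp

lemma tau_pad (m : ℕ) (a : ℕ → ι) (q : ℕ) : D.tau (D.pad m a) (m + q) = D.tau a q * D.T D.i0 ^ m := by
  rw [pad, tau_cat, tau_const]

section cont
variable [TopologicalSpace ι] [DiscreteTopology ι]

lemma tau_cont (m : ℕ) : Continuous fun b : ℕ → ι => D.tau b m := by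
  induction m with
  | zero => exact continuous_const
  | succ m ih =>
    simp only [tau]
    exact ((continuous_of_discreteTopology (f := D.T)).comp (continuous_apply m)).mul ih

lemma ss_cont (m : ℕ) : Continuous fun b : ℕ → ι => D.ss b m := by
  induction m with
  | zero => exact continuous_const
  | succ m ih =>
    simp only [ss]
    refine Continuous.add ((act_cont' ?_ ih).const_smul D.ρ) ?_
    · exact (continuous_of_discreteTopology (f := D.T)).comp (continuous_apply m)
    · exact (continuous_of_discreteTopology (f := D.δ)).comp (continuous_apply m)

end cont

end CD

/-- state space -/
abbrev St (ι : Type) (M N : ℕ) := (ℕ → ι) × KK M N × BMat M N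

/-- integral unimodular matrices -/
abbrev GLZ (M N : ℕ) := (Matrix (Fin M ⊕ Fin N) (Fin M ⊕ Fin N) ℤ)ˣ

/-- right multiplication by an integral matrix -/
def rg (γ : GLZ M N) (y : St ι M N) : St ι M N := (y.1, y.2.1, y.2.2 * zm γ)

/-- translation along the unipotent group -/
def sh (t : MatSpace M N) (y : St ι M N) : St ι M N := (y.1, y.2.1, Um t * y.2.2)

namespace CD
variable (D : CD ι M N)

/-- The displacement vector -/
def dsp (m : ℕ) (a : ℕ → ι) (b : ℕ → ι) (k : KK M N) : MatSpace M N :=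
  (D.ρ ^ m)⁻¹ • act (k * (D.tau b m)⁻¹) (D.ss a m - D.ss b m)

/-- change of the first `m` letters -/
def mv (m : ℕ) (a : ℕ → ι) (y : St ι M N) : St ι M N :=
  (spl m a y.1, y.2.1 * (D.tau y.1 m)⁻¹ * D.tau a m, Um (D.dsp m a y.1 y.2.1) * y.2.2)

lemma mv_congr {m : ℕ} {a a' : ℕ → ι} (h : ∀ j < m, a j = a' j) (y : St ι M N) : D.mv m a y = D.mv m a' y := by
  unfold mv dsp
  rw [D.tau_congr h, D.ss_congr h]
  congr 1
  funext j
  simp only [spl]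
  split_ifs with hj
  · exact h j hj
  · rfl

lemma mv_succ (n : ℕ) (c : ℕ → ι) (y : St ι M N) (h : c n = y.1 n) : D.mv (n + 1) c y = D.mv n c y := by
  unfold mv dsp
  have h1 : spl (n + 1) c y.1 = spl n c y.1 := by
    funext j
    simp only [spl]
    by_cases hj : j < n
    · simp [hj, hj.trans (Nat.lt_succ_self n)]
    · by_cases hj' : j = n
      · subst hj'; simp [h]
      · have : ¬ j < n + 1 := by omega
        simp [hj, this]
  have h2 : y.2.1 * (D.tau y.1 (n + 1))⁻¹ * D.tau c (n + 1) = y.2.1 * (D.tau y.1 n)⁻¹ * D.tau c n := by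
    simp only [tau, h]; group
  have h3 : (D.ρ ^ (n + 1))⁻¹ • act (y.2.1 * (D.tau y.1 (n + 1))⁻¹) (D.ss c (n + 1) - D.ss y.1 (n + 1))
      = (D.ρ ^ n)⁻¹ • act (y.2.1 * (D.tau y.1 n)⁻¹) (D.ss c n - D.ss y.1 n) := by
    have h0 := D.hρ0.ne'
    simp only [tau, ss, h, add_sub_add_right_eq_sub, ← smul_sub, ← map_sub, _root_.mul_inv_rev]
    rw [← mul_assoc, act_mul]
    simp only [map_smul]
    rw [act_inv_act, smul_smul]
    congr 1
    field_simp
    ring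
  rw [h1, h2, h3]

lemma mv_ext {m n : ℕ} (hmn : m ≤ n) (a : ℕ → ι) (y : St ι M N) : D.mv m a y = D.mv n (spl m a y.1) y := by
  induction n, hmn using Nat.le_induction with
  | base =>
    apply D.mv_congr
    intro j hj; simp [spl, hj]
  | succ n hn ih =>
    rw [ih, mv_succ]
    simp [spl, not_lt.2 hn]

lemma mv_mv (n : ℕ) (a a' : ℕ → ι) (y : St ι M N) : D.mv n a (D.mv n a' y) = D.mv n a y := by
  unfold mv dsp
  simp only [tau_spl, ss_spl]
  have h1 : spl n a (spl n a' y.1) = spl n a y.1 := by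
    funext j; simp only [spl]; split_ifs <;> rfl
  rw [h1, mul_inv_cancel_right, ← mul_assoc, Um_mul, ← smul_add, ← map_add, sub_add_sub_cancel]

lemma mv_mv_ex (m p : ℕ) (a a' : ℕ → ι) (y : St ι M N) : ∃ n a'', D.mv m a (D.mv p a' y) = D.mv n a'' y := by
  refine ⟨max m p, spl m a (D.mv p a' y).1, ?_⟩
  rw [D.mv_ext (le_max_left m p) a, D.mv_ext (le_max_right m p) a' y, mv_mv]

lemma mv_rg (m : ℕ) (a : ℕ → ι) (γ : GLZ M N) (y : St ι M N) : D.mv m a (rg γ y) = rg γ (D.mv m a y) := by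
  simp [mv, rg, mul_assoc]

lemma mv_sh (m : ℕ) (a : ℕ → ι) (t : MatSpace M N) (y : St ι M N) : D.mv m a (sh t y) = sh t (D.mv m a y) := by
  simp [mv, sh, ← mul_assoc, Um_mul, add_comm]

lemma rg_sh (t : MatSpace M N) (γ : GLZ M N) (y : St ι M N) : rg γ (sh t y) = sh t (rg γ y) := by
  simp [rg, sh, mul_assoc]

lemma mv_cont [TopologicalSpace ι] [DiscreteTopology ι] (m : ℕ) (a : ℕ → ι) : Continuous (D.mv m a) := by
  unfold mv dsp
  have hb : Continuous fun y : St ι M N => y.1 := continuous_fst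
  have hk : Continuous fun y : St ι M N => y.2.1 := continuous_fst.comp continuous_snd
  have hg : Continuous fun y : St ι M N => y.2.2 := continuous_snd.comp continuous_snd
  have ht := (D.tau_cont m).comp hb
  have hs := (D.ss_cont m).comp hb
  refine Continuous.prodMk ?_ (Continuous.prodMk ?_ ?_)
  · refine continuous_pi fun j => ?_
    simp only [spl]
    split_ifs
    · exact continuous_const
    · exact (continuous_apply j).comp hb
  · exact (hk.mul ht.inv).mul continuous_const
  · have h1 : Continuous fun y : St ι M N => act (y.2.1 * (D.tau y.1 m)⁻¹) (D.ss a m - D.ss y.1 m) :=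
      act_cont' (hk.mul ht.inv) (continuous_const.sub hs)
    exact (Um_cont.comp (h1.const_smul ((D.ρ ^ m)⁻¹))).mul hg

end CD

lemma rg_cont [TopologicalSpace ι] (γ : GLZ M N) : Continuous (rg γ : St ι M N → St ι M N) := by
  unfold rg
  fun_prop

lemma sh_cont [TopologicalSpace ι] : Continuous fun p : MatSpace M N × St ι M N => sh p.1 p.2 := by
  unfold sh
  have := Um_cont (M := M) (N := N)
  fun_prop

lemma sh_sh (t u : MatSpace M N) (y : St ι M N) : sh t (sh u y) = sh (t + u) y := by
  simp [sh, ← mul_assoc, Um_mul]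

lemma sh_zero (y : St ι M N) : sh 0 y = y := by simp [sh, Um_zero]

lemma rg_rg_inv (γ : GLZ M N) (y : St ι M N) : rg γ (rg γ⁻¹ y) = y := by
  have := zm_inv_mul (γ⁻¹)
  rw [inv_inv] at this
  simp only [rg, mul_assoc, this, mul_one]

end

section

variable {M N : ℕ} {ι : Type} [TopologicalSpace ι] [DiscreteTopology ι] [Finite ι]

/-- closed invariant set -/
structure Inva (D : CD ι M N) (Z : Set (St ι M N)) : Prop where
  closed : IsClosed Z
  ne : Z.Nonempty
  mv : ∀ m a, ∀ y ∈ Z, D.mv m a y ∈ Z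
  rg : ∀ γ, ∀ y ∈ Z, rg γ y ∈ Z

/-- minimal invariant set of good lattices -/
structure MinSys (D : CD ι M N) (c R : ℝ) (Z : Set (St ι M N)) : Prop extends Inva D Z where
  good : ∀ y ∈ Z, Good c y.2.2
  red : ∀ y ∈ Z, ∃ γ : GLZ M N, ‖y.2.2 * zm γ‖ ≤ R
  min : ∀ Z' ⊆ Z, Inva D Z' → Z' = Z

lemma box_compact (R : ℝ) : IsCompact {y : St ι M N | ‖y.2.2‖ ≤ R} := by
  have h : {y : St ι M N | ‖y.2.2‖ ≤ R} = Set.univ ×ˢ (Set.univ ×ˢ Metric.closedBall 0 R) := by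
    ext y; simp
  rw [h]
  haveI : CompactSpace ι := Finite.compactSpace
  exact isCompact_univ.prod (isCompact_univ.prod (isCompact_closedBall _ _))

lemma g_cont : Continuous fun y : St ι M N => y.2.2 := continuous_snd.comp continuous_snd

lemma mv_zero_eq (D : CD ι M N) (a : ℕ → ι) (y : St ι M N) : D.mv 0 a y = y := by
  have h : CD.spl 0 a y.1 = y.1 := by funext j; simp [CD.spl]
  simp [CD.mv, CD.dsp, CD.tau, CD.ss, Um_zero, h]

lemma start_aux [NeZero M] (D : CD ι M N) (c : ℝ) (g0 : BMat M N)
    (h0 : ∀ b m, Good c (Um (D.ss b m) * g0)) (γ : GLZ M N) (m q : ℕ) (a : ℕ → ι) :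
    Good c (Um (D.dsp m a (fun _ => D.i0) (D.T D.i0 ^ (m + q))) * (el M N (D.ρ ^ (m + q))⁻¹ * g0 * zm γ)) := by
  have hρn : 0 < (D.ρ ^ (m + q))⁻¹ := inv_pos.2 (pow_pos D.hρ0 _)
  have e1 : D.T D.i0 ^ (m + q) * (D.T D.i0 ^ m)⁻¹ = D.T D.i0 ^ q := by
    rw [add_comm m q, pow_add, mul_inv_cancel_right]
  have e2 := D.ss_cat m a (fun _ => D.i0) q
  rw [D.ss_const, D.tau_const, add_zero] at e2
  have e3 : D.dsp m a (fun _ => D.i0) (D.T D.i0 ^ (m + q)) =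
      (D.ρ ^ (m + q))⁻¹ • D.ss (CD.cat m a fun _ => D.i0) (m + q) := by
    rw [CD.dsp, D.tau_const, e1, D.ss_const, sub_zero, e2, smul_smul, pow_add]
    congr 1
    have := D.hρ0.ne'
    field_simp
  rw [e3, ← mul_assoc, ← mul_assoc, ← el_Um _ hρn, mul_assoc (el M N _)]
  exact Good_zm (Good_el (h0 _ _) hρn) γ

lemma start_state [NeZero M] (D : CD ι M N) (c R : ℝ) (g0 : BMat M N)
    (h0 : ∀ b m, Good c (Um (D.ss b m) * g0))
    (hR : ∀ g : BMat M N, Good c g → ∃ γ : GLZ M N, ‖g * zm γ‖ ≤ R) (n : ℕ) :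
    ∃ y : St ι M N, ‖y.2.2‖ ≤ R ∧ ∀ m, m ≤ n → ∀ a, Good c (D.mv m a y).2.2 := by
  have hρn : 0 < (D.ρ ^ n)⁻¹ := inv_pos.2 (pow_pos D.hρ0 n)
  have hg0 : Good c g0 := by
    have := h0 (fun _ => D.i0) 0
    simpa [CD.ss, Um_zero] using this
  obtain ⟨γ, hγ⟩ := hR _ (Good_el hg0 hρn)
  obtain ⟨y, hy⟩ : ∃ y : St ι M N, y = ((fun _ => D.i0 : ℕ → ι), D.T D.i0 ^ n, el M N (D.ρ ^ n)⁻¹ * g0 * zm γ) := ⟨_, rfl⟩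
  refine ⟨y, by rw [hy]; exact hγ, ?_⟩
  intro m hmn a
  obtain ⟨q, rfl⟩ := Nat.exists_eq_add_of_le hmn
  have := start_aux D c g0 h0 γ m q a
  rw [hy]
  exact this

lemma exists_minSys [NeZero M] (D : CD ι M N) (c : ℝ) (hc : 0 < c) (g0 : BMat M N)
    (h0 : ∀ b m, Good c (Um (D.ss b m) * g0)) : ∃ R Z, MinSys D c R Z := by
  obtain ⟨R, hR⟩ := Good_reduce (M := M) (N := N) c hc
  set Ω : Set (St ι M N) := {y | ∀ m a, Good c (D.mv m a y).2.2} with hΩ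
  have hcl : ∀ m a, IsClosed {y : St ι M N | Good c (D.mv m a y).2.2} := fun m a =>
    (Good_closed c).preimage (g_cont.comp (D.mv_cont m a))
  have hrgR : ∀ y ∈ Ω, ∃ γ : GLZ M N, ‖y.2.2 * zm γ‖ ≤ R := by
    intro y hy
    have := hy 0 (fun _ => D.i0)
    rw [mv_zero_eq] at this
    exact hR _ this
  have hΩi : Inva D Ω := by
    refine ⟨?_, ?_, ?_, ?_⟩
    · have : Ω = ⋂ m, ⋂ a, {y : St ι M N | Good c (D.mv m a y).2.2} := by ext y; simp [hΩ]
      rw [this]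
      exact isClosed_iInter fun m => isClosed_iInter fun a => hcl m a
    · set K : ℕ → Set (St ι M N) := fun n => {y | ‖y.2.2‖ ≤ R} ∩ ⋂ m, ⋂ (_ : m ≤ n), ⋂ a, {y : St ι M N | Good c (D.mv m a y).2.2}
      have hKc : ∀ n, IsClosed (⋂ m, ⋂ (_ : m ≤ n), ⋂ a, {y : St ι M N | Good c (D.mv m a y).2.2}) := fun n =>
        isClosed_iInter fun m => isClosed_iInter fun _ => isClosed_iInter fun a => hcl m a
      have hKcpt : ∀ n, IsCompact (K n) := fun n => (box_compact R).inter_right (hKc n)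
      have hKne : ∀ n, (K n).Nonempty := by
        intro n
        obtain ⟨y, hy1, hy2⟩ := start_state D c R g0 h0 hR n
        exact ⟨y, hy1, by simp only [Set.mem_iInter]; exact hy2⟩
      obtain ⟨y, hy⟩ := IsCompact.nonempty_iInter_of_sequence_nonempty_isCompact_isClosed K
        (by
          intro n
          refine Set.inter_subset_inter_right _ ?_
          intro y hy
          simp only [Set.mem_iInter] at hy ⊢
          exact fun m hm a => hy m (hm.trans (Nat.le_succ n)) a)
        hKne (hKcpt 0) (fun n => (hKcpt n).isClosed)
      refine ⟨y, fun m a => ?_⟩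
      have := (Set.mem_iInter.1 hy m).2
      simp only [Set.mem_iInter] at this
      exact this m le_rfl a
    · intro m a y hy m' a'
      obtain ⟨n, a'', h⟩ := D.mv_mv_ex m' m a' a y
      rw [h]; exact hy n a''
    · intro γ y hy m a
      rw [D.mv_rg]
      exact Good_zm (hy m a) γ
  set S : Set (Set (St ι M N)) := {Z | Z ⊆ Ω ∧ Inva D Z} with hS
  obtain ⟨Z, hZ⟩ := zorn_superset S (by
    intro ch hch hchain
    rcases ch.eq_empty_or_nonempty with rfl | hne
    · exact ⟨Ω, ⟨subset_rfl, hΩi⟩, by simp⟩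
    refine ⟨⋂₀ ch, ⟨?_, ?_, ?_, ?_, ?_⟩, fun s hs => Set.sInter_subset_of_mem hs⟩
    · obtain ⟨s, hs⟩ := hne
      exact (Set.sInter_subset_of_mem hs).trans (hch hs).1
    · exact isClosed_sInter fun s hs => (hch hs).2.closed
    · have : (⋂ s : ch, ((s : Set (St ι M N)) ∩ {y | ‖y.2.2‖ ≤ R})).Nonempty := by
        haveI : Nonempty ch := hne.to_subtype
        apply IsCompact.nonempty_iInter_of_directed_nonempty_isCompact_isClosed
        · intro s t
          rcases hchain.total s.2 t.2 with h | h
          · exact ⟨s, subset_rfl, Set.inter_subset_inter_left _ h⟩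
          · exact ⟨t, Set.inter_subset_inter_left _ h, subset_rfl⟩
        · intro s
          obtain ⟨y, hy⟩ := (hch s.2).2.ne
          obtain ⟨γ, hγ⟩ := hrgR y ((hch s.2).1 hy)
          exact ⟨rg γ y, (hch s.2).2.rg γ y hy, hγ⟩
        · intro s
          exact (box_compact R).inter_left (hch s.2).2.closed
        · intro s
          exact ((box_compact R).inter_left (hch s.2).2.closed).isClosed
      obtain ⟨y, hy⟩ := this
      refine ⟨y, fun s hs => ?_⟩
      exact (Set.mem_iInter.1 hy ⟨s, hs⟩).1
    · intro m a y hy s hs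
      exact (hch hs).2.mv m a y (hy s hs)
    · intro γ y hy s hs
      exact (hch hs).2.rg γ y (hy s hs))
  refine ⟨R, Z, { hZ.1.2 with good := ?_, red := fun y hy => hrgR y (hZ.1.1 hy), min := ?_ }⟩
  · intro y hy
    have := hZ.1.1 hy 0 (fun _ => D.i0)
    rwa [mv_zero_eq] at this
  · intro Z' hZ' hi
    exact subset_antisymm hZ' (hZ.2 (y := Z') ⟨hZ'.trans hZ.1.1, hi⟩ hZ')

/-- the stabilizer -/
def Hset (Z : Set (St ι M N)) : Set (MatSpace M N) := {t | ∀ y ∈ Z, sh t y ∈ Z}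

namespace MinSys

variable {D : CD ι M N} {c R : ℝ} {Z : Set (St ι M N)}

lemma mem_H (h : MinSys D c R Z) {t : MatSpace M N} {y : St ι M N} (hy : y ∈ Z) (hty : sh t y ∈ Z) :
    t ∈ Hset Z := by
  have key : {y | y ∈ Z ∧ sh t y ∈ Z} = Z := by
    apply h.min
    · exact fun y hy => hy.1
    · refine ⟨?_, ⟨y, hy, hty⟩, ?_, ?_⟩
      · exact h.closed.inter (h.closed.preimage (sh_cont.comp (continuous_const.prodMk continuous_id)))
      · intro m a y hy
        exact ⟨h.mv m a y hy.1, by rw [← D.mv_sh]; exact h.mv m a _ hy.2⟩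
      · intro γ y hy
        exact ⟨h.rg γ y hy.1, by rw [← CD.rg_sh]; exact h.rg γ _ hy.2⟩
  intro y' hy'
  rw [← key] at hy'
  exact hy'.2

lemma H_neg (h : MinSys D c R Z) {t : MatSpace M N} (ht : t ∈ Hset Z) : -t ∈ Hset Z := by
  have key : {y | sh (-t) y ∈ Z} = Z := by
    apply h.min
    · intro y hy
      have := ht _ hy
      rwa [sh_sh, add_neg_cancel, sh_zero] at this
    · refine ⟨?_, ?_, ?_, ?_⟩
      · exact h.closed.preimage (sh_cont.comp (continuous_const.prodMk continuous_id))
      · obtain ⟨y, hy⟩ := h.ne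
        refine ⟨sh t y, ?_⟩
        simpa [sh_sh, sh_zero] using hy
      · intro m a y hy
        change sh (-t) (D.mv m a y) ∈ Z
        rw [← D.mv_sh]; exact h.mv m a _ hy
      · intro γ y hy
        change sh (-t) (_root_.rg γ y) ∈ Z
        rw [← CD.rg_sh]; exact h.rg γ _ hy
  intro y hy
  rw [← key] at hy
  exact hy

lemma H_add (h : MinSys D c R Z) {t u : MatSpace M N} (ht : t ∈ Hset Z) (hu : u ∈ Hset Z) : t + u ∈ Hset Z := by
  intro y hy
  rw [← sh_sh]
  exact ht _ (hu _ hy)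

lemma H_zero : (0 : MatSpace M N) ∈ Hset Z := by
  intro y hy; rwa [sh_zero]

lemma H_closed (h : MinSys D c R Z) : IsClosed (Hset Z) := by
  have : Hset Z = ⋂ y ∈ Z, {t | sh t y ∈ Z} := by ext t; simp [Hset]
  rw [this]
  exact isClosed_biInter fun y _ => h.closed.preimage (sh_cont.comp (continuous_id.prodMk continuous_const))

/-- The stabilizer as a closed subgroup -/
def Hgrp (h : MinSys D c R Z) : AddSubgroup (MatSpace M N) where
  carrier := Hset Z
  add_mem' := h.H_add
  zero_mem' := H_zero
  neg_mem' := h.H_neg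

end MinSys

end

section

lemma closed_subgroup_gap {E : Type*} [NormedAddCommGroup E] [NormedSpace ℝ E] [FiniteDimensional ℝ E]
    (H : AddSubgroup E) (hH : IsClosed (H : Set E)) :
    ∃ V : Submodule ℝ E, (∀ t ∈ V, t ∈ H) ∧ ∃ ε > 0, ∀ t ∈ H, ‖t‖ < ε → t ∈ V := by
  let V : Submodule ℝ E :=
    { carrier := {t | ∀ r : ℝ, r • t ∈ H}
      add_mem' := by intro a b ha hb r; rw [smul_add]; exact H.add_mem (ha r) (hb r)
      zero_mem' := by intro r; rw [smul_zero]; exact H.zero_mem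
      smul_mem' := by intro s t ht r; rw [smul_smul]; exact ht _ }
  have hVH : ∀ t ∈ V, t ∈ H := by
    intro t ht
    have := ht 1
    rwa [one_smul] at this
  refine ⟨V, hVH, ?_⟩
  by_contra hcon
  push Not at hcon
  obtain ⟨W, hW⟩ := V.exists_isCompl
  let p : E →ₗ[ℝ] E := W.projection V hW.symm
  have hpc : Continuous p := p.continuous_of_finiteDimensional
  have hpV : ∀ t, t - p t ∈ V := by
    intro t
    rw [show t - p t = V.projection W hW t from (Submodule.projection_eq_self_sub_projection hW.symm t).symm]
    exact Submodule.projection_apply_mem _ _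
  choose t ht1 ht2 ht3 using fun n : ℕ => hcon (1 / ((n : ℝ) + 1)) (by positivity)
  have ht0 : Tendsto t atTop (𝓝 0) := by
    rw [tendsto_zero_iff_norm_tendsto_zero]
    exact squeeze_zero (fun n => norm_nonneg _) (fun n => (ht2 n).le) tendsto_one_div_add_atTop_nhds_zero_nat
  set w : ℕ → E := fun n => p (t n) with hw
  have hwH : ∀ n, w n ∈ H := by
    intro n
    have := H.sub_mem (ht1 n) (hVH _ (hpV (t n)))
    simpa using this
  have hw0 : ∀ n, w n ≠ 0 := by
    intro n h0
    have := hpV (t n)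
    rw [show p (t n) = 0 from h0, sub_zero] at this
    exact ht3 n this
  have hwt : Tendsto w atTop (𝓝 0) := by
    have := (hpc.tendsto 0).comp ht0
    rwa [map_zero] at this
  have hwn : Tendsto (fun n => ‖w n‖) atTop (𝓝 0) := by simpa using hwt.norm
  obtain ⟨u, hu, φ, hφ, hlim⟩ := (isCompact_sphere (0 : E) 1).tendsto_subseq
    (x := fun n => ‖w n‖⁻¹ • w n) (fun n => by simp [norm_smul, hw0 n])
  have hun : ‖u‖ = 1 := by simpa using hu
  have huW : u ∈ W := by
    have hWc : IsClosed (W : Set E) := W.closed_of_finiteDimensional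
    refine hWc.mem_of_tendsto hlim (Eventually.of_forall fun n => ?_)
    exact W.smul_mem _ (Submodule.projection_apply_mem _ _)
  have huV : u ∈ V := by
    intro r
    have hlim2 : Tendsto (fun n => (⌊r * ‖w (φ n)‖⁻¹⌋ : ℤ) • w (φ n)) atTop (𝓝 (r • u)) := by
      have h1 : Tendsto (fun n => r • (‖w (φ n)‖⁻¹ • w (φ n))) atTop (𝓝 (r • u)) := hlim.const_smul r
      have h2 : Tendsto (fun n => Int.fract (r * ‖w (φ n)‖⁻¹) • w (φ n)) atTop (𝓝 0) := by
        rw [tendsto_zero_iff_norm_tendsto_zero]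
        refine squeeze_zero (fun n => norm_nonneg _) (fun n => ?_) (hwn.comp hφ.tendsto_atTop)
        rw [norm_smul, Real.norm_eq_abs, abs_of_nonneg (Int.fract_nonneg _)]
        exact mul_le_of_le_one_left (norm_nonneg _) (Int.fract_lt_one _).le
      have h3 := h1.sub h2
      rw [sub_zero] at h3
      refine h3.congr fun n => ?_
      rw [smul_smul, ← sub_smul, Int.self_sub_fract, Int.cast_smul_eq_zsmul]
    exact hH.mem_of_tendsto hlim2 (Eventually.of_forall fun n => H.zsmul_mem (hwH _) _)
  have : u = 0 := by
    have := hW.disjoint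
    exact Submodule.disjoint_def.1 this u huV huW
  rw [this, norm_zero] at hun
  exact zero_ne_one hun

end

section

variable {M N : ℕ}

lemma exists_dot_of_notMem {n : Type*} [Fintype n] {S : Submodule ℝ (n → ℝ)} {v : n → ℝ} (hv : v ∉ S) :
    ∃ b : n → ℝ, b ⬝ᵥ v ≠ 0 ∧ ∀ x ∈ S, b ⬝ᵥ x = 0 := by
  classical
  obtain ⟨f, hf, hker⟩ := Submodule.exists_le_ker_of_notMem hv
  have hfu : ∀ x, f x = (fun i => f (Pi.single i 1)) ⬝ᵥ x := by
    intro x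
    rw [LinearMap.pi_apply_eq_sum_univ f x]
    simp only [dotProduct, smul_eq_mul]
    refine Finset.sum_congr rfl fun i _ => ?_
    rw [mul_comm]
    congr 2
    funext j
    simp [Pi.single_apply, eq_comm]
  refine ⟨fun i => f (Pi.single i 1), by rw [← hfu]; exact hf, fun x hx => ?_⟩
  rw [← hfu]
  exact hker hx

lemma nform_small [NeZero M] (c : ℝ) (hc : 0 < c) :
    ∃ δ > 0, ∀ x : Fin M ⊕ Fin N → ℝ, ‖x‖ < δ → nform x < c := by
  have := (nform_cont (M := M) (N := N)).tendsto 0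
  rw [nform_zero] at this
  have := this.eventually (gt_mem_nhds hc)
  rw [Metric.eventually_nhds_iff] at this
  obtain ⟨δ, hδ, h⟩ := this
  exact ⟨δ, hδ, fun x hx => h (by simpa using hx)⟩

lemma Um_mulVec_inl (t : MatSpace M N) (x : Fin M ⊕ Fin N → ℝ) :
    (Um t *ᵥ x) ∘ Sum.inl = x ∘ Sum.inl + t *ᵥ (x ∘ Sum.inr) := by
  rw [Um, blk_mulVec_inl, Matrix.one_mulVec]

lemma Um_mulVec_inr (t : MatSpace M N) (x : Fin M ⊕ Fin N → ℝ) :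
    (Um t *ᵥ x) ∘ Sum.inr = x ∘ Sum.inr := by
  rw [Um, blk_mulVec_inr, Matrix.one_mulVec, Matrix.zero_mulVec, zero_add]

lemma not_kill [NeZero M] {c : ℝ} (hc : 0 < c) {g : BMat M N} {t : MatSpace M N} (h : Good c (Um t * g))
    {v : Fin M ⊕ Fin N → ℤ} (hv : v ≠ 0)
    (h0 : t *ᵥ ((g *ᵥ zc v) ∘ Sum.inr) = - ((g *ᵥ zc v) ∘ Sum.inl)) : False := by
  have := h.2 v hv
  rw [← Matrix.mulVec_mulVec, nform, Um_mulVec_inl, h0, add_neg_cancel, zero_dotProduct,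
    zero_pow (NeZero.ne M), zero_mul] at this
  linarith

lemma inr_ne_zero [NeZero N] {c : ℝ} (hc : 0 < c) {g : BMat M N} (h : Good c g)
    {v : Fin M ⊕ Fin N → ℤ} (hv : v ≠ 0) : (g *ᵥ zc v) ∘ Sum.inr ≠ 0 := by
  intro h0
  have := h.2 v hv
  rw [nform, h0, zero_dotProduct, zero_pow (NeZero.ne N), mul_zero] at this
  linarith

lemma vecMulVec_mid (a : Fin M → ℝ) (b : Fin N → ℝ) (Z : Matrix (Fin N) (Fin M) ℝ) :
    vecMulVec a b * Z * vecMulVec a b = (b ⬝ᵥ (Z *ᵥ a)) • vecMulVec a b := by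
  rw [Matrix.vecMulVec_mul, Matrix.vecMulVec_mul_vecMulVec, ← Matrix.dotProduct_mulVec]
  ext i j
  simp [vecMulVec]
  ring

lemma vmv_mulVec (a : Fin M → ℝ) (b : Fin N → ℝ) (q : Fin N → ℝ) :
    vecMulVec a b *ᵥ q = (b ⬝ᵥ q) • a := by
  rw [Matrix.vecMulVec_mulVec]
  ext i
  simp [mul_comm]

lemma nV_Z [NeZero M] [NeZero N] {c : ℝ} (hc : 0 < c) {g : BMat M N} (V : Submodule ℝ (MatSpace M N))
    (hV : ∀ t ∈ V, Good c (Um t * g)) (Z : Matrix (Fin N) (Fin M) ℝ)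
    (hF : ∀ ξ : MatSpace M N, ξ * Z * ξ ∈ V) : Z = 0 := by
  by_contra hZ
  have hg : Good c g := by simpa [Um_zero] using hV 0 V.zero_mem
  let v : Fin M ⊕ Fin N → ℤ := fun _ => 1
  have hv : v ≠ 0 := by
    intro h
    have := congrFun h (Sum.inl ⟨0, Nat.pos_of_ne_zero (NeZero.ne M)⟩)
    simp [v] at this
  set q := (g *ᵥ zc v) ∘ Sum.inr with hq
  have hq0 : q ≠ 0 := inr_ne_zero hc hg hv
  have hqq : q ⬝ᵥ q ≠ 0 := fun h => hq0 (dotProduct_self_eq_zero.1 h)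
  obtain ⟨e, he⟩ : ∃ e : Fin N → ℝ, e ᵥ* Z ≠ 0 := by
    by_contra hcon
    push Not at hcon
    apply hZ
    ext i j
    have := congrFun (hcon (Pi.single i 1)) j
    simpa using this
  obtain ⟨b, hbq, hbZ⟩ : ∃ b : Fin N → ℝ, b ⬝ᵥ q ≠ 0 ∧ b ᵥ* Z ≠ 0 := by
    by_cases h1 : q ᵥ* Z = 0
    · by_cases h2 : e ⬝ᵥ q = 0
      · refine ⟨e + q, ?_, ?_⟩
        · rw [add_dotProduct, h2, zero_add]; exact hqq
        · rw [Matrix.add_vecMul, h1, add_zero]; exact he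
      · exact ⟨e, h2, he⟩
    · exact ⟨q, hqq, h1⟩
  have hmem1 : ∀ a : Fin M → ℝ, b ⬝ᵥ (Z *ᵥ a) ≠ 0 → vecMulVec a b ∈ V := by
    intro a ha
    have := V.smul_mem (b ⬝ᵥ (Z *ᵥ a))⁻¹ (hF (vecMulVec a b))
    rwa [vecMulVec_mid, smul_smul, inv_mul_cancel₀ ha, one_smul] at this
  have hmem : ∀ a : Fin M → ℝ, vecMulVec a b ∈ V := by
    intro a
    by_cases ha : b ⬝ᵥ (Z *ᵥ a) = 0
    · set a1 : Fin M → ℝ := b ᵥ* Z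
      have h1 : b ⬝ᵥ (Z *ᵥ a1) ≠ 0 := by
        rw [Matrix.dotProduct_mulVec]
        exact fun h => hbZ (dotProduct_self_eq_zero.1 h)
      have h2 := hmem1 a1 h1
      have h3 := hmem1 (a + a1) (by rw [Matrix.mulVec_add, dotProduct_add, ha, zero_add]; exact h1)
      have := V.sub_mem h3 h2
      rwa [Matrix.add_vecMulVec, add_sub_cancel_right] at this
    · exact hmem1 a ha
  refine not_kill hc (hV _ (hmem (-((b ⬝ᵥ q)⁻¹ • ((g *ᵥ zc v) ∘ Sum.inl))))) hv ?_
  rw [vmv_mulVec, smul_neg, smul_smul, mul_inv_cancel₀ hbq, one_smul]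

lemma nV_Y_eig [NeZero M] [NeZero N] {c : ℝ} (hc : 0 < c) {g : BMat M N} (V : Submodule ℝ (MatSpace M N))
    (hV : ∀ t ∈ V, Good c (Um t * g)) (X : Matrix (Fin M) (Fin M) ℝ) (Y : Matrix (Fin N) (Fin N) ℝ)
    (hF : ∀ ξ : MatSpace M N, ξ * Y - X * ξ ∈ V) {v : Fin M ⊕ Fin N → ℤ} (hv : v ≠ 0) :
    ∃ y : ℝ, Y *ᵥ ((g *ᵥ zc v) ∘ Sum.inr) = y • ((g *ᵥ zc v) ∘ Sum.inr) := by
  set q := (g *ᵥ zc v) ∘ Sum.inr with hq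
  by_contra hcon
  have hn : Y *ᵥ q ∉ Submodule.span ℝ {q} := by
    intro h
    obtain ⟨y, hy⟩ := Submodule.mem_span_singleton.1 h
    exact hcon ⟨y, hy.symm⟩
  obtain ⟨b, hb1, hb2⟩ := exists_dot_of_notMem hn
  have hbq : b ⬝ᵥ q = 0 := hb2 q (Submodule.mem_span_singleton_self q)
  set a : Fin M → ℝ := -((b ⬝ᵥ (Y *ᵥ q))⁻¹ • ((g *ᵥ zc v) ∘ Sum.inl))
  refine not_kill hc (hV _ (hF (vecMulVec a b))) hv ?_
  rw [← hq, Matrix.sub_mulVec, ← Matrix.mulVec_mulVec, ← Matrix.mulVec_mulVec, vmv_mulVec, vmv_mulVec, hbq,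
    zero_smul, Matrix.mulVec_zero, sub_zero]
  simp only [a]
  rw [smul_neg, smul_smul, mul_inv_cancel₀ hb1, one_smul]

lemma eig_eq {n : Type*} [Fintype n] {Y : Matrix n n ℝ} {q r : n → ℝ} (hq : q ≠ 0) (hr : r ≠ 0) {a b y : ℝ}
    (h1 : Y *ᵥ q = a • q) (h2 : Y *ᵥ r = b • r) (h3 : Y *ᵥ (q + r) = y • (q + r)) : a = b := by
  rw [Matrix.mulVec_add, h1, h2, smul_add] at h3
  have h4 : (y - a) • q = (b - y) • r := by
    rw [sub_smul, sub_smul]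
    rw [sub_eq_sub_iff_add_eq_add, ← h3]
    abel
  by_cases hya : y = a
  · rw [hya, sub_self, zero_smul, eq_comm, smul_eq_zero] at h4
    rcases h4 with h4 | h4
    · linarith
    · exact absurd h4 hr
  · have h5 : y - a ≠ 0 := sub_ne_zero.2 hya
    have h6 : q = ((y - a)⁻¹ * (b - y)) • r := by
      rw [mul_smul, ← h4, smul_smul, inv_mul_cancel₀ h5, one_smul]
    have h7 : Y *ᵥ q = b • q := by
      rw [h6, Matrix.mulVec_smul, h2, smul_comm]
    rw [h1] at h7
    have : (a - b) • q = 0 := by rw [sub_smul, h7, sub_self]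
    rcases smul_eq_zero.1 this with h | h
    · linarith
    · exact absurd h hq

lemma nV_Y [NeZero M] [NeZero N] {c : ℝ} (hc : 0 < c) {g : BMat M N} (V : Submodule ℝ (MatSpace M N))
    (hV : ∀ t ∈ V, Good c (Um t * g)) (X : Matrix (Fin M) (Fin M) ℝ) (Y : Matrix (Fin N) (Fin N) ℝ)
    (hF : ∀ ξ : MatSpace M N, ξ * Y - X * ξ ∈ V) : ∃ y : ℝ, Y = y • 1 := by
  have hg : Good c g := by simpa [Um_zero] using hV 0 V.zero_mem
  have heig := fun (v : Fin M ⊕ Fin N → ℤ) (hv : v ≠ 0) => nV_Y_eig hc V hV X Y hF hv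
  set e : Fin M ⊕ Fin N → (Fin M ⊕ Fin N → ℤ) := fun i => Pi.single i 1 with he
  have he0 : ∀ i, e i ≠ 0 := by intro i h; have := congrFun h i; simp [he] at this
  choose lam hlam using fun i => heig (e i) (he0 i)
  set q : Fin M ⊕ Fin N → (Fin N → ℝ) := fun i => (g *ᵥ zc (e i)) ∘ Sum.inr with hq
  have hq0 : ∀ i, q i ≠ 0 := fun i => inr_ne_zero hc hg (he0 i)
  have hall : ∀ i j, lam i = lam j := by
    intro i j
    have hij : e i + e j ≠ 0 := by
      intro h
      have := congrFun h i
      by_cases hij : i = j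
      · subst hij; simp [he] at this
      · simp [he, hij] at this
    obtain ⟨y, hy⟩ := heig _ hij
    have hadd : (g *ᵥ zc (e i + e j)) ∘ Sum.inr = q i + q j := by
      have : zc (e i + e j) = zc (e i) + zc (e j) := by funext k; simp [zc]
      rw [this, Matrix.mulVec_add]; rfl
    rw [hadd] at hy
    exact eig_eq (hq0 i) (hq0 j) (hlam i) (hlam j) hy
  set i0 : Fin M ⊕ Fin N := Sum.inl ⟨0, Nat.pos_of_ne_zero (NeZero.ne M)⟩
  refine ⟨lam i0, ?_⟩
  have hq' : ∀ i, Y *ᵥ q i = lam i0 • q i := by intro i; rw [← hall i i0]; exact hlam i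
  have hqcol : ∀ i k, q i k = g (Sum.inr k) i := by
    intro i k
    have : zc (e i) = Pi.single i 1 := by
      funext k; simp only [zc, he, Pi.single_apply]; split_ifs <;> simp
    simp [hq, this]
  have hx : ∀ x : Fin M ⊕ Fin N → ℝ, Y *ᵥ ((g *ᵥ x) ∘ Sum.inr) = lam i0 • ((g *ᵥ x) ∘ Sum.inr) := by
    intro x
    have : (g *ᵥ x) ∘ Sum.inr = ∑ i, x i • q i := by
      funext k
      simp [Matrix.mulVec, dotProduct, hqcol, mul_comm]
    rw [this, Matrix.mulVec_sum, Finset.smul_sum]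
    refine Finset.sum_congr rfl fun i _ => ?_
    rw [Matrix.mulVec_smul, hq' i, smul_comm]
  have hdet : IsUnit g.det := by
    rw [isUnit_iff_ne_zero]
    intro h
    have := hg.1
    rw [h] at this
    simp at this
  have hw : ∀ w : Fin N → ℝ, Y *ᵥ w = lam i0 • w := by
    intro w
    have := hx (g⁻¹ *ᵥ (Sum.elim 0 w))
    rw [Matrix.mulVec_mulVec, Matrix.mul_nonsing_inv _ hdet, Matrix.one_mulVec] at this
    exact this
  ext i j
  have := congrFun (hw (Pi.single j 1)) i
  simpa [Matrix.one_apply, Pi.single_apply] using this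

lemma nV_X [NeZero M] [NeZero N] {c : ℝ} (hc : 0 < c) {g : BMat M N} (V : Submodule ℝ (MatSpace M N))
    (hV : ∀ t ∈ V, Good c (Um t * g)) (X : Matrix (Fin M) (Fin M) ℝ)
    (hF : ∀ ξ : MatSpace M N, X * ξ ∈ V) : X = 0 := by
  by_contra hX
  have hg : Good c g := by simpa [Um_zero] using hV 0 V.zero_mem
  obtain ⟨a, ha⟩ : ∃ a, X *ᵥ a ≠ 0 := by
    by_contra hcon
    push Not at hcon
    apply hX
    ext i j
    have := congrFun (hcon (Pi.single j 1)) i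
    simpa using this
  set w := X *ᵥ a with hw
  have hww : 0 < w ⬝ᵥ w := by
    have h1 : 0 ≤ w ⬝ᵥ w := by
      unfold dotProduct
      exact Finset.sum_nonneg fun i _ => mul_self_nonneg _
    rcases h1.lt_or_eq with h | h
    · exact h
    · exact absurd (dotProduct_self_eq_zero.1 h.symm) ha
  have hmem : ∀ b, vecMulVec w b ∈ V := by
    intro b
    have := hF (vecMulVec a b)
    rwa [Matrix.mul_vecMulVec] at this
  set r := (Real.sqrt (w ⬝ᵥ w))⁻¹
  set u : Fin M ⊕ Fin N → ℝ := Sum.elim (r • w) 0 with hu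
  have huu : u ⬝ᵥ u = 1 := by
    rw [hu, sumElim_dotProduct_sumElim, zero_dotProduct, add_zero]
    rw [dotProduct_smul, smul_dotProduct, smul_eq_mul, smul_eq_mul, ← mul_assoc, ← mul_inv,
      Real.mul_self_sqrt hww.le, inv_mul_cancel₀ hww.ne']
  obtain ⟨δ, hδ, hsm⟩ := nform_small (M := M) (N := N) c hc
  obtain ⟨v, hv, y, hy, h1, -⟩ := squeeze g hg.1 u huu (δ / 4) (by positivity)
  set x := g *ᵥ zc v with hx
  set l := (1 - (δ / 4) ^ Fintype.card (Fin M ⊕ Fin N)) * (u ⬝ᵥ x)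
  set q := x ∘ Sum.inr with hq
  have hq0 : q ≠ 0 := inr_ne_zero hc hg hv
  have hqq : q ⬝ᵥ q ≠ 0 := fun h => hq0 (dotProduct_self_eq_zero.1 h)
  set b : Fin N → ℝ := (-(l * r) * (q ⬝ᵥ q)⁻¹) • q with hb
  have hbad := (hV _ (hmem b)).2 v hv
  have heq : (Um (vecMulVec w b) * g) *ᵥ zc v = (δ / 4) • y := by
    rw [← Matrix.mulVec_mulVec, ← hx]
    funext i
    rcases i with i | i
    · have := congrFun (Um_mulVec_inl (vecMulVec w b) x) i
      rw [← hq, vmv_mulVec] at this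
      simp only [Function.comp_apply] at this
      rw [this]
      have h2 := congrFun h1 (Sum.inl i)
      simp only [Pi.add_apply, Function.comp_apply]
      rw [h2, hb, smul_dotProduct]
      simp only [hu, Pi.add_apply, Pi.smul_apply, smul_eq_mul, Sum.elim_inl]
      field_simp
      ring
    · have := congrFun (Um_mulVec_inr (vecMulVec w b) x) i
      simp only [Function.comp_apply] at this
      rw [this, h1]
      simp [hu]
  rw [heq] at hbad
  have : ‖(δ / 4) • y‖ < δ := by
    have hy2 : ‖y‖ ≤ 2 := by
      rw [pi_norm_le_iff_of_nonneg (by norm_num)]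
      exact hy
    rw [norm_smul, Real.norm_eq_abs, abs_of_pos (by positivity)]
    nlinarith
  exact absurd hbad (not_le.2 (hsm _ this))

theorem nV_zero [NeZero M] [NeZero N] {c : ℝ} (hc : 0 < c) {g : BMat M N} (V : Submodule ℝ (MatSpace M N))
    (hV : ∀ t ∈ V, Good c (Um t * g)) (X : Matrix (Fin M) (Fin M) ℝ) (Y : Matrix (Fin N) (Fin N) ℝ)
    (Z : Matrix (Fin N) (Fin M) ℝ) (hF : ∀ ξ : MatSpace M N, ξ * Y - X * ξ - ξ * Z * ξ ∈ V)
    (htr : X.trace + Y.trace = 0) : X = 0 ∧ Y = 0 ∧ Z = 0 := by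
  have hZ : Z = 0 := by
    refine nV_Z hc V hV Z fun ξ => ?_
    have h1 := V.add_mem (hF ξ) (hF (-ξ))
    have h2 := V.smul_mem (-(1 / 2) : ℝ) h1
    convert h2 using 1
    simp only [Matrix.neg_mul, Matrix.mul_neg, neg_neg]
    rw [show ξ * Y - X * ξ - ξ * Z * ξ + (-(ξ * Y) - -(X * ξ) - ξ * Z * ξ) = (-2 : ℝ) • (ξ * Z * ξ) by module]
    rw [smul_smul]; norm_num
  subst hZ
  simp only [Matrix.mul_zero, Matrix.zero_mul, sub_zero] at hF
  obtain ⟨y, rfl⟩ := nV_Y hc V hV X Y hF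
  have hX : y • (1 : Matrix (Fin M) (Fin M) ℝ) - X = 0 := by
    refine nV_X hc V hV _ fun ξ => ?_
    have := hF ξ
    simpa [Matrix.sub_mul] using this
  have hX' : X = y • 1 := (sub_eq_zero.1 hX).symm
  subst hX'
  have hy : y = 0 := by
    simp only [Matrix.trace_smul, Matrix.trace_one, Fintype.card_fin, smul_eq_mul, ← mul_add] at htr
    have hM : (0 : ℝ) < M := by exact_mod_cast Nat.pos_of_ne_zero (NeZero.ne M)
    have hN : (0 : ℝ) ≤ N := by positivity
    rcases mul_eq_zero.1 htr with h | h
    · exact h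
    · linarith
  simp [hy]

end

section

variable {M N : ℕ} {ι : Type}

/-- the orbit of `0` -/
def CD.PP (D : CD ι M N) : Set (MatSpace M N) := {x | ∃ b m, x = D.ss b m}

lemma bil_bound {E : Type*} [NormedAddCommGroup E] [NormedSpace ℝ E] [FiniteDimensional ℝ E]
    (B : E →ₗ[ℝ] E →ₗ[ℝ] ℝ) : ∃ CB : ℝ, ∀ x y : E, |B x y| ≤ CB * ‖x‖ * ‖y‖ := by
  let B' : E →L[ℝ] E →L[ℝ] ℝ :=
    LinearMap.toContinuousLinearMap ((LinearMap.toContinuousLinearMap :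
        (E →ₗ[ℝ] ℝ) ≃ₗ[ℝ] (E →L[ℝ] ℝ)).toLinearMap ∘ₗ B)
  exact ⟨‖B'‖, fun x y => B'.le_opNorm₂ x y⟩

lemma quad_lin (D : CD ι M N) (hspan : Submodule.span ℝ D.PP = ⊤) (c0 : ℝ) (l : MatSpace M N →ₗ[ℝ] ℝ)
    (B : MatSpace M N →ₗ[ℝ] MatSpace M N →ₗ[ℝ] ℝ)
    (h : ∀ b m, c0 + l (D.ss b m) + B (D.ss b m) (D.ss b m) = 0) : c0 = 0 ∧ l = 0 := by
  have hc0 : c0 = 0 := by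
    have := h (fun _ => D.i0) 0
    simpa [CD.ss] using this
  refine ⟨hc0, ?_⟩
  set T := D.T D.i0
  let W : Submodule ℝ (MatSpace M N) :=
    { carrier := {y | Tendsto (fun q : ℕ => l (act (T ^ q) y)) atTop (𝓝 0)}
      add_mem' := by
        intro a b ha hb
        have := Tendsto.add ha hb
        simpa using this
      zero_mem' := by simp
      smul_mem' := by
        intro r x hx
        have := Tendsto.const_mul r hx
        simpa using this }
  have hBb : ∃ CB : ℝ, ∀ x y : MatSpace M N, |B x y| ≤ CB * ‖x‖ * ‖y‖ := by
    exact bil_bound B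
  obtain ⟨CB, hCB⟩ := hBb
  have hPW : ∀ y ∈ D.PP, y ∈ W := by
    rintro y ⟨b, m, rfl⟩
    have e : ∀ q : ℕ, l (act (T ^ q) (D.ss b m)) =
        - (D.ρ ^ q * B (act (T ^ q) (D.ss b m)) (act (T ^ q) (D.ss b m))) := by
      intro q
      have h1 := h (CD.cat m b fun _ => D.i0) (m + q)
      rw [D.ss_cat, D.ss_const, D.tau_const, hc0, add_zero, zero_add] at h1
      simp only [map_smul, smul_eq_mul, LinearMap.smul_apply] at h1
      have hp : D.ρ ^ q ≠ 0 := (pow_pos D.hρ0 q).ne'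
      have : D.ρ ^ q * (l (act (T ^ q) (D.ss b m)) +
        D.ρ ^ q * B (act (T ^ q) (D.ss b m)) (act (T ^ q) (D.ss b m))) = 0 := by
        linear_combination h1
      have := (mul_eq_zero.1 this).resolve_left hp
      linarith
    change Tendsto _ _ _
    have h2 : Tendsto (fun q : ℕ => D.ρ ^ q * (|CB| * ((M * N : ℝ) * ‖D.ss b m‖) * ((M * N : ℝ) * ‖D.ss b m‖)))
        atTop (𝓝 0) := by
      have := (tendsto_pow_atTop_nhds_zero_of_lt_one D.hρ0.le D.hρ1).mul_const
        (|CB| * ((M * N : ℝ) * ‖D.ss b m‖) * ((M * N : ℝ) * ‖D.ss b m‖))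
      simpa using this
    refine squeeze_zero_norm (fun q => ?_) h2
    rw [e q, norm_neg, norm_mul, Real.norm_eq_abs, abs_of_pos (pow_pos D.hρ0 q)]
    refine mul_le_mul_of_nonneg_left ?_ (pow_pos D.hρ0 q).le
    have h3 := act_norm_le (T ^ q) (D.ss b m)
    refine (hCB _ _).trans ?_
    have := le_abs_self CB
    gcongr
  have hW : W = ⊤ := by
    rw [eq_top_iff, ← hspan]
    exact Submodule.span_le.2 hPW
  have hall : ∀ y, Tendsto (fun q : ℕ => l (act (T ^ q) y)) atTop (𝓝 0) := by
    intro y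
    have : y ∈ W := hW ▸ Submodule.mem_top
    exact this
  ext1 y
  have hsum : Tendsto (fun q : ℕ => ∑ i, ∑ j, ((M * N : ℝ) * ‖y‖) * |l (act (T ^ q) (Matrix.single i j 1))|) atTop (𝓝 0) := by
    have : Tendsto (fun q : ℕ => ∑ i : Fin M, ∑ j : Fin N, ((M * N : ℝ) * ‖y‖) * |l (act (T ^ q) (Matrix.single i j 1))|)
        atTop (𝓝 (∑ i : Fin M, ∑ j : Fin N, ((M * N : ℝ) * ‖y‖) * |(0:ℝ)|)) :=
      tendsto_finsetSum _ fun i _ => tendsto_finsetSum _ fun j _ => ((hall _).abs.const_mul _)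
    simpa using this
  have hb : ∀ q : ℕ, |l y| ≤ ∑ i, ∑ j, ((M * N : ℝ) * ‖y‖) * |l (act (T ^ q) (Matrix.single i j 1))| := by
    intro q
    set x := act (T ^ q)⁻¹ y with hx
    have hy : y = act (T ^ q) x := by rw [hx, act_act_inv]
    have hxn : ‖x‖ ≤ (M * N : ℝ) * ‖y‖ := act_norm_le _ _
    have e1 : l y = ∑ i, ∑ j, x i j * l (act (T ^ q) (Matrix.single i j 1)) := by
      conv_lhs => rw [hy, Matrix.matrix_eq_sum_single x]
      simp only [map_sum]
      refine Finset.sum_congr rfl fun i _ => Finset.sum_congr rfl fun j _ => ?_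
      rw [show Matrix.single i j (x i j) = x i j • Matrix.single i j (1:ℝ) by simp, map_smul, map_smul, smul_eq_mul]
    rw [e1]
    refine (Finset.abs_sum_le_sum_abs _ _).trans (Finset.sum_le_sum fun i _ => ?_)
    refine (Finset.abs_sum_le_sum_abs _ _).trans (Finset.sum_le_sum fun j _ => ?_)
    rw [abs_mul]
    refine mul_le_mul_of_nonneg_right ?_ (abs_nonneg _)
    exact (Matrix.norm_entry_le_entrywise_sup_norm x).trans hxn
  have := ge_of_tendsto' hsum hb
  simpa using le_antisymm this (abs_nonneg _)

lemma quad_zero (D : CD ι M N) (hspan : Submodule.span ℝ D.PP = ⊤) (c0 : ℝ) (l : MatSpace M N →ₗ[ℝ] ℝ)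
    (B : MatSpace M N →ₗ[ℝ] MatSpace M N →ₗ[ℝ] ℝ)
    (h : ∀ b m, c0 + l (D.ss b m) + B (D.ss b m) (D.ss b m) = 0) (ξ : MatSpace M N) :
    c0 + l ξ + B ξ ξ = 0 := by
  obtain ⟨rfl, rfl⟩ := quad_lin D hspan c0 l B h
  have h1 : ∀ s ∈ D.PP, ∀ y, B y s + B s y = 0 := by
    rintro s ⟨a, q, rfl⟩ y
    set τ := D.tau a q
    set s := D.ss a q
    have hp : D.ρ ^ q ≠ 0 := (pow_pos D.hρ0 q).ne'
    have := (quad_lin D hspan (B s s) (D.ρ ^ q • (B.flip s ∘ₗ act τ + B s ∘ₗ act τ))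
      ((D.ρ ^ q * D.ρ ^ q) • B.compl₁₂ (act τ) (act τ)) (fun b m => by
        have h2 := h (CD.cat m b a) (m + q)
        rw [D.ss_cat] at h2
        simp only [LinearMap.zero_apply, map_add, map_smul, LinearMap.add_apply, LinearMap.smul_apply, smul_eq_mul,
          zero_add] at h2
        simp only [LinearMap.smul_apply, LinearMap.add_apply, LinearMap.comp_apply, LinearMap.flip_apply,
          LinearMap.compl₁₂_apply, smul_eq_mul]
        linear_combination h2)).2
    have h3 := LinearMap.congr_fun this (act τ⁻¹ y)
    simp only [LinearMap.smul_apply, LinearMap.add_apply, LinearMap.comp_apply, LinearMap.flip_apply, act_act_inv,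
      LinearMap.zero_apply, smul_eq_mul] at h3
    exact (mul_eq_zero.1 h3).resolve_left hp
  let W : Submodule ℝ (MatSpace M N) := LinearMap.ker (B + B.flip)
  have hW : ξ ∈ W := by
    have : (⊤ : Submodule ℝ (MatSpace M N)) ≤ W := by
      rw [← hspan]
      refine Submodule.span_le.2 fun s hs => ?_
      refine LinearMap.mem_ker.2 (LinearMap.ext fun y => ?_)
      have := h1 s hs y
      simp only [LinearMap.add_apply, LinearMap.flip_apply, LinearMap.zero_apply]
      linarith
    exact this Submodule.mem_top
  have h4 := LinearMap.congr_fun (LinearMap.mem_ker.1 hW) ξ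
  simp only [LinearMap.add_apply, LinearMap.flip_apply, LinearMap.zero_apply] at h4
  simp only [LinearMap.zero_apply]
  linarith

/-- the vector valued version used below -/
lemma quad_mem (D : CD ι M N) (hspan : Submodule.span ℝ D.PP = ⊤) (V : Submodule ℝ (MatSpace M N))
    (X : Matrix (Fin M) (Fin M) ℝ) (Y : Matrix (Fin N) (Fin N) ℝ)
    (Z : Matrix (Fin N) (Fin M) ℝ) (o : KK M N) (c : MatSpace M N)
    (h : ∀ b m, act o (D.ss b m - c) * Y - X * act o (D.ss b m - c)
      - act o (D.ss b m - c) * Z * act o (D.ss b m - c) ∈ V) (ξ : MatSpace M N) :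
    ξ * Y - X * ξ - ξ * Z * ξ ∈ V := by
  by_contra hn
  obtain ⟨f, hf, hker⟩ := Submodule.exists_le_ker_of_notMem hn
  let F1 : MatSpace M N →ₗ[ℝ] MatSpace M N :=
    { toFun := fun ξ => ξ * Y - X * ξ
      map_add' := by intro x y; simp only [Matrix.add_mul, Matrix.mul_add]; abel
      map_smul' := by intro r x; simp [smul_sub] }
  let F2 : MatSpace M N →ₗ[ℝ] MatSpace M N →ₗ[ℝ] MatSpace M N :=
    LinearMap.mk₂ ℝ (fun ξ η => ξ * Z * η) (by intro x y z; simp [Matrix.add_mul]) (by intro r x y; simp)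
      (by intro x y z; simp [Matrix.mul_add]) (by intro r x y; simp)
  have hF1 : ∀ ξ, F1 ξ = ξ * Y - X * ξ := fun _ => rfl
  have hF2 : ∀ ξ η, F2 ξ η = ξ * Z * η := fun _ _ => rfl
  have key := quad_zero D hspan (- f (F1 (act o c)) - f (F2 (act o c) (act o c)))
    (f ∘ₗ F1 ∘ₗ act o + (f ∘ₗ F2 (act o c) ∘ₗ act o) + f ∘ₗ F2.flip (act o c) ∘ₗ act o)
    (-((F2.compr₂ f).compl₁₂ (act o) (act o))) (fun b m => by
      have h1 : f _ = 0 := hker (h b m)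
      rw [← hF1, ← hF2] at h1
      simp only [map_sub, LinearMap.sub_apply] at h1
      simp only [LinearMap.add_apply, LinearMap.comp_apply, LinearMap.flip_apply, LinearMap.neg_apply,
        LinearMap.compl₁₂_apply, LinearMap.compr₂_apply]
      linear_combination h1) (act o⁻¹ ξ + c)
  apply hf
  rw [← hF1, ← hF2]
  simp only [LinearMap.add_apply, LinearMap.comp_apply, LinearMap.flip_apply, LinearMap.neg_apply,
        LinearMap.compl₁₂_apply, LinearMap.compr₂_apply, map_add, act_act_inv] at key
  simp only [map_sub]
  linear_combination key

end

section

variable {M N : ℕ}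

lemma conj_blk (α : MatSpace M N) (X : Matrix (Fin M) (Fin M) ℝ) (W : MatSpace M N) (Z : Matrix (Fin N) (Fin M) ℝ)
    (Y : Matrix (Fin N) (Fin N) ℝ) : Um α * fromBlocks X W Z Y * Um (-α) =
      fromBlocks (X + α * Z) (W + (α * Y - X * α - α * Z * α)) Z (Y - Z * α) := by
  simp only [Um, fromBlocks_multiply, Matrix.one_mul, Matrix.zero_mul, Matrix.mul_one, Matrix.mul_zero, add_zero,
    zero_add, Matrix.mul_neg, Matrix.add_mul]
  congr 1 <;> abel

lemma uf_lim {X : Type*} [TopologicalSpace X] (U : Ultrafilter ℕ) {K : Set X} (hK : IsCompact K) (f : ℕ → X)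
    (hf : ∀ᶠ j in (U : Filter ℕ), f j ∈ K) : ∃ x ∈ K, Tendsto f U (𝓝 x) := by
  obtain ⟨x, hx, h⟩ := hK.ultrafilter_le_nhds (U.map f) (by rw [le_principal_iff]; exact hf)
  exact ⟨x, hx, h⟩

lemma uf_lim_norm {E : Type*} [NormedAddCommGroup E] [ProperSpace E] (U : Ultrafilter ℕ) (C : ℝ) (f : ℕ → E)
    (hf : ∀ᶠ j in (U : Filter ℕ), ‖f j‖ ≤ C) : ∃ x, ‖x‖ ≤ C ∧ Tendsto f U (𝓝 x) := by
  obtain ⟨x, hx, h⟩ := uf_lim U (isCompact_closedBall (0 : E) C) f (by simpa using hf)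
  exact ⟨x, by simpa using hx, h⟩

lemma tendsto_mmul {a b c : ℕ} {l : Filter ℕ} {f : ℕ → Matrix (Fin a) (Fin b) ℝ} {g : ℕ → Matrix (Fin b) (Fin c) ℝ}
    {x : Matrix (Fin a) (Fin b) ℝ} {y : Matrix (Fin b) (Fin c) ℝ} (hf : Tendsto f l (𝓝 x)) (hg : Tendsto g l (𝓝 y)) :
    Tendsto (fun j => f j * g j) l (𝓝 (x * y)) := by
  have h : Continuous fun p : Matrix (Fin a) (Fin b) ℝ × Matrix (Fin b) (Fin c) ℝ => p.1 * p.2 :=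
    continuous_fst.matrix_mul continuous_snd
  exact (h.tendsto (x, y)).comp (hf.prodMk_nhds hg)

lemma tendsto_fromBlocks {l : Filter ℕ} {A : ℕ → Matrix (Fin M) (Fin M) ℝ} {B : ℕ → MatSpace M N}
    {C : ℕ → Matrix (Fin N) (Fin M) ℝ} {D : ℕ → Matrix (Fin N) (Fin N) ℝ}
    {A' : Matrix (Fin M) (Fin M) ℝ} {B' : MatSpace M N}
    {C' : Matrix (Fin N) (Fin M) ℝ} {D' : Matrix (Fin N) (Fin N) ℝ} (hA : Tendsto A l (𝓝 A')) (hB : Tendsto B l (𝓝 B'))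
    (hC : Tendsto C l (𝓝 C')) (hD : Tendsto D l (𝓝 D')) :
    Tendsto (fun j => (fromBlocks (A j) (B j) (C j) (D j) : BMat M N)) l (𝓝 (fromBlocks A' B' C' D')) := by
  have h : Continuous fun p : Matrix (Fin M) (Fin M) ℝ × MatSpace M N × Matrix (Fin N) (Fin M) ℝ × Matrix (Fin N) (Fin N) ℝ =>
      (fromBlocks p.1 p.2.1 p.2.2.1 p.2.2.2 : BMat M N) :=
    Continuous.matrix_fromBlocks (by fun_prop) (by fun_prop) (by fun_prop) (by fun_prop)
  exact (h.tendsto (A', B', C', D')).comp (hA.prodMk_nhds (hB.prodMk_nhds (hC.prodMk_nhds hD)))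

lemma kap_norm_le (k : KK M N) : ‖kap k‖ ≤ 1 := by
  rw [Matrix.norm_le_iff zero_le_one]
  have h1 := orth_norm_le k.1.2
  have h2 := orth_norm_le k.2.2
  rintro (i | i) (j | j)
  · exact (Matrix.norm_entry_le_entrywise_sup_norm (k.1 : Matrix (Fin M) (Fin M) ℝ)).trans h1
  · simp [kap]
  · simp [kap]
  · exact (Matrix.norm_entry_le_entrywise_sup_norm (k.2 : Matrix (Fin N) (Fin N) ℝ)).trans h2

lemma adj_bound (R : ℝ) : ∃ A : ℝ, 0 ≤ A ∧ ∀ g : BMat M N, ‖g‖ ≤ R → ‖g.adjugate‖ ≤ A := by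
  have hc : Continuous fun g : BMat M N => g.adjugate := Continuous.matrix_adjugate continuous_id
  obtain ⟨A, hA⟩ := (isCompact_closedBall (0 : BMat M N) R).exists_bound_of_continuousOn hc.continuousOn
  exact ⟨max A 0, le_max_right _ _, fun g hg => (hA g (by simpa using hg)).trans (le_max_left _ _)⟩

lemma h_lip (R : ℝ) : ∃ K : ℝ, 0 ≤ K ∧ ∀ (g g' h : BMat M N) (u : KK M N), ‖g‖ ≤ R → |g.det| = 1 →
    g' = kap u * h * g → ‖h - 1‖ ≤ K * (‖g' - g‖ + ‖kap u - 1‖) := by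
  obtain ⟨A, hA0, hA⟩ := adj_bound (M := M) (N := N) R
  set d : ℝ := (Fintype.card (Fin M ⊕ Fin N) : ℝ) with hd
  have hd0 : 0 ≤ d := by positivity
  refine ⟨d * (d * (1 + d * |R|) * A), by positivity, fun g g' h u hg hdet he => ?_⟩
  have hgi : g * ((g.det)⁻¹ • g.adjugate) = 1 := by
    have : g.det ≠ 0 := fun h0 => by simp [h0] at hdet
    rw [Matrix.mul_smul, Matrix.mul_adjugate, smul_smul, inv_mul_cancel₀ this, one_smul]
  have e1 : h - 1 = kap u⁻¹ * ((g' - g) - (kap u - 1) * g) * ((g.det)⁻¹ • g.adjugate) := by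
    have : (g' - g) - (kap u - 1) * g = kap u * (h - 1) * g := by
      rw [he]; noncomm_ring
    rw [this, mul_assoc, mul_assoc, hgi, ← mul_assoc, mul_one, ← mul_assoc, kap_inv_mul, one_mul]
  have hn1 : ‖(g.det)⁻¹ • g.adjugate‖ ≤ A := by
    rw [norm_smul, norm_inv, Real.norm_eq_abs, hdet, inv_one, one_mul]; exact hA g hg
  have hR : ‖g‖ ≤ |R| := hg.trans (le_abs_self R)
  have hn2 : ‖(g' - g) - (kap u - 1) * g‖ ≤ (1 + d * |R|) * (‖g' - g‖ + ‖kap u - 1‖) := by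
    have h1 := norm_mul_le_card (kap u - 1) g
    have h2 := norm_sub_le (g' - g) ((kap u - 1) * g)
    have h3 : ‖(kap u - 1) * g‖ ≤ d * |R| * ‖kap u - 1‖ := by
      refine h1.trans ?_
      have : ‖kap u - 1‖ * ‖g‖ ≤ ‖kap u - 1‖ * |R| := by gcongr
      calc _ ≤ d * (‖kap u - 1‖ * |R|) := by gcongr
        _ = _ := by ring
    have h4 : 0 ≤ d * |R| * ‖g' - g‖ := by positivity
    have h5 := norm_nonneg (kap u - 1)
    nlinarith
  have hn3 := norm_mul_le_card (kap u⁻¹) ((g' - g) - (kap u - 1) * g)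
  have hn4 := norm_mul_le_card (kap u⁻¹ * ((g' - g) - (kap u - 1) * g)) ((g.det)⁻¹ • g.adjugate)
  rw [e1]
  have hk := kap_norm_le u⁻¹
  have h6 : ‖kap u⁻¹ * ((g' - g) - (kap u - 1) * g)‖ ≤ d * ((1 + d * |R|) * (‖g' - g‖ + ‖kap u - 1‖)) := by
    refine hn3.trans ?_
    have : ‖kap u⁻¹‖ * ‖(g' - g) - (kap u - 1) * g‖ ≤ 1 * ((1 + d * |R|) * (‖g' - g‖ + ‖kap u - 1‖)) := by gcongr
    rw [one_mul] at this
    gcongr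
  calc _ ≤ d * (‖kap u⁻¹ * ((g' - g) - (kap u - 1) * g)‖ * ‖(g.det)⁻¹ • g.adjugate‖) := hn4
    _ ≤ d * (d * ((1 + d * |R|) * (‖g' - g‖ + ‖kap u - 1‖)) * A) := by gcongr
    _ = _ := by ring

lemma scale_find (Dm : ℕ → ℕ → ℝ) (K ε : ℝ) (hK : 0 ≤ K) (hε : 0 < ε) (hstep : ∀ j m, Dm j (m + 1) ≤ K * Dm j m)
    (h0 : Tendsto (fun j => Dm j 0) atTop (𝓝 0)) (n : ℕ → ℕ) (hn : ∀ᶠ j in atTop, ε ≤ Dm j (n j)) :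
    ∃ m : ℕ → ℕ, Tendsto m atTop atTop ∧ ∀ᶠ j in atTop, m j ≤ n j ∧ ε ≤ Dm j (m j) ∧ Dm j (m j) ≤ K * ε := by
  classical
  have hpow : ∀ j m, Dm j m ≤ K ^ m * Dm j 0 := by
    intro j m
    induction m with
    | zero => simp
    | succ m ih =>
      refine (hstep j m).trans ?_
      rw [pow_succ', mul_assoc]
      gcongr
  have hsmall : ∀ m, ∀ᶠ j in atTop, Dm j m < ε := by
    intro m
    have : Tendsto (fun j => K ^ m * Dm j 0) atTop (𝓝 0) := by simpa using h0.const_mul (K ^ m)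
    filter_upwards [this.eventually (gt_mem_nhds hε)] with j hj
    exact (hpow j m).trans_lt hj
  refine ⟨fun j => if h : ∃ m, ε ≤ Dm j m then Nat.find h else j, ?_, ?_⟩
  · rw [tendsto_atTop]
    intro B
    have : ∀ᶠ j in atTop, ∀ m < B, Dm j m < ε := by
      have := (Filter.eventually_all_finset (Finset.range B) (l := (atTop : Filter ℕ))
        (p := fun m j => Dm j m < ε)).2 fun m _ => hsmall m
      simpa using this
    filter_upwards [this, hn] with j hj hnj
    rw [dif_pos ⟨_, hnj⟩, Nat.le_find_iff]
    intro m hm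
    exact not_le.2 (hj m hm)
  · filter_upwards [hn, hsmall 0] with j hj hj0
    have hex : ∃ m, ε ≤ Dm j m := ⟨_, hj⟩
    rw [dif_pos hex]
    refine ⟨Nat.find_min' hex hj, Nat.find_spec hex, ?_⟩
    rcases hm : Nat.find hex with _ | m
    · have := Nat.find_spec hex
      rw [hm] at this
      linarith
    · refine (hstep j m).trans ?_
      have : Dm j m < ε := not_le.1 (Nat.find_min hex (by rw [hm]; exact Nat.lt_succ_self m))
      gcongr

end

section

variable {M N : ℕ} {ι : Type} [TopologicalSpace ι] [DiscreteTopology ι] [Finite ι]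

lemma kap_inj {k l : KK M N} (h : kap k = kap l) : k = l := by
  have h1 := congrArg Matrix.toBlocks₁₁ h
  have h2 := congrArg Matrix.toBlocks₂₂ h
  simp only [kap, toBlocks_fromBlocks₁₁, toBlocks_fromBlocks₂₂] at h1 h2
  exact Prod.ext (Subtype.ext h1) (Subtype.ext h2)

lemma kap_lim (U : Ultrafilter ℕ) (u : ℕ → KK M N) (hu : Tendsto (fun j => kap (u j)) U (𝓝 1)) :
    Tendsto u U (𝓝 1) := by
  obtain ⟨x, -, hx⟩ := uf_lim U (isCompact_univ (X := KK M N)) u (Eventually.of_forall fun _ => trivial)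
  have h1 := (kap_cont.tendsto x).comp hx
  have h2 : kap x = kap 1 := by rw [kap_one]; exact tendsto_nhds_unique h1 hu
  rwa [kap_inj h2] at hx

lemma drift_limit {D : CD ι M N} {c R : ℝ} {Z : Set (St ι M N)} (h : MinSys D c R Z) (U : Ultrafilter ℕ)
    (y y' : ℕ → St ι M N) (hy : ∀ j, y j ∈ Z) (hy' : ∀ j, y' j ∈ Z) (m : ℕ → ℕ) (hm : Tendsto m U atTop)
    (hag : ∀ᶠ j in (U : Filter ℕ), ∀ i < m j, (y j).1 i = (y' j).1 i) (a : ℕ → ℕ → ι)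
    (hu : Tendsto (fun j => kap ((y' j).2.1 * (y j).2.1⁻¹)) U (𝓝 1)) (hh : ℕ → BMat M N)
    (hhe : ∀ j, (y' j).2.2 = kap ((y' j).2.1 * (y j).2.1⁻¹) * hh j * (y j).2.2) (w : MatSpace M N)
    (hw : Tendsto (fun j => Um (D.dsp (m j) (a j) (y j).1 (y j).2.1) * hh j *
      Um (-D.dsp (m j) (a j) (y j).1 (y j).2.1)) U (𝓝 (Um w))) : w ∈ Hset Z := by
  have hY : ∀ j, D.mv (m j) (a j) (y j) ∈ Z := fun j => h.mv _ _ _ (hy j)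
  have hY' : ∀ j, D.mv (m j) (a j) (y' j) ∈ Z := fun j => h.mv _ _ _ (hy' j)
  choose γ hγ using fun j => h.red _ (hY j)
  obtain ⟨x, -, hx⟩ := uf_lim U (box_compact (ι := ι) (M := M) (N := N) R) (fun j => rg (γ j) (D.mv (m j) (a j) (y j)))
    (Eventually.of_forall fun j => hγ j)
  have hxZ : x ∈ Z := h.closed.mem_of_tendsto hx (Eventually.of_forall fun j => h.rg _ _ (hY j))
  have hx1 : Tendsto (fun j => CD.spl (m j) (a j) (y j).1) U (𝓝 x.1) := (continuous_fst.tendsto x).comp hx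
  have hx2 : Tendsto (fun j => (D.mv (m j) (a j) (y j)).2.1) U (𝓝 x.2.1) := by
    have t := ((continuous_fst.comp continuous_snd : Continuous fun z : St ι M N => z.2.1).tendsto x).comp hx
    exact t
  have hx3 : Tendsto (fun j => (D.mv (m j) (a j) (y j)).2.2 * zm (γ j)) U (𝓝 x.2.2) := by
    have t := ((g_cont (ι := ι) (M := M) (N := N)).tendsto x).comp hx
    exact t
  refine h.mem_H hxZ (h.closed.mem_of_tendsto (f := fun j => rg (γ j) (D.mv (m j) (a j) (y' j))) (b := (U : Filter ℕ)) ?_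
    (Eventually.of_forall fun j => h.rg _ _ (hY' j)))
  have c1 : Tendsto (fun j => CD.spl (m j) (a j) (y' j).1) U (𝓝 x.1) := by
    rw [tendsto_pi_nhds] at hx1 ⊢
    intro i
    refine (hx1 i).congr' ?_
    filter_upwards [hm.eventually_gt_atTop i] with j hj
    simp [CD.spl, hj]
  have htau : ∀ᶠ j in (U : Filter ℕ), D.tau (y' j).1 (m j) = D.tau (y j).1 (m j) := by
    filter_upwards [hag] with j hj using D.tau_congr fun i hi => (hj i hi).symm
  have hss : ∀ᶠ j in (U : Filter ℕ), D.ss (y' j).1 (m j) = D.ss (y j).1 (m j) := by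
    filter_upwards [hag] with j hj using D.ss_congr fun i hi => (hj i hi).symm
  have c2 : Tendsto (fun j => (D.mv (m j) (a j) (y' j)).2.1) U (𝓝 x.2.1) := by
    have := (kap_lim U _ hu).mul hx2
    rw [one_mul] at this
    refine this.congr' ?_
    filter_upwards [htau] with j hj
    simp only [CD.mv, hj]
    group
  have c3 : Tendsto (fun j => (D.mv (m j) (a j) (y' j)).2.2 * zm (γ j)) U (𝓝 (Um w * x.2.2)) := by
    have := (hu.mul hw).mul hx3
    rw [one_mul] at this
    refine this.congr' ?_
    filter_upwards [htau, hss] with j hj1 hj2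
    have e1 : D.dsp (m j) (a j) (y' j).1 (y' j).2.1 =
        act ((y' j).2.1 * (y j).2.1⁻¹) (D.dsp (m j) (a j) (y j).1 (y j).2.1) := by
      simp only [CD.dsp, hj1, hj2]
      rw [map_smul, ← act_mul]
      congr 3
      group
    have e2 : (D.mv (m j) (a j) (y' j)).2.2 = Um (D.dsp (m j) (a j) (y' j).1 (y' j).2.1) * (y' j).2.2 := rfl
    have e3 : (D.mv (m j) (a j) (y j)).2.2 = Um (D.dsp (m j) (a j) (y j).1 (y j).2.1) * (y j).2.2 := rfl
    rw [e2, e1, hhe j, e3]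
    set α := D.dsp (m j) (a j) (y j).1 (y j).2.1
    set u := (y' j).2.1 * (y j).2.1⁻¹
    have e4 : Um (-α) * Um α = 1 := by rw [Um_mul, neg_add_cancel, Um_zero]
    calc kap u * (Um α * hh j * Um (-α)) * (Um α * (y j).2.2 * zm (γ j))
        = kap u * Um α * hh j * (Um (-α) * Um α) * (y j).2.2 * zm (γ j) := by simp only [mul_assoc]
      _ = Um (act u α) * (kap u * hh j * (y j).2.2) * zm (γ j) := by rw [e4, kap_Um]; simp only [mul_assoc, one_mul]
  exact c1.prodMk_nhds (c2.prodMk_nhds c3)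

end

section

variable {M N : ℕ} {ι : Type} [TopologicalSpace ι] [DiscreteTopology ι] [Finite ι]

lemma tb11_norm (A : BMat M N) : ‖A.toBlocks₁₁‖ ≤ ‖A‖ :=
  (Matrix.norm_le_iff (norm_nonneg _)).2 fun i j => Matrix.norm_entry_le_entrywise_sup_norm A

lemma tb12_norm (A : BMat M N) : ‖A.toBlocks₁₂‖ ≤ ‖A‖ :=
  (Matrix.norm_le_iff (norm_nonneg _)).2 fun i j => Matrix.norm_entry_le_entrywise_sup_norm A

lemma tb21_norm (A : BMat M N) : ‖A.toBlocks₂₁‖ ≤ ‖A‖ :=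
  (Matrix.norm_le_iff (norm_nonneg _)).2 fun i j => Matrix.norm_entry_le_entrywise_sup_norm A

lemma tb22_norm (A : BMat M N) : ‖A.toBlocks₂₂‖ ≤ ‖A‖ :=
  (Matrix.norm_le_iff (norm_nonneg _)).2 fun i j => Matrix.norm_entry_le_entrywise_sup_norm A

lemma F_norm_le (ξ : MatSpace M N) (X : Matrix (Fin M) (Fin M) ℝ) (Y : Matrix (Fin N) (Fin N) ℝ)
    (Z : Matrix (Fin N) (Fin M) ℝ) (r e : ℝ) (hξ : ‖ξ‖ ≤ r) (hX : ‖X‖ ≤ e) (hY : ‖Y‖ ≤ e) (hZ : ‖Z‖ ≤ e) :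
    ‖ξ * Y - X * ξ - ξ * Z * ξ‖ ≤ (N * r + M * r + M * (N * r) * r) * e := by
  have h1 := norm_mul_le_card ξ Y
  have h2 := norm_mul_le_card X ξ
  have h3 := norm_mul_le_card (ξ * Z) ξ
  have h4 := norm_mul_le_card ξ Z
  simp only [Fintype.card_fin] at h1 h2 h3 h4
  have hr : 0 ≤ r := (norm_nonneg _).trans hξ
  have he : 0 ≤ e := (norm_nonneg _).trans hX
  have h1' : ‖ξ * Y‖ ≤ N * (r * e) := h1.trans (by gcongr)
  have h2' : ‖X * ξ‖ ≤ M * (e * r) := h2.trans (by gcongr)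
  have h4' : ‖ξ * Z‖ ≤ N * (r * e) := h4.trans (by gcongr)
  have h3' : ‖ξ * Z * ξ‖ ≤ M * (N * (r * e) * r) := h3.trans (by gcongr)
  have h5 := norm_sub_le (ξ * Y - X * ξ) (ξ * Z * ξ)
  have h6 := norm_sub_le (ξ * Y) (X * ξ)
  linarith

/-- limit computation in the drift lemma -/
lemma conj_limit (U : Ultrafilter ℕ) (t s : ℕ → ℝ) (ht0 : ∀ j, t j ≠ 0) (ht : Tendsto t U (𝓝 0)) (hs : Tendsto s U (𝓝 1))
    (X : ℕ → Matrix (Fin M) (Fin M) ℝ) (W : ℕ → MatSpace M N) (Z : ℕ → Matrix (Fin N) (Fin M) ℝ)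
    (Y : ℕ → Matrix (Fin N) (Fin N) ℝ) (ξ : ℕ → MatSpace M N) (X' : Matrix (Fin M) (Fin M) ℝ)
    (Z' : Matrix (Fin N) (Fin M) ℝ) (Y' : Matrix (Fin N) (Fin N) ℝ) (ξ' : MatSpace M N)
    (hX0 : Tendsto X U (𝓝 0)) (hY0 : Tendsto Y U (𝓝 0)) (hZ0 : Tendsto Z U (𝓝 0)) (hW0 : Tendsto W U (𝓝 0))
    (hX : Tendsto (fun j => (t j)⁻¹ • X j) U (𝓝 X')) (hY : Tendsto (fun j => (t j)⁻¹ • Y j) U (𝓝 Y'))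
    (hZ : Tendsto (fun j => ((t j)⁻¹ * (t j)⁻¹) • Z j) U (𝓝 Z')) (hξ : Tendsto ξ U (𝓝 ξ')) :
    Tendsto (fun j => Um ((t j)⁻¹ • ξ j) * (s j • (1 + fromBlocks (X j) (W j) (Z j) (Y j))) * Um (-((t j)⁻¹ • ξ j))) U
      (𝓝 (Um (ξ' * Y' - X' * ξ' - ξ' * Z' * ξ'))) := by
  have e : ∀ j, Um ((t j)⁻¹ • ξ j) * (s j • (1 + fromBlocks (X j) (W j) (Z j) (Y j))) * Um (-((t j)⁻¹ • ξ j)) =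
      s j • (1 + fromBlocks (X j + t j • (ξ j * (((t j)⁻¹ * (t j)⁻¹) • Z j)))
        (W j + (ξ j * ((t j)⁻¹ • Y j) - ((t j)⁻¹ • X j) * ξ j - ξ j * (((t j)⁻¹ * (t j)⁻¹) • Z j) * ξ j))
        (Z j) (Y j - t j • ((((t j)⁻¹ * (t j)⁻¹) • Z j) * ξ j))) := by
    intro j
    have h1 : Um ((t j)⁻¹ • ξ j) * Um (-((t j)⁻¹ • ξ j)) = 1 := by rw [Um_mul, add_neg_cancel, Um_zero]
    have h2 : t j * ((t j)⁻¹ * (t j)⁻¹) = (t j)⁻¹ := by field_simp [ht0 j]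
    rw [Matrix.mul_smul, Matrix.smul_mul, mul_add, add_mul, mul_one, h1, conj_blk]
    simp only [Matrix.mul_smul, Matrix.smul_mul, smul_smul, h2]
  simp only [e]
  have hz1 : Tendsto (fun j => X j + t j • (ξ j * (((t j)⁻¹ * (t j)⁻¹) • Z j))) U (𝓝 0) := by
    have := hX0.add (ht.smul (tendsto_mmul hξ hZ))
    simpa using this
  have hz2 : Tendsto (fun j => W j + (ξ j * ((t j)⁻¹ • Y j) - ((t j)⁻¹ • X j) * ξ j - ξ j * (((t j)⁻¹ * (t j)⁻¹) • Z j) * ξ j)) U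
      (𝓝 (ξ' * Y' - X' * ξ' - ξ' * Z' * ξ')) := by
    have := hW0.add (((tendsto_mmul hξ hY).sub (tendsto_mmul hX hξ)).sub (tendsto_mmul (tendsto_mmul hξ hZ) hξ))
    rwa [zero_add] at this
  have hz3 : Tendsto (fun j => Y j - t j • ((((t j)⁻¹ * (t j)⁻¹) • Z j) * ξ j)) U (𝓝 0) := by
    have := hY0.sub (ht.smul (tendsto_mmul hZ hξ))
    simpa using this
  have h4 := hs.smul ((tendsto_const_nhds (x := (1 : BMat M N))).add (tendsto_fromBlocks hz1 hz2 hZ0 hz3))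
  rw [one_smul] at h4
  have h5 : Um (ξ' * Y' - X' * ξ' - ξ' * Z' * ξ') = 1 + fromBlocks 0 (ξ' * Y' - X' * ξ' - ξ' * Z' * ξ') 0 0 := by
    rw [Um, ← fromBlocks_one, fromBlocks_add]; simp
  rw [h5]
  exact h4

end

section

variable {M N : ℕ} {ι : Type} [TopologicalSpace ι] [DiscreteTopology ι] [Finite ι]

lemma act_tendsto {l : Filter ℕ} {f : ℕ → KK M N} {g : ℕ → MatSpace M N} {x : KK M N} {y : MatSpace M N}
    (hf : Tendsto f l (𝓝 x)) (hg : Tendsto g l (𝓝 y)) : Tendsto (fun j => act (f j) (g j)) l (𝓝 (act x y)) :=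
  Filter.Tendsto.comp (g := fun p : KK M N × MatSpace M N => act p.1 p.2) (f := fun j => (f j, g j))
    (act_cont.tendsto (x, y)) (hf.prodMk_nhds hg)

lemma sub_tendsto {l : Filter ℕ} {g : ℕ → MatSpace M N} {y : MatSpace M N} (z : MatSpace M N)
    (hg : Tendsto g l (𝓝 y)) : Tendsto (fun j => z - g j) l (𝓝 (z - y)) := hg.const_sub z

lemma trace_blocks (A : BMat M N) : A.toBlocks₁₁.trace + A.toBlocks₂₂.trace = A.trace := by
  simp [Matrix.trace, Fintype.sum_sum_type, Matrix.toBlocks₁₁, Matrix.toBlocks₂₂]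

set_option maxHeartbeats 1000000 in
lemma drift [NeZero M] [NeZero N] {D : CD ι M N} {c R : ℝ} {Z : Set (St ι M N)} (h : MinSys D c R Z) (hc : 0 < c)
    (hspan : Submodule.span ℝ D.PP = ⊤) (Rb : ℝ) (hb : ∀ b m, ‖D.ss b m‖ ≤ Rb) :
    ∃ η > 0, ∃ C > 0, ∀ y ∈ Z, ∀ y' ∈ Z, ‖y.2.2‖ ≤ R → ‖y'.2.2‖ ≤ R → ∀ n : ℕ, (∀ j < n, y.1 j = y'.1 j) →
      ‖kap (y'.2.1 * y.2.1⁻¹) - 1‖ < η → ‖y'.2.2 - y.2.2‖ < η →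
      ∀ hh : BMat M N, y'.2.2 = kap (y'.2.1 * y.2.1⁻¹) * hh * y.2.2 → ‖hh.toBlocks₂₁‖ ≤ C * (D.ρ ^ n * D.ρ ^ n) := by
  obtain ⟨V, hVH, ε0, hε0, hgap⟩ := closed_subgroup_gap h.Hgrp h.H_closed
  obtain ⟨y0, hy0⟩ := h.ne
  have hV : ∀ t ∈ V, Good c (Um t * y0.2.2) := fun t ht => h.good _ (hVH t ht y0 hy0)
  have hρ0 := D.hρ0
  set r : ℝ := (M * N : ℝ) * (Rb + Rb)
  set K : ℝ := D.ρ⁻¹ * D.ρ⁻¹ with hK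
  have hRb : 0 ≤ Rb := (norm_nonneg _).trans (hb (fun _ => D.i0) 0)
  set Cw : ℝ := N * r + M * r + M * (N * r) * r + 1
  have hr0 : 0 ≤ r := by positivity
  have hCw : 0 < Cw := by positivity
  have hK0 : 0 < K := by positivity
  set ε : ℝ := ε0 / (2 * Cw * K) with hε
  have hεp : 0 < ε := by positivity
  by_contra hcon
  push Not at hcon
  choose y hy y' hy' hR hR' n hn hk hg hh he hbad using
    fun j : ℕ => hcon (1 / ((j : ℝ) + 1)) (by positivity) (2 * ε) (by positivity)
  obtain ⟨L, hL0, hL⟩ := h_lip (M := M) (N := N) R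
  have hone : Tendsto (fun j : ℕ => 1 / ((j : ℝ) + 1)) atTop (𝓝 0) := tendsto_one_div_add_atTop_nhds_zero_nat
  have hkl : Tendsto (fun j => kap ((y' j).2.1 * (y j).2.1⁻¹)) atTop (𝓝 1) := by
    refine tendsto_iff_norm_sub_tendsto_zero.2 ?_
    exact squeeze_zero (fun j => norm_nonneg _) (fun j => (hk j).le) hone
  have hhl : Tendsto hh atTop (𝓝 1) := by
    refine tendsto_iff_norm_sub_tendsto_zero.2 ?_
    have h2 : Tendsto (fun j : ℕ => L * (1 / ((j : ℝ) + 1) + 1 / ((j : ℝ) + 1))) atTop (𝓝 0) := by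
      simpa using (hone.add hone).const_mul L
    refine squeeze_zero (fun j => norm_nonneg _) (fun j => ?_) h2
    refine (hL _ _ _ _ (hR j) (h.good _ (hy j)).1 (he j)).trans ?_
    have := (hk j).le
    have := (hg j).le
    gcongr
  set d : ℝ := (M : ℝ) + N with hd
  have hd0 : 0 < d := by
    have : (0 : ℝ) < M := by exact_mod_cast Nat.pos_of_ne_zero (NeZero.ne M)
    positivity
  set s : ℕ → ℝ := fun j => (hh j).trace / d with hs
  have hsl : Tendsto s atTop (𝓝 1) := by
    have ct : Continuous fun A : BMat M N => A.trace / d := (continuous_id.matrix_trace).div_const d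
    have := (ct.tendsto 1).comp hhl
    have e : (1 : BMat M N).trace / d = 1 := by
      rw [Matrix.trace_one]; simp [hd]; exact hd0.ne'
    rw [e] at this
    exact this
  set H' : ℕ → BMat M N := fun j => (s j)⁻¹ • hh j - 1 with hH'
  have hHl : Tendsto H' atTop (𝓝 0) := by
    have h1 := (hsl.inv₀ one_ne_zero).smul hhl
    have h2 := h1.sub_const (1 : BMat M N)
    simpa using h2
  have hHn : Tendsto (fun j => ‖H' j‖) atTop (𝓝 0) := by simpa using hHl.norm
  set X := fun j => (H' j).toBlocks₁₁ with hXd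
  set W := fun j => (H' j).toBlocks₁₂ with hWd
  set Zz := fun j => (H' j).toBlocks₂₁ with hZd
  set Y := fun j => (H' j).toBlocks₂₂ with hYd
  have hX0 : Tendsto X atTop (𝓝 0) := squeeze_zero_norm (fun j => tb11_norm _) hHn
  have hW0 : Tendsto W atTop (𝓝 0) := squeeze_zero_norm (fun j => tb12_norm _) hHn
  have hZ0 : Tendsto Zz atTop (𝓝 0) := squeeze_zero_norm (fun j => tb21_norm _) hHn
  have hY0 : Tendsto Y atTop (𝓝 0) := squeeze_zero_norm (fun j => tb22_norm _) hHn
  have hs_pos : ∀ᶠ j in atTop, 1 / 2 < s j ∧ s j < 2 :=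
    (hsl.eventually (lt_mem_nhds (by norm_num))).and (hsl.eventually (gt_mem_nhds (by norm_num)))
  have hhe : ∀ᶠ j in atTop, hh j = s j • (1 + fromBlocks (X j) (W j) (Zz j) (Y j)) := by
    filter_upwards [hs_pos] with j hj
    have : s j ≠ 0 := by linarith [hj.1]
    rw [hXd, hWd, hZd, hYd, fromBlocks_toBlocks, hH']
    simp only [add_sub_cancel, smul_smul, mul_inv_cancel₀ this, one_smul]
  have htr : ∀ᶠ j in atTop, (X j).trace + (Y j).trace = 0 := by
    filter_upwards [hs_pos] with j hj
    have h0 : s j ≠ 0 := by linarith [hj.1]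
    have e : (hh j).trace = s j * d := by simp only [hs]; field_simp
    simp only [hXd, hYd]
    rw [trace_blocks, hH']
    simp only [trace_sub, trace_smul, trace_one, e, smul_eq_mul, Fintype.card_sum, Fintype.card_fin, Nat.cast_add]
    field_simp
    simp [hd]
  set Dm : ℕ → ℕ → ℝ := fun j m => max (max ((D.ρ ^ m)⁻¹ * ‖X j‖) ((D.ρ ^ m)⁻¹ * ‖Y j‖))
    ((D.ρ ^ m)⁻¹ * (D.ρ ^ m)⁻¹ * ‖Zz j‖) with hDm
  have hρi : 1 ≤ D.ρ⁻¹ := (one_le_inv₀ hρ0).2 D.hρ1.le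
  have hKi : D.ρ⁻¹ ≤ K := by rw [hK]; nlinarith
  have hstep : ∀ j m, Dm j (m + 1) ≤ K * Dm j m := by
    intro j m
    have hp : 0 < (D.ρ ^ m)⁻¹ := by positivity
    simp only [hDm, pow_succ, mul_inv]
    refine max_le (max_le ?_ ?_) ?_
    · refine le_trans ?_ (mul_le_mul_of_nonneg_left ((le_max_left _ _).trans (le_max_left _ _)) hK0.le)
      calc (D.ρ ^ m)⁻¹ * D.ρ⁻¹ * ‖X j‖ = D.ρ⁻¹ * ((D.ρ ^ m)⁻¹ * ‖X j‖) := by ring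
        _ ≤ _ := by gcongr
    · refine le_trans ?_ (mul_le_mul_of_nonneg_left ((le_max_right _ _).trans (le_max_left _ _)) hK0.le)
      calc (D.ρ ^ m)⁻¹ * D.ρ⁻¹ * ‖Y j‖ = D.ρ⁻¹ * ((D.ρ ^ m)⁻¹ * ‖Y j‖) := by ring
        _ ≤ _ := by gcongr
    · refine le_trans ?_ (mul_le_mul_of_nonneg_left (le_max_right _ _) hK0.le)
      rw [hK]
      apply le_of_eq
      ring
  have hD0 : Tendsto (fun j => Dm j 0) atTop (𝓝 0) := by
    have := ((hX0.norm).max (hY0.norm)).max hZ0.norm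
    simpa [hDm] using this
  have hDn : ∀ᶠ j in atTop, ε ≤ Dm j (n j) := by
    filter_upwards [hs_pos] with j hj
    refine le_trans ?_ (le_max_right _ _)
    have h0 : 0 < s j := by linarith [hj.1]
    have e : Zz j = (s j)⁻¹ • (hh j).toBlocks₂₁ := by
      ext a b
      simp [hZd, hH', Matrix.toBlocks₂₁]
    rw [e, norm_smul, norm_inv, Real.norm_eq_abs, abs_of_pos h0]
    have h1 := (hbad j).le
    have h2 : (2 : ℝ)⁻¹ ≤ (s j)⁻¹ := inv_anti₀ h0 hj.2.le
    have hp : 0 < D.ρ ^ n j := by positivity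
    calc ε = (D.ρ ^ n j)⁻¹ * (D.ρ ^ n j)⁻¹ * (2⁻¹ * (2 * ε * (D.ρ ^ n j * D.ρ ^ n j))) := by field_simp
      _ ≤ _ := by gcongr
  obtain ⟨m, hm, hmD⟩ := scale_find Dm K ε hK0.le hεp hstep hD0 n hDn
  -- pass to the limit along an ultrafilter
  obtain ⟨U, hU⟩ : ∃ U : Ultrafilter ℕ, (U : Filter ℕ) ≤ atTop := ⟨_, Nat.hyperfilter_le_atTop⟩
  have hmDU := hU hmD
  have hpos : ∀ j, 0 < (D.ρ ^ m j)⁻¹ := fun j => by positivity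
  obtain ⟨X', hX'n, hX'⟩ := uf_lim_norm U (K * ε) (fun j => (D.ρ ^ m j)⁻¹ • X j) (by
    filter_upwards [hmDU] with j hj
    rw [norm_smul, Real.norm_eq_abs, abs_of_pos (hpos j)]
    exact ((le_max_left _ _).trans (le_max_left _ _)).trans hj.2.2)
  obtain ⟨Y', hY'n, hY'⟩ := uf_lim_norm U (K * ε) (fun j => (D.ρ ^ m j)⁻¹ • Y j) (by
    filter_upwards [hmDU] with j hj
    rw [norm_smul, Real.norm_eq_abs, abs_of_pos (hpos j)]
    exact ((le_max_right _ _).trans (le_max_left _ _)).trans hj.2.2)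
  obtain ⟨Z', hZ'n, hZ'⟩ := uf_lim_norm U (K * ε) (fun j => ((D.ρ ^ m j)⁻¹ * (D.ρ ^ m j)⁻¹) • Zz j) (by
    filter_upwards [hmDU] with j hj
    rw [norm_smul, Real.norm_eq_abs, abs_of_pos (mul_pos (hpos j) (hpos j))]
    exact (le_max_right _ _).trans hj.2.2)
  obtain ⟨o, -, ho⟩ := uf_lim U (isCompact_univ (X := KK M N)) (fun j => (y j).2.1 * (D.tau (y j).1 (m j))⁻¹)
    (Eventually.of_forall fun _ => trivial)
  obtain ⟨cc, hccn, hcc⟩ := uf_lim_norm U Rb (fun j => D.ss (y j).1 (m j)) (Eventually.of_forall fun j => hb _ _)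
  have htr' : X'.trace + Y'.trace = 0 := by
    have ct1 : Continuous fun A : Matrix (Fin M) (Fin M) ℝ => A.trace := continuous_id.matrix_trace
    have ct2 : Continuous fun A : Matrix (Fin N) (Fin N) ℝ => A.trace := continuous_id.matrix_trace
    have h1 := ((ct1.tendsto X').comp hX').add ((ct2.tendsto Y').comp hY')
    refine tendsto_nhds_unique h1 (tendsto_const_nhds.congr' ?_)
    filter_upwards [hU htr] with j hj
    simp only [Function.comp_apply, trace_smul, ← smul_add, hj, smul_zero]
  have hne : ε ≤ max (max ‖X'‖ ‖Y'‖) ‖Z'‖ := by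
    have h1 := ((hX'.norm).max (hY'.norm)).max hZ'.norm
    refine ge_of_tendsto h1 ?_
    filter_upwards [hmDU] with j hj
    simp only [norm_smul, Real.norm_eq_abs, abs_of_pos (hpos j), abs_of_pos (mul_pos (hpos j) (hpos j))]
    exact hj.2.1
  have hex : ∃ a q, act o (D.ss a q - cc) * Y' - X' * act o (D.ss a q - cc)
      - act o (D.ss a q - cc) * Z' * act o (D.ss a q - cc) ∉ V := by
    by_contra hno
    push Not at hno
    obtain ⟨h1, h2, h3⟩ := nV_zero hc V hV X' Y' Z' (quad_mem D hspan V X' Y' Z' o cc hno) htr'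
    rw [h1, h2, h3] at hne
    simp at hne
    linarith
  obtain ⟨a, q, hw⟩ := hex
  apply hw
  refine hgap _ ?_ ?_
  · refine drift_limit h U y y' hy hy' m (hm.mono_left hU) ?_ (fun j => D.pad (m j - q) a) (hkl.mono_left hU) hh he _ ?_
    · filter_upwards [hmDU] with j hj i hi
      exact hn j i (hi.trans_le hj.1)
    · have hξ : Tendsto (fun j => act ((y j).2.1 * (D.tau (y j).1 (m j))⁻¹) (D.ss a q - D.ss (y j).1 (m j))) U
          (𝓝 (act o (D.ss a q - cc))) := act_tendsto ho (sub_tendsto (D.ss a q) hcc)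
      have ht : Tendsto (fun j => D.ρ ^ m j) U (𝓝 0) :=
        (tendsto_pow_atTop_nhds_zero_of_lt_one hρ0.le D.hρ1).comp (hm.mono_left hU)
      have := conj_limit U (fun j => D.ρ ^ m j) s (fun j => by positivity) ht (hsl.mono_left hU) X W Zz Y _ X' Z' Y' _
        (hX0.mono_left hU) (hY0.mono_left hU) (hZ0.mono_left hU) (hW0.mono_left hU) hX' hY' hZ' hξ
      refine this.congr' ?_
      filter_upwards [hU hhe, hU (hm.eventually_ge_atTop q)] with j hj hjq
      have e : D.ss (D.pad (m j - q) a) (m j) = D.ss a q := by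
        have := D.ss_pad (m j - q) a q
        rwa [Nat.sub_add_cancel hjq] at this
      rw [← hj]
      simp only [CD.dsp, e]
  · refine (F_norm_le _ X' Y' Z' r (K * ε) ?_ hX'n hY'n hZ'n).trans_lt ?_
    · refine (act_norm_le _ _).trans ?_
      have := norm_sub_le (D.ss a q) cc
      have := hb a q
      refine mul_le_mul_of_nonneg_left ?_ (by positivity)
      linarith
    · have h1 : (N * r + M * r + M * (N * r) * r) * (K * ε) ≤ Cw * (K * ε) := by
        refine mul_le_mul_of_nonneg_right ?_ (by positivity)
        simp [Cw]
      have h2 : Cw * (K * ε) = ε0 / 2 := by rw [hε]; field_simp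
      linarith

end

section

variable {M N : ℕ} {ι : Type}

lemma zm_eq_one {γ : GLZ M N} (h : ‖zm (γ : Matrix (Fin M ⊕ Fin N) (Fin M ⊕ Fin N) ℤ) - 1‖ < 1) :
    zm (γ : Matrix (Fin M ⊕ Fin N) (Fin M ⊕ Fin N) ℤ) = 1 := by
  rw [← zm_one]
  congr 1
  ext i j
  have h1 := (Matrix.norm_entry_le_entrywise_sup_norm (i := i) (j := j) (zm (γ : Matrix (Fin M ⊕ Fin N) (Fin M ⊕ Fin N) ℤ) - 1)).trans_lt h
  rw [← zm_one] at h1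
  have h2 : |((((γ : Matrix (Fin M ⊕ Fin N) (Fin M ⊕ Fin N) ℤ) i j) - (1 : Matrix (Fin M ⊕ Fin N) (Fin M ⊕ Fin N) ℤ) i j : ℤ) : ℝ)| < 1 := by
    push_cast
    exact h1
  rw [← Int.cast_abs] at h2
  have h3 : |((γ : Matrix (Fin M ⊕ Fin N) (Fin M ⊕ Fin N) ℤ) i j) - (1 : Matrix (Fin M ⊕ Fin N) (Fin M ⊕ Fin N) ℤ) i j| < 1 := by
    exact_mod_cast h2
  have := Int.abs_lt_one_iff.1 h3
  omega

lemma zrig (R0 : ℝ) : ∃ θ > 0, ∀ (z : BMat M N) (β : MatSpace M N) (u : KK M N) (hh : BMat M N) (γ : GLZ M N), ‖z‖ ≤ R0 →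
    |z.det| = 1 → ‖β‖ < θ → ‖kap u - 1‖ < θ → ‖hh - 1‖ < θ →
    Um (-β) * kap u * hh * z = z * zm γ → kap u * hh = Um β := by
  obtain ⟨A, hA0, hA⟩ := adj_bound (M := M) (N := N) R0
  set d : ℝ := (Fintype.card (Fin M ⊕ Fin N) : ℝ) with hd
  have hd0 : 0 ≤ d := by positivity
  set B := d * (d * A * |R0|) + 1 with hB
  have hB0 : 0 < B := by positivity
  have hct : Continuous fun p : MatSpace M N × BMat M N × BMat M N => Um (-p.1) * p.2.1 * p.2.2 :=
    ((Um_cont.comp continuous_fst.neg).mul (continuous_fst.comp continuous_snd)).mul (continuous_snd.comp continuous_snd)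
  have h1 := Metric.continuousAt_iff.1 (hct.continuousAt (x := ((0 : MatSpace M N), (1 : BMat M N), (1 : BMat M N)))) B⁻¹ (by positivity)
  obtain ⟨θ, hθ, hθ'⟩ := h1
  refine ⟨θ, hθ, fun z β u hh γ hz hdet hβ hu hhh he => ?_⟩
  have h2 := @hθ' (β, kap u, hh) (by
    rw [Prod.dist_eq, max_lt_iff, Prod.dist_eq, max_lt_iff]
    exact ⟨by simpa [dist_eq_norm] using hβ, by simpa [dist_eq_norm] using hu, by simpa [dist_eq_norm] using hhh⟩)
  simp only [neg_zero, Um_zero, one_mul, mul_one, dist_eq_norm] at h2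
  have hdz : z.det ≠ 0 := fun h0 => by simp [h0] at hdet
  have hzi : ((z.det)⁻¹ • z.adjugate) * z = 1 := by
    rw [Matrix.smul_mul, Matrix.adjugate_mul, smul_smul, inv_mul_cancel₀ hdz, one_smul]
  have hzi' : z * ((z.det)⁻¹ • z.adjugate) = 1 := by
    rw [Matrix.mul_smul, Matrix.mul_adjugate, smul_smul, inv_mul_cancel₀ hdz, one_smul]
  set zi := (z.det)⁻¹ • z.adjugate with hzid
  have hzin : ‖zi‖ ≤ A := by
    rw [hzid, norm_smul, norm_inv, Real.norm_eq_abs, hdet, inv_one, one_mul]; exact hA z hz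
  have e1 : zm (γ : Matrix (Fin M ⊕ Fin N) (Fin M ⊕ Fin N) ℤ) - 1 = zi * (Um (-β) * kap u * hh - 1) * z := by
    have : zi * (Um (-β) * kap u * hh - 1) * z = zi * (Um (-β) * kap u * hh * z) - zi * z := by noncomm_ring
    rw [this, he, ← mul_assoc, hzi, one_mul]
  have e2 : zm (γ : Matrix (Fin M ⊕ Fin N) (Fin M ⊕ Fin N) ℤ) = 1 := by
    apply zm_eq_one
    rw [e1]
    have n1 := norm_mul_le_card (zi * (Um (-β) * kap u * hh - 1)) z
    have n2 := norm_mul_le_card zi (Um (-β) * kap u * hh - 1)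
    have hR : ‖z‖ ≤ |R0| := hz.trans (le_abs_self R0)
    have n3 : ‖zi * (Um (-β) * kap u * hh - 1)‖ ≤ d * (A * B⁻¹) := n2.trans (by gcongr)
    have n4 : ‖zi * (Um (-β) * kap u * hh - 1) * z‖ ≤ d * (d * (A * B⁻¹) * |R0|) := n1.trans (by gcongr)
    refine n4.trans_lt ?_
    have : d * (d * (A * B⁻¹) * |R0|) = (d * (d * A * |R0|)) / B := by field_simp
    rw [this, div_lt_one hB0]
    linarith
  rw [e2, mul_one] at he
  have e3 : Um (-β) * kap u * hh = 1 := by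
    have := congrArg (· * zi) he
    simpa [mul_assoc, hzi'] using this
  calc kap u * hh = (Um β * Um (-β)) * (kap u * hh) := by rw [Um_mul, add_neg_cancel, Um_zero, one_mul]
    _ = Um β * (Um (-β) * kap u * hh) := by simp only [mul_assoc]
    _ = Um β := by rw [e3, mul_one]

lemma pigeon (R η : ℝ) (hη : 0 < η) : ∃ K : ℕ, ∀ (k : Fin (K + 1) → KK M N) (g : Fin (K + 1) → BMat M N), (∀ i, ‖g i‖ ≤ R) →
    ∃ i j, i ≠ j ∧ ‖kap (k j * (k i)⁻¹) - 1‖ < η ∧ ‖g j - g i‖ < η := by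
  classical
  set d : ℝ := (Fintype.card (Fin M ⊕ Fin N) : ℝ) with hd
  have hd0 : 0 ≤ d := by positivity
  set e := η / (2 * (d + 1)) with he
  have he0 : 0 < e := by positivity
  obtain ⟨t, -, htf, hcov⟩ := (isCompact_closedBall ((0, 0) : BMat M N × BMat M N) (max 1 R)).finite_cover_balls he0
  refine ⟨htf.toFinset.card, fun k g hg => ?_⟩
  have hin : ∀ i, ∃ x ∈ t, dist (kap (k i), g i) x < e := by
    intro i
    have : (kap (k i), g i) ∈ Metric.closedBall ((0, 0) : BMat M N × BMat M N) (max 1 R) := by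
      simp only [Metric.mem_closedBall, Prod.dist_eq, dist_zero_right]
      exact max_le_max (kap_norm_le _) (hg i)
    have := hcov this
    simpa using this
  choose f hf hfd using hin
  obtain ⟨i, -, j, -, hij, hfe⟩ := Finset.exists_ne_map_eq_of_card_lt_of_maps_to (s := Finset.univ) (t := htf.toFinset) (f := f)
    (by simp) (fun i _ => by simpa using hf i)
  refine ⟨i, j, hij, ?_⟩
  have hd2 : dist (kap (k j), g j) (kap (k i), g i) < e + e := by
    have h1 := hfd i
    have h2 := hfd j
    rw [hfe] at h1
    exact (dist_triangle_right _ _ _).trans_lt (add_lt_add h2 h1)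
  rw [Prod.dist_eq, max_lt_iff, dist_eq_norm, dist_eq_norm] at hd2
  have hle : (d + 1) * (e + e) = η := by rw [he]; field_simp; ring
  constructor
  · have e1 : kap (k j * (k i)⁻¹) - 1 = (kap (k j) - kap (k i)) * kap (k i)⁻¹ := by
      rw [sub_mul, ← kap_mul, ← kap_mul, mul_inv_cancel, kap_one]
    rw [e1]
    have h1 := norm_mul_le_card (kap (k j) - kap (k i)) (kap (k i)⁻¹)
    have h2 := kap_norm_le (k i)⁻¹
    have h3 : ‖kap (k j) - kap (k i)‖ * ‖kap (k i)⁻¹‖ ≤ (e + e) * 1 := by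
      have := hd2.1.le
      gcongr
    have h4 : d * (‖kap (k j) - kap (k i)‖ * ‖kap (k i)⁻¹‖) ≤ d * ((e + e) * 1) := by gcongr
    change _ ≤ d * _ at h1
    linarith
  · have : e + e ≤ η := by nlinarith
    linarith [hd2.2]

lemma many_words [NeZero M] [NeZero N] (D : CD ι M N) (hspan : Submodule.span ℝ D.PP = ⊤) (Rb : ℝ) (hb : ∀ b m, ‖D.ss b m‖ ≤ Rb) (K : ℕ) :
    ∃ (q : ℕ) (a : Fin K → ℕ → ι), Function.Injective fun i => D.ss (a i) q := by
  classical
  have hp : ∃ b m, D.ss b m ≠ 0 := by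
    by_contra hno
    push Not at hno
    have h1 : Submodule.span ℝ D.PP ≤ ⊥ := by
      refine Submodule.span_le.2 ?_
      rintro x ⟨b, m, rfl⟩
      simp [hno b m]
    rw [hspan] at h1
    have : (Matrix.of fun _ _ => 1 : MatSpace M N) ∈ (⊥ : Submodule ℝ (MatSpace M N)) := h1 Submodule.mem_top
    have h2 : (Matrix.of fun _ _ => 1 : MatSpace M N) = 0 := by simpa using this
    have h3 : (1 : ℝ) = 0 := congrFun (congrFun h2 0) 0
    exact one_ne_zero h3
  obtain ⟨b, m, hbm⟩ := hp
  set f : ℕ → MatSpace M N := fun q => D.ss (CD.cat m b fun _ => D.i0) (m + q) with hf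
  have hfe : ∀ q, f q = D.ρ ^ q • act (D.T D.i0 ^ q) (D.ss b m) := by
    intro q
    simp only [hf]
    rw [D.ss_cat, D.ss_const, D.tau_const, add_zero]
  have hf0 : ∀ q, f q ≠ 0 := by
    intro q h0
    rw [hfe] at h0
    have h1 := (smul_eq_zero.1 h0).resolve_left (pow_pos D.hρ0 q).ne'
    apply hbm
    rw [← act_inv_act (D.T D.i0 ^ q) (D.ss b m), h1, map_zero]
  have hft : Tendsto f atTop (𝓝 0) := by
    have h2 : Tendsto (fun q : ℕ => D.ρ ^ q * ((M * N : ℝ) * ‖D.ss b m‖)) atTop (𝓝 0) := by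
      simpa using (tendsto_pow_atTop_nhds_zero_of_lt_one D.hρ0.le D.hρ1).mul_const ((M * N : ℝ) * ‖D.ss b m‖)
    refine squeeze_zero_norm (fun q => ?_) h2
    rw [hfe, norm_smul, Real.norm_eq_abs, abs_of_pos (pow_pos D.hρ0 q)]
    exact mul_le_mul_of_nonneg_left (act_norm_le _ _) (pow_pos D.hρ0 q).le
  have hinf : (Set.range f).Infinite := by
    intro hfin
    have h0 := hfin.isClosed.mem_of_tendsto hft (Eventually.of_forall fun q => Set.mem_range_self q)
    obtain ⟨q, hq⟩ := h0
    exact hf0 q hq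
  obtain ⟨t, hts, htc⟩ := hinf.exists_subset_card_eq K
  have e : Fin K ≃ t := (Finset.equivFinOfCardEq htc).symm
  choose qq hqq using fun i : Fin K => hts (e i).2
  set Q := m + Finset.univ.sup qq
  refine ⟨Q, fun i => D.pad (Q - (m + qq i)) (CD.cat m b fun _ => D.i0), ?_⟩
  have hval : ∀ i, D.ss (D.pad (Q - (m + qq i)) (CD.cat m b fun _ => D.i0)) Q = e i := by
    intro i
    have h1 : m + qq i ≤ Q := Nat.add_le_add_left (Finset.le_sup (f := qq) (Finset.mem_univ i)) m
    have h2 := D.ss_pad (Q - (m + qq i)) (CD.cat m b fun _ => D.i0) (m + qq i)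
    rw [Nat.sub_add_cancel h1] at h2
    rw [h2]
    exact hqq i
  intro i j hij
  simp only [hval] at hij
  exact e.injective (Subtype.ext hij)

end

section

variable {M N : ℕ} {ι : Type}

lemma core_step [NeZero M] (c R0 θ : ℝ) (hred : ∀ g : BMat M N, Good c g → ∃ γ : GLZ M N, ‖g * zm γ‖ ≤ R0)
    (hz : ∀ (z : BMat M N) (β : MatSpace M N) (u : KK M N) (hh : BMat M N) (γ : GLZ M N), ‖z‖ ≤ R0 →
      |z.det| = 1 → ‖β‖ < θ → ‖kap u - 1‖ < θ → ‖hh - 1‖ < θ →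
      Um (-β) * kap u * hh * z = z * zm γ → kap u * hh = Um β)
    (r : ℝ) (hr : 0 < r) (hr1 : r ≤ 1) (α α' : MatSpace M N) (G : BMat M N) (γ γ' : GLZ M N) (u : KK M N) (hh : BMat M N)
    (hg : Good c (Um α * G * zm γ)) (heq : Um α' * G * zm γ' = kap u * hh * (Um α * G * zm γ))
    (hβ : ‖r • (α' - α)‖ < θ) (hu : ‖kap u - 1‖ < θ) (hh1 : ‖hh - 1‖ < θ) (h21 : r⁻¹ * ‖hh.toBlocks₂₁‖ < θ) :
    ‖α' - α‖ ≤ M * ‖hh.toBlocks₁₂‖ := by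
  have hθ : 0 < θ := (norm_nonneg _).trans_lt hu
  set E := el M N r with hE
  set F := el M N r⁻¹ with hF
  have hFE : F * E = 1 := el_inv_mul r hr
  set h' := E * hh * F with hh'
  have hb : h' = fromBlocks hh.toBlocks₁₁ (r • hh.toBlocks₁₂) (r⁻¹ • hh.toBlocks₂₁) hh.toBlocks₂₂ := by
    rw [hh', ← el_blocks r _ _ _ _ hr, Matrix.fromBlocks_toBlocks]
  have hn : ‖h' - 1‖ < θ := by
    rw [Matrix.norm_lt_iff hθ]
    have key : ∀ i j, ‖(hh - 1) i j‖ < θ := fun i j => (Matrix.norm_entry_le_entrywise_sup_norm (hh - 1)).trans_lt hh1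
    rw [hb]
    intro i j
    have k := key i j
    rcases i with i | i <;> rcases j with j | j
    · exact k
    · have k2 : ‖hh (Sum.inl i) (Sum.inr j)‖ < θ := by simpa using k
      have : ‖r * hh (Sum.inl i) (Sum.inr j)‖ < θ := by
        rw [norm_mul, Real.norm_eq_abs, abs_of_pos hr]
        exact (mul_le_of_le_one_left (norm_nonneg _) hr1).trans_lt k2
      simpa [Matrix.toBlocks₁₂] using this
    · have k2 : ‖hh (Sum.inr i) (Sum.inl j)‖ ≤ ‖hh.toBlocks₂₁‖ :=
        Matrix.norm_entry_le_entrywise_sup_norm (i := i) (j := j) hh.toBlocks₂₁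
      have : ‖r⁻¹ * hh (Sum.inr i) (Sum.inl j)‖ < θ := by
        rw [norm_mul, Real.norm_eq_abs, abs_of_pos (inv_pos.2 hr)]
        exact (mul_le_mul_of_nonneg_left k2 (inv_pos.2 hr).le).trans_lt h21
      simpa [Matrix.toBlocks₂₁] using this
    · exact k
  obtain ⟨σ, hσ⟩ := hred _ (Good_el hg hr)
  have hgood := Good_zm (Good_el hg hr) σ
  rw [← hE] at hσ hgood
  have hγ : zm (γ : Matrix (Fin M ⊕ Fin N) (Fin M ⊕ Fin N) ℤ) * zm (γ⁻¹ : GLZ M N) = 1 := zm_inv_mul γ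
  have hσi : zm (σ : Matrix (Fin M ⊕ Fin N) (Fin M ⊕ Fin N) ℤ) * zm (σ⁻¹ : GLZ M N) = 1 := zm_inv_mul σ
  have hUm : Um (-(r • (α' - α))) * (E * Um α') = E * Um α := by
    rw [hE, el_Um r hr, el_Um r hr, ← mul_assoc, Um_mul]
    congr 2
    rw [smul_sub]; abel
  have e1 : kap u * h' * (E * (Um α * G * zm γ) * zm σ) = E * (Um α' * G * zm γ') * zm σ := by
    rw [heq, hh']
    have e0 : kap u * (E * hh * F) * (E * (Um α * G * zm γ) * zm σ)
        = (kap u * E) * hh * (F * E) * (Um α * G * zm γ) * zm σ := by simp only [mul_assoc]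
    rw [e0, hFE, hE, kap_el]
    simp only [mul_assoc, one_mul]
  have e2 : Um (-(r • (α' - α))) * kap u * h' * (E * (Um α * G * zm γ) * zm σ) = E * Um α * G * zm γ' * zm σ := by
    rw [← hUm, mul_assoc (Um (-(r • (α' - α))) * kap u), mul_assoc (Um (-(r • (α' - α)))), ← mul_assoc (kap u), e1]
    simp only [mul_assoc]
  have e3 : E * (Um α * G * zm γ) * zm σ * zm ((σ⁻¹ * γ⁻¹ * γ' * σ : GLZ M N) : Matrix (Fin M ⊕ Fin N) (Fin M ⊕ Fin N) ℤ)
      = E * Um α * G * zm γ' * zm σ := by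
    rw [Units.val_mul, Units.val_mul, Units.val_mul, zm_mul, zm_mul, zm_mul]
    have e4 : E * (Um α * G * zm γ) * zm σ * (zm (σ⁻¹ : GLZ M N) * zm (γ⁻¹ : GLZ M N) * zm γ' * zm σ)
      = E * Um α * G * (zm γ * ((zm σ * zm (σ⁻¹ : GLZ M N)) * zm (γ⁻¹ : GLZ M N))) * zm γ' * zm σ := by
        simp only [mul_assoc]
    rw [e4, hσi, one_mul, hγ, mul_one]
  have hmain := hz _ _ u h' (σ⁻¹ * γ⁻¹ * γ' * σ) hσ hgood.1 hβ hu hn (e2.trans e3.symm)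
  have h12 := congrArg Matrix.toBlocks₁₂ hmain
  rw [hb, kap, Matrix.fromBlocks_multiply, Um, Matrix.toBlocks_fromBlocks₁₂, Matrix.toBlocks_fromBlocks₁₂,
    Matrix.zero_mul, add_zero, Matrix.mul_smul] at h12
  have h3 : (u.1 : Matrix (Fin M) (Fin M) ℝ) * hh.toBlocks₁₂ = α' - α := smul_right_injective _ hr.ne' h12
  rw [← h3]
  have h4 := norm_mul_le_card (u.1 : Matrix (Fin M) (Fin M) ℝ) hh.toBlocks₁₂
  have h5 := orth_norm_le u.1.2
  rw [Fintype.card_fin] at h4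
  refine h4.trans (mul_le_mul_of_nonneg_left ?_ (by positivity))
  exact mul_le_of_le_one_left (norm_nonneg _) h5

variable [TopologicalSpace ι] [DiscreteTopology ι] [Finite ι]

theorem core [NeZero M] [NeZero N] (D : CD ι M N) (hspan : Submodule.span ℝ D.PP = ⊤) (Rb : ℝ)
    (hb : ∀ b m, ‖D.ss b m‖ ≤ Rb) (c : ℝ) (hc : 0 < c) (g0 : BMat M N) (h0 : ∀ b m, Good c (Um (D.ss b m) * g0)) : False := by
  obtain ⟨R, Z, h⟩ := exists_minSys D c hc g0 h0
  obtain ⟨η, hη, C, hC, hdrift⟩ := drift h hc hspan Rb hb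
  obtain ⟨R0, hred⟩ := Good_reduce (M := M) (N := N) c hc
  obtain ⟨θ, hθ, hz⟩ := zrig (M := M) (N := N) R0
  obtain ⟨L, hL0, hL⟩ := h_lip (M := M) (N := N) R
  have hρ0 := D.hρ0
  have hρ1 := D.hρ1
  set η' := min (min η θ) (min θ 1 / (2 * L + 1)) with hη'
  have hm1 : 0 < min θ 1 := lt_min hθ one_pos
  have hη'0 : 0 < η' := lt_min (lt_min hη hθ) (by positivity)
  have hη'1 : η' ≤ η := (min_le_left _ _).trans (min_le_left _ _)
  have hη'2 : η' ≤ θ := (min_le_left _ _).trans (min_le_right _ _)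
  have hη'3 : L * (η' + η') < min θ 1 := by
    have : η' ≤ min θ 1 / (2 * L + 1) := min_le_right _ _
    rw [le_div_iff₀ (by positivity)] at this
    nlinarith
  obtain ⟨K, hK⟩ := pigeon (M := M) (N := N) R η' hη'0
  obtain ⟨q, a, ha⟩ := many_words D hspan Rb hb (K + 1)
  have hRb : 0 ≤ Rb := (norm_nonneg _).trans (hb (fun _ => D.i0) 0)
  obtain ⟨e, he⟩ := exists_pow_lt_of_lt_one (show 0 < θ / ((M * N : ℝ) * (2 * Rb) + 1) by positivity) hρ1
  have he' : D.ρ ^ e * ((M * N : ℝ) * (2 * Rb)) < θ := by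
    rw [lt_div_iff₀ (by positivity)] at he
    have := pow_pos hρ0 e
    nlinarith
  obtain ⟨κ, hκ, hκ'⟩ : ∃ κ > 0, ∀ i j, i ≠ j → κ ≤ ‖D.ss (a j) q - D.ss (a i) q‖ := by
    have : ∃ κ > 0, ∀ p ∈ (Finset.univ : Finset (Fin (K+1) × Fin (K+1))), p.1 ≠ p.2 → κ ≤ ‖D.ss (a p.2) q - D.ss (a p.1) q‖ := by
      have : ∀ s : Finset (Fin (K+1) × Fin (K+1)), ∃ κ > 0, ∀ p ∈ s, p.1 ≠ p.2 → κ ≤ ‖D.ss (a p.2) q - D.ss (a p.1) q‖ := by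
        intro s
        classical
        induction s using Finset.induction_on with
        | empty => exact ⟨1, one_pos, by simp⟩
        | insert p s hp ih =>
          obtain ⟨κ, hκ, h1⟩ := ih
          by_cases hpp : p.1 = p.2
          · refine ⟨κ, hκ, fun p' hp' => ?_⟩
            rcases Finset.mem_insert.1 hp' with rfl | hp'
            · exact fun h => absurd hpp h
            · exact h1 p' hp'
          · refine ⟨min κ ‖D.ss (a p.2) q - D.ss (a p.1) q‖, lt_min hκ ?_, fun p' hp' hne => ?_⟩
            · rw [norm_pos_iff, sub_ne_zero]
              exact fun h => hpp (ha h).symm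
            · rcases Finset.mem_insert.1 hp' with rfl | hp'
              · exact min_le_right _ _
              · exact (min_le_left _ _).trans (h1 p' hp' hne)
      exact this _
    obtain ⟨κ, hκ, h1⟩ := this
    exact ⟨κ, hκ, fun i j hij => h1 (i, j) (Finset.mem_univ _) hij⟩
  obtain ⟨n, hn⟩ := exists_pow_lt_of_lt_one (show 0 < min (θ * D.ρ ^ (q + e) / C) (κ / (M * (M * N : ℝ) + 1)) from
    lt_min (div_pos (mul_pos hθ (pow_pos hρ0 _)) hC) (by positivity)) hρ1
  have hn1 : C * D.ρ ^ n < θ * D.ρ ^ (q + e) := by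
    have := (lt_min_iff.1 hn).1
    rw [lt_div_iff₀ hC] at this
    linarith
  have hn2 : D.ρ ^ n * (M * (M * N : ℝ)) < κ := by
    have := (lt_min_iff.1 hn).2
    rw [lt_div_iff₀ (by positivity)] at this
    have := pow_pos hρ0 n
    nlinarith
  obtain ⟨y, hy⟩ := h.ne
  set w : Fin (K + 1) → St ι M N := fun i => D.mv (n + q) (D.pad n (a i)) y with hw
  have hwZ : ∀ i, w i ∈ Z := fun i => h.mv _ _ y hy
  choose γ hγ using fun i => h.red (w i) (hwZ i)
  have hxZ : ∀ i, rg (γ i) (w i) ∈ Z := fun i => h.rg _ _ (hwZ i)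
  obtain ⟨i, j, hij, hu, hg⟩ := hK (fun i => (w i).2.1) (fun i => (rg (γ i) (w i)).2.2) hγ
  set u := (w j).2.1 * ((w i).2.1)⁻¹ with hud
  set g := (rg (γ i) (w i)).2.2 with hgd
  set g' := (rg (γ j) (w j)).2.2 with hgd'
  have hgg : Good c g := h.good _ (hxZ i)
  have hdet : g.det ≠ 0 := fun h0 => by have := hgg.1; simp [h0] at this
  set hh : BMat M N := kap u⁻¹ * g' * ((g.det)⁻¹ • g.adjugate) with hhd
  have hgi : ((g.det)⁻¹ • g.adjugate) * g = 1 := by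
    rw [Matrix.smul_mul, Matrix.adjugate_mul, smul_smul, inv_mul_cancel₀ hdet, one_smul]
  have heq : g' = kap u * hh * g := by
    have e0 : kap u * (kap u⁻¹ * g' * ((g.det)⁻¹ • g.adjugate)) * g = (kap u * kap u⁻¹) * g' * (((g.det)⁻¹ • g.adjugate) * g) := by
      simp only [mul_assoc]
    rw [hhd, e0, hgi, kap_mul_inv, one_mul, mul_one]
  have hh1 := hL g g' hh u (hγ i) hgg.1 heq
  have hh2 : ‖hh - 1‖ < min θ 1 := by
    refine hh1.trans_lt (lt_of_le_of_lt ?_ hη'3)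
    exact mul_le_mul_of_nonneg_left (add_le_add hg.le hu.le) hL0
  have hfirst : ∀ l < n, (rg (γ i) (w i)).1 l = (rg (γ j) (w j)).1 l := by
    intro l hl
    have : l < n + q := by omega
    simp [rg, hw, CD.mv, CD.spl, this, CD.pad, CD.cat, hl]
  have h21 := hdrift _ (hxZ i) _ (hxZ j) (hγ i) (hγ j) n hfirst (hu.trans_le hη'1) (hg.trans_le hη'1) hh heq
  set k := n + q + e with hk
  set r := D.ρ ^ k with hr
  have hr0 : 0 < r := pow_pos hρ0 k
  have hr1 : r ≤ 1 := pow_le_one₀ hρ0.le hρ1.le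
  set o := y.2.1 * (D.tau y.1 (n + q))⁻¹ with ho
  have hds : D.dsp (n + q) (D.pad n (a j)) y.1 y.2.1 - D.dsp (n + q) (D.pad n (a i)) y.1 y.2.1
      = (D.ρ ^ (n + q))⁻¹ • act o (D.ss (a j) q - D.ss (a i) q) := by
    simp only [CD.dsp, D.ss_pad]
    rw [← smul_sub, ← map_sub, sub_sub_sub_cancel_right]
  have hρnq := pow_pos hρ0 (n + q)
  have hA : ‖r • (D.dsp (n + q) (D.pad n (a j)) y.1 y.2.1 - D.dsp (n + q) (D.pad n (a i)) y.1 y.2.1)‖ < θ := by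
    rw [hds, smul_smul]
    have : r * (D.ρ ^ (n + q))⁻¹ = D.ρ ^ e := by
      rw [hr, hk, pow_add _ (n + q)]; field_simp
    rw [this, norm_smul, Real.norm_eq_abs, abs_of_pos (pow_pos hρ0 e)]
    refine lt_of_le_of_lt (mul_le_mul_of_nonneg_left ?_ (pow_pos hρ0 e).le) he'
    refine (act_norm_le _ _).trans (mul_le_mul_of_nonneg_left ?_ (by positivity))
    have := norm_sub_le (D.ss (a j) q) (D.ss (a i) q)
    linarith [hb (a j) q, hb (a i) q]
  have hB : r⁻¹ * ‖hh.toBlocks₂₁‖ < θ := by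
    rw [inv_mul_lt_iff₀ hr0]
    refine h21.trans_lt ?_
    have e1 : r = D.ρ ^ n * D.ρ ^ (q + e) := by rw [hr, hk, add_assoc, pow_add]
    rw [e1]
    have := pow_pos hρ0 n
    nlinarith
  have hstep := core_step c R0 θ hred hz r hr0 hr1 (D.dsp (n + q) (D.pad n (a i)) y.1 y.2.1)
    (D.dsp (n + q) (D.pad n (a j)) y.1 y.2.1) y.2.2 (γ i) (γ j) u hh hgg heq hA (hu.trans_le hη'2)
    (hh2.trans_le (min_le_left _ _)) hB
  have hb12 : ‖hh.toBlocks₁₂‖ ≤ 1 := by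
    have h1 := tb12_norm (hh - 1)
    have h2 : (hh - 1).toBlocks₁₂ = hh.toBlocks₁₂ := by
      ext x y; simp [Matrix.toBlocks₁₂]
    rw [h2] at h1
    exact h1.trans (hh2.le.trans (min_le_right _ _))
  rw [hds, norm_smul, norm_inv, Real.norm_eq_abs, abs_of_pos hρnq, inv_mul_le_iff₀ hρnq] at hstep
  have h7 := norm_le_act o (D.ss (a j) q - D.ss (a i) q)
  have h8 := hκ' i j hij
  have hM : (0 : ℝ) ≤ M := by positivity
  have h9 : D.ρ ^ (n + q) ≤ D.ρ ^ n := pow_le_pow_of_le_one hρ0.le hρ1.le (Nat.le_add_right n q)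
  have h10 : D.ρ ^ (n + q) * (M * ‖hh.toBlocks₁₂‖) ≤ D.ρ ^ n * (M * 1) := by gcongr
  have h11 : (M * N : ℝ) * ‖act o (D.ss (a j) q - D.ss (a i) q)‖ ≤ (M * N : ℝ) * (D.ρ ^ n * (M * 1)) :=
    mul_le_mul_of_nonneg_left (hstep.trans h10) (by positivity)
  nlinarith

end

section

variable {M N : ℕ}

/-- data of a similarity -/
abbrev Sim (M N : ℕ) := ℝ × KK M N × MatSpace M N

/-- application of a similarity -/
def ap (s : Sim M N) (x : MatSpace M N) : MatSpace M N := s.1 • act s.2.1 x + s.2.2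

/-- composition of similarities -/
def sCmp (s t : Sim M N) : Sim M N := (s.1 * t.1, s.2.1 * t.2.1, s.1 • act s.2.1 t.2.2 + s.2.2)

lemma ap_cmp (s t : Sim M N) (x : MatSpace M N) : ap (sCmp s t) x = ap s (ap t x) := by
  simp only [ap, sCmp, map_add, map_smul, act_mul, smul_add, smul_smul, add_assoc]

lemma ap_sub (s : Sim M N) (x y : MatSpace M N) : ap s x - ap s y = s.1 • act s.2.1 (x - y) := by
  simp only [ap, map_sub, smul_sub]; abel

lemma ap_cont (s : Sim M N) : Continuous (ap s) := by
  unfold ap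
  exact ((act_cont' continuous_const continuous_id).const_smul s.1).add continuous_const

/-- similarities preserving a set -/
def Pres (C : Set (MatSpace M N)) : Set (Sim M N) := {s | 0 < s.1 ∧ ∀ x ∈ C, ap s x ∈ C}

lemma Pres_cmp {C : Set (MatSpace M N)} {s t : Sim M N} (hs : s ∈ Pres C) (ht : t ∈ Pres C) : sCmp s t ∈ Pres C :=
  ⟨mul_pos hs.1 ht.1, fun x hx => by rw [ap_cmp]; exact hs.2 _ (ht.2 x hx)⟩

lemma Pres_one (C : Set (MatSpace M N)) : ((1, 1, 0) : Sim M N) ∈ Pres C :=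
  ⟨one_pos, fun x hx => by simpa [ap, act_one] using hx⟩

lemma sim_of_alg {r : ℝ} {f : MatSpace M N → MatSpace M N} (h : IsAlgebraicSimilarity r f) :
    ∃ s : Sim M N, s.1 = r ∧ 0 < r ∧ ∀ x, f x = ap s x := by
  obtain ⟨hr, B, hB, C, hC, δ, h⟩ := h
  refine ⟨(r, (⟨B, hB⟩, ⟨Cᵀ, orth_transpose_mem hC⟩), δ), rfl, hr, fun x => ?_⟩
  rw [h, ap, act_apply]
  simp

lemma smul_act_norm (ρ : ℝ) (hρ : 0 ≤ ρ) (k : KK M N) (x : MatSpace M N) : ‖ρ • act k x‖ ≤ ρ * ((M * N : ℝ) * ‖x‖) := by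
  rw [norm_smul, Real.norm_eq_abs, abs_of_nonneg hρ]
  exact mul_le_mul_of_nonneg_left (act_norm_le _ _) hρ

lemma fix_exists {C : Set (MatSpace M N)} (hcl : IsClosed C) (hne : C.Nonempty) {s : Sim M N} (hs : s ∈ Pres C)
    (h1 : s.1 < 1) : ∃ p ∈ C, ap s p = p := by
  obtain ⟨x0, hx0⟩ := hne
  set f : ℕ → MatSpace M N := fun n => (ap s)^[n] x0 with hf
  have hfs : ∀ n, f (n + 1) = ap s (f n) := fun n => Function.iterate_succ_apply' _ _ _
  have hfC : ∀ n, f n ∈ C := by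
    intro n
    induction n with
    | zero => exact hx0
    | succ n ih => rw [hfs]; exact hs.2 _ ih
  have hdiff : ∀ n, f (n + 1) - f n = s.1 ^ n • act (s.2.1 ^ n) (f 1 - f 0) := by
    intro n
    induction n with
    | zero => simp [act_one]
    | succ n ih =>
      rw [hfs, hfs n, ap_sub, ← hfs, ih, map_smul, smul_smul, pow_succ', pow_succ' s.2.1, act_mul]
  have hc : CauchySeq f := by
    refine cauchySeq_of_le_geometric s.1 ((M * N : ℝ) * ‖f 1 - f 0‖) h1 fun n => ?_
    rw [dist_comm, dist_eq_norm, hdiff, mul_comm]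
    exact smul_act_norm _ (pow_pos hs.1 n).le _ _
  obtain ⟨p, hp⟩ := cauchySeq_tendsto_of_complete hc
  refine ⟨p, hcl.mem_of_tendsto hp (Eventually.of_forall hfC), ?_⟩
  have h2 : Tendsto (fun n => f (n + 1)) atTop (𝓝 (ap s p)) := by
    have : (fun n => f (n + 1)) = fun n => ap s (f n) := funext hfs
    rw [this]
    exact ((ap_cont s).tendsto p).comp hp
  exact tendsto_nhds_unique h2 ((tendsto_add_atTop_iff_nat 1).2 hp)

lemma pow_pres {C : Set (MatSpace M N)} {s : Sim M N} (hs : s ∈ Pres C) {p : MatSpace M N} (hp : ap s p = p) (n : ℕ) :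
    ∃ t ∈ Pres C, t.1 = s.1 ^ n ∧ ∀ y, ap t y = s.1 ^ n • act (s.2.1 ^ n) (y - p) + p := by
  induction n with
  | zero => exact ⟨_, Pres_one C, by simp, fun y => by simp [ap, act_one]⟩
  | succ n ih =>
    obtain ⟨t, ht, h1, h2⟩ := ih
    refine ⟨sCmp s t, Pres_cmp hs ht, by simp [sCmp, h1, pow_succ'], fun y => ?_⟩
    have h3 := ap_sub s (ap t y) p
    rw [hp, sub_eq_iff_eq_add] at h3
    rw [ap_cmp, h3, h2, add_sub_cancel_right, map_smul, smul_smul, pow_succ', pow_succ' s.2.1, act_mul]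

lemma prod_pres {C : Set (MatSpace M N)} {ι : Type*} (v : ι → Sim M N) (hv : ∀ i, v i ∈ Pres C) (s : Finset ι) :
    ∃ t ∈ Pres C, t.1 = ∏ i ∈ s, (v i).1 := by
  classical
  induction s using Finset.induction_on with
  | empty => exact ⟨_, Pres_one C, by simp⟩
  | insert i s hi ih =>
    obtain ⟨t, ht, h1⟩ := ih
    exact ⟨sCmp (v i) t, Pres_cmp (hv i) ht, by rw [Finset.prod_insert hi, ← h1, sCmp]⟩

/-- a similarity as affine map -/
def apA (s : Sim M N) : MatSpace M N →ᵃ[ℝ] MatSpace M N where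
  toFun := ap s
  linear := s.1 • act s.2.1
  map_vadd' := by intro p v; simp [ap, add_assoc]

lemma span_top {E : Type*} {φ : E → MatSpace M N → MatSpace M N} {r : E → ℝ}
    (hsim : ∀ e, IsAlgebraicSimilarity (r e) (φ e)) (hirr : IrreducibleMatIFS φ) (O : Set (MatSpace M N)) (hne : O.Nonempty)
    (hO : ∀ e, ∀ x ∈ O, φ e x ∈ O) : affineSpan ℝ O = ⊤ := by
  by_contra htop
  apply hirr
  refine ⟨affineSpan ℝ O, hne.mono (subset_affineSpan ℝ O), htop, fun e => ?_⟩
  obtain ⟨s, hs1, hr, hs⟩ := sim_of_alg (hsim e)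
  have hfe : φ e = apA s := funext hs
  have hinj : Function.Injective (s.1 • act s.2.1 : MatSpace M N →ₗ[ℝ] MatSpace M N) := by
    intro x y hxy
    have h1 : s.1 • act s.2.1 x = s.1 • act s.2.1 y := hxy
    have h2 := smul_right_injective _ (by rw [hs1]; exact hr.ne' : s.1 ≠ 0) h1
    rw [← act_inv_act s.2.1 x, h2, act_inv_act]
  have hle : (affineSpan ℝ O).map (apA s) ≤ affineSpan ℝ O := by
    rw [AffineSubspace.map_span]
    apply affineSpan_mono
    rintro _ ⟨x, hx, rfl⟩
    rw [← hfe]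
    exact hO e x hx
  have heq : (affineSpan ℝ O).map (apA s) = affineSpan ℝ O := by
    apply AffineSubspace.eq_of_direction_eq_of_nonempty_of_le _ _ hle
    · apply Submodule.eq_of_le_of_finrank_eq (AffineSubspace.direction_le hle)
      rw [AffineSubspace.map_direction]
      exact (LinearEquiv.finrank_eq (Submodule.equivMapOfInjective _ hinj _)).symm
    · obtain ⟨x, hx⟩ := hne
      exact ⟨apA s x, AffineSubspace.mem_map_of_mem _ (subset_affineSpan ℝ O hx)⟩
  rw [hfe, ← AffineSubspace.coe_map, heq]

lemma ss_bdd {ι : Type} [Finite ι] (D : CD ι M N) : ∃ Rb, ∀ b m, ‖D.ss b m‖ ≤ Rb := by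
  obtain ⟨Δ, hΔ⟩ := Finite.exists_le (fun i => ‖D.δ i‖)
  have hΔ0 : 0 ≤ Δ := (norm_nonneg _).trans (hΔ D.i0)
  have h1 : 0 < 1 - D.ρ := sub_pos.2 D.hρ1
  have key : ∀ b m k, ‖act k (D.ss b m)‖ ≤ (M * N : ℝ) * Δ / (1 - D.ρ) := by
    intro b m
    induction m with
    | zero => intro k; simp only [CD.ss, map_zero, norm_zero]; positivity
    | succ m ih =>
      intro k
      simp only [CD.ss, map_add, map_smul]
      rw [← act_mul]
      refine (norm_add_le _ _).trans ?_
      rw [norm_smul, Real.norm_eq_abs, abs_of_pos D.hρ0]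
      have h2 := mul_le_mul_of_nonneg_left (ih (k * D.T (b m))) D.hρ0.le
      have h3 := (act_norm_le k (D.δ (b m))).trans (mul_le_mul_of_nonneg_left (hΔ (b m)) (by positivity))
      have h4 : D.ρ * ((M * N : ℝ) * Δ / (1 - D.ρ)) + (M * N : ℝ) * Δ = (M * N : ℝ) * Δ / (1 - D.ρ) := by
        field_simp; ring
      linarith
  exact ⟨_, fun b m => by simpa [act_one] using key b m 1⟩

end

section

variable {M N : ℕ}

lemma G_aux {C : Set (MatSpace M N)} (hcl : IsClosed C) (hne : C.Nonempty) {n : ℕ} (i0 : Fin n) (v : Fin n → Sim M N)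
    (hv : ∀ i, v i ∈ Pres C) {s0 : Sim M N} (hs0 : s0 ∈ Pres C) (hs1 : s0.1 < 1) {p0 : MatSpace M N} (hp0 : ap s0 p0 = p0)
    (hind : AffineIndependent ℝ fun i => ap (v i) p0) (hspan : affineSpan ℝ (Set.range fun i => ap (v i) p0) = ⊤) :
    ∃ (ρ : ℝ) (Ψ : Fin n → Sim M N) (p : MatSpace M N), 0 < ρ ∧ ρ < 1 ∧ (∀ i, Ψ i ∈ Pres C) ∧ (∀ i, (Ψ i).1 = ρ) ∧
      p ∈ C ∧ ap (Ψ i0) p = p ∧ affineSpan ℝ (Set.range fun i => ap (Ψ i) p) = ⊤ := by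
  classical
  set Λ := ∏ i, (v i).1 with hΛ
  have hΛ0 : 0 < Λ := Finset.prod_pos fun i _ => (hv i).1
  choose W hW hW1 using fun i => prod_pres v hv (Finset.univ.erase i)
  have hWΛ : ∀ i, (v i).1 * (W i).1 = Λ := fun i => by
    rw [hW1, hΛ]; exact Finset.mul_prod_erase Finset.univ (fun i => (v i).1) (Finset.mem_univ i)
  choose S hS hS1 hS2 using fun m => pow_pres hs0 hp0 m
  set Ψ : ℕ → Fin n → Sim M N := fun m i => sCmp (v i) (sCmp (S m) (W i)) with hΨ
  have hΨP : ∀ m i, Ψ m i ∈ Pres C := fun m i => Pres_cmp (hv i) (Pres_cmp (hS m) (hW i))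
  have hΨ1 : ∀ m i, (Ψ m i).1 = Λ * s0.1 ^ m := fun m i => by
    simp only [hΨ, sCmp]
    rw [hS1, ← hWΛ i]; ring
  have hpow : Tendsto (fun m : ℕ => s0.1 ^ m) atTop (𝓝 0) := tendsto_pow_atTop_nhds_zero_of_lt_one hs0.1.le hs1
  have hR : Tendsto (fun m : ℕ => Λ * s0.1 ^ m) atTop (𝓝 0) := by simpa using hpow.const_mul Λ
  have hRp : ∀ m, 0 < Λ * s0.1 ^ m := fun m => mul_pos hΛ0 (pow_pos hs0.1 m)
  have hSy : ∀ y, Tendsto (fun m => ap (S m) y) atTop (𝓝 p0) := by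
    intro y
    have h1 : Tendsto (fun m => s0.1 ^ m • act (s0.2.1 ^ m) (y - p0)) atTop (𝓝 0) := by
      have h2 : Tendsto (fun m : ℕ => s0.1 ^ m * ((M * N : ℝ) * ‖y - p0‖)) atTop (𝓝 0) := by
        simpa using hpow.mul_const ((M * N : ℝ) * ‖y - p0‖)
      exact squeeze_zero_norm (fun m => smul_act_norm _ (pow_pos hs0.1 m).le _ _) h2
    have h3 := h1.add_const p0
    rw [zero_add] at h3
    refine h3.congr fun m => ?_
    rw [hS2]
  have hD : ∀ i, Tendsto (fun m => ap (Ψ m i) 0) atTop (𝓝 (ap (v i) p0)) := by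
    intro i
    have h1 := ((ap_cont (v i)).tendsto p0).comp (hSy (ap (W i) 0))
    refine h1.congr fun m => ?_
    simp only [hΨ, ap_cmp, Function.comp]
  have hev1 : ∀ᶠ m in atTop, Λ * s0.1 ^ m < 1 := hR.eventually (gt_mem_nhds one_pos)
  have hev2 : ∀ᶠ m in atTop, Λ * s0.1 ^ m * (M * N : ℝ) < 1 / 2 := by
    have : Tendsto (fun m : ℕ => Λ * s0.1 ^ m * (M * N : ℝ)) atTop (𝓝 0) := by simpa using hR.mul_const (M * N : ℝ)
    exact this.eventually (gt_mem_nhds (by norm_num))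
  have hp : ∀ m, ∃ p, Λ * s0.1 ^ m < 1 → p ∈ C ∧ ap (Ψ m i0) p = p := by
    intro m
    by_cases h : Λ * s0.1 ^ m < 1
    · obtain ⟨p, h1, h2⟩ := fix_exists hcl hne (hΨP m i0) (by rw [hΨ1]; exact h)
      exact ⟨p, fun _ => ⟨h1, h2⟩⟩
    · exact ⟨0, fun h' => absurd h' h⟩
  choose p hp using hp
  have hdiff : ∀ m i, ap (Ψ m i) (p m) - ap (Ψ m i) 0 = (Λ * s0.1 ^ m) • act (Ψ m i).2.1 (p m) := by
    intro m i
    rw [ap_sub, sub_zero, hΨ1]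
  have hpb : ∀ᶠ m in atTop, ‖p m‖ ≤ 2 * (‖ap (v i0) p0‖ + 1) := by
    have h3 : ∀ᶠ m in atTop, ‖ap (Ψ m i0) 0‖ < ‖ap (v i0) p0‖ + 1 := (hD i0).norm.eventually (gt_mem_nhds (by linarith))
    filter_upwards [hev1, hev2, h3] with m h1 h2 h3
    have h4 := (hp m h1).2
    have h5 := hdiff m i0
    rw [h4, sub_eq_iff_eq_add] at h5
    have h6 : ‖p m‖ ≤ ‖(Λ * s0.1 ^ m) • act (Ψ m i0).2.1 (p m)‖ + ‖ap (Ψ m i0) 0‖ := by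
      have := norm_add_le ((Λ * s0.1 ^ m) • act (Ψ m i0).2.1 (p m)) (ap (Ψ m i0) 0)
      rwa [← h5] at this
    have h7 := smul_act_norm _ (hRp m).le (Ψ m i0).2.1 (p m)
    have h8 : Λ * s0.1 ^ m * (M * N : ℝ) * ‖p m‖ ≤ 1 / 2 * ‖p m‖ := mul_le_mul_of_nonneg_right h2.le (norm_nonneg _)
    linarith
  have hlim : Tendsto (fun m i => ap (Ψ m i) (p m)) atTop (𝓝 fun i => ap (v i) p0) := by
    refine tendsto_pi_nhds.2 fun i => ?_
    have h1 : Tendsto (fun m => (Λ * s0.1 ^ m) • act (Ψ m i).2.1 (p m)) atTop (𝓝 0) := by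
      have h2 : Tendsto (fun m : ℕ => Λ * s0.1 ^ m * ((M * N : ℝ) * (2 * (‖ap (v i0) p0‖ + 1)))) atTop (𝓝 0) := by
        simpa using hR.mul_const ((M * N : ℝ) * (2 * (‖ap (v i0) p0‖ + 1)))
      refine squeeze_zero_norm' ?_ h2
      filter_upwards [hpb] with m hm
      refine (smul_act_norm _ (hRp m).le _ _).trans ?_
      exact mul_le_mul_of_nonneg_left (mul_le_mul_of_nonneg_left hm (by positivity)) (hRp m).le
    have h3 := h1.add (hD i)
    rw [zero_add] at h3
    refine h3.congr fun m => ?_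
    rw [← hdiff, sub_add_cancel]
  have hopen := (isOpen_setOfPred_affineIndependent (𝕜 := ℝ) (E := MatSpace M N) (ι := Fin n)).mem_nhds hind
  obtain ⟨m, hm1, hm2⟩ := (hev1.and (hlim.eventually hopen)).exists
  refine ⟨Λ * s0.1 ^ m, Ψ m, p m, hRp m, hm1, hΨP m, hΨ1 m, (hp m hm1).1, (hp m hm1).2, ?_⟩
  have hm3 : AffineIndependent ℝ fun i => ap (Ψ m i) (p m) := hm2
  rw [hm3.affineSpan_eq_top_iff_card_eq_finrank_add_one]
  exact hind.affineSpan_eq_top_iff_card_eq_finrank_add_one.1 hspan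

theorem G_part {E : Type*} {φ : E → MatSpace M N → MatSpace M N} {r : E → ℝ}
    (hsim : ∀ e, IsAlgebraicSimilarity (r e) (φ e)) (hirr : IrreducibleMatIFS φ) (e0 : E) (he0 : r e0 < 1)
    {C : Set (MatSpace M N)} (hcl : IsClosed C) (hne : C.Nonempty) (hC : ∀ e, ∀ x ∈ C, φ e x ∈ C) :
    ∃ (n : ℕ) (D : CD (Fin n) M N) (p : MatSpace M N), Submodule.span ℝ D.PP = ⊤ ∧ ∀ b m, p + D.ss b m ∈ C := by
  choose s hs1 hr hs using fun e => sim_of_alg (hsim e)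
  have hsP : ∀ e, s e ∈ Pres C := fun e => ⟨by rw [hs1]; exact hr e, fun x hx => by rw [← hs]; exact hC e x hx⟩
  obtain ⟨p0, hp0C, hp0⟩ := fix_exists hcl hne (hsP e0) (by rw [hs1]; exact he0)
  set O := {x | ∃ t ∈ Pres C, ap t p0 = x} with hO
  have htop : affineSpan ℝ O = ⊤ := by
    refine span_top hsim hirr O ⟨_, _, Pres_one C, rfl⟩ ?_
    rintro e _ ⟨t, ht, rfl⟩
    exact ⟨sCmp (s e) t, Pres_cmp (hsP e) ht, by rw [ap_cmp, hs]⟩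
  obtain ⟨t, htO, hts, hti⟩ := exists_affineIndependent ℝ (MatSpace M N) O
  rw [htop] at hts
  haveI : Finite t := finite_of_fin_dim_affineIndependent ℝ hti
  set en := Finite.equivFin t
  choose v hv hvp using fun i => htO (en.symm i).2
  have hx : (fun i => ap (v i) p0) = fun i => ((en.symm i : t) : MatSpace M N) := funext hvp
  have hind : AffineIndependent ℝ fun i => ap (v i) p0 := by
    rw [hx]; exact hti.comp_embedding en.symm.toEmbedding
  have hspan : affineSpan ℝ (Set.range fun i => ap (v i) p0) = ⊤ := by
    rw [hx, ← hts]
    congr 1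
    have : (fun i => ((en.symm i : t) : MatSpace M N)) = Subtype.val ∘ en.symm := rfl
    rw [this, Set.range_comp, en.symm.range_eq_univ, Set.image_univ, Subtype.range_coe]
  have hi0 : Nonempty (Fin (Nat.card t)) := by
    by_contra hno
    rw [not_nonempty_iff] at hno
    rw [Set.range_eq_empty, AffineSubspace.span_empty] at hspan
    exact bot_ne_top hspan
  obtain ⟨i0⟩ := hi0
  obtain ⟨ρ, Ψ, p, hρ0, hρ1, hΨ, hΨ1, hpC, hpf, hpspan⟩ := G_aux hcl hne i0 v hv (hsP e0) (by rw [hs1]; exact he0) hp0 hind hspan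
  let D : CD (Fin (Nat.card t)) M N :=
    { i0 := i0, ρ := ρ, hρ0 := hρ0, hρ1 := hρ1, T := fun i => (Ψ i).2.1, δ := fun i => ap (Ψ i) p - p, hδ := by rw [hpf, sub_self] }
  refine ⟨_, D, p, ?_, ?_⟩
  · rw [eq_top_iff]
    have h1 : vectorSpan ℝ (Set.range fun i => ap (Ψ i) p) = ⊤ := by
      rw [← direction_affineSpan, hpspan, AffineSubspace.direction_top]
    rw [← h1, vectorSpan_range_eq_span_range_vsub_right ℝ _ i0]
    apply Submodule.span_mono
    rintro _ ⟨i, rfl⟩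
    refine ⟨fun _ => i, 1, ?_⟩
    simp only [CD.ss, map_zero, smul_zero, zero_add, hpf, vsub_eq_sub]
    rfl
  · intro b m
    induction m with
    | zero => simpa [CD.ss] using hpC
    | succ m ih =>
      have h1 := (hΨ (b m)).2 _ ih
      have h2 := ap_sub (Ψ (b m)) (p + D.ss b m) p
      rw [add_sub_cancel_left, hΨ1, sub_eq_iff_eq_add] at h2
      have h3 : p + D.ss b (m + 1) = ap (Ψ (b m)) (p + D.ss b m) := by
        rw [h2, CD.ss]
        change p + (ρ • act (Ψ (b m)).2.1 (D.ss b m) + (ap (Ψ (b m)) p - p)) = _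
        abel
      rw [h3]; exact h1

theorem no_good [NeZero M] [NeZero N] {E : Type*} {φ : E → MatSpace M N → MatSpace M N} {r : E → ℝ}
    (hsim : ∀ e, IsAlgebraicSimilarity (r e) (φ e)) (hirr : IrreducibleMatIFS φ) (e0 : E) (he0 : r e0 < 1)
    {C : Set (MatSpace M N)} (hcl : IsClosed C) (hne : C.Nonempty) (hC : ∀ e, ∀ x ∈ C, φ e x ∈ C)
    (c : ℝ) (hc : 0 < c) (g0 : BMat M N) (h0 : ∀ x ∈ C, Good c (Um x * g0)) : False := by
  obtain ⟨n, D, p, hspan, hD⟩ := G_part hsim hirr e0 he0 hcl hne hC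
  obtain ⟨Rb, hb⟩ := ss_bdd D
  refine core D hspan Rb hb c hc (Um p * g0) fun b m => ?_
  rw [← mul_assoc, Um_mul, add_comm]
  exact h0 _ (hD b m)

end

section

variable {M N : ℕ}

/-- uniformly badly approximable matrices -/
def BAc (M N : ℕ) (c : ℝ) : Set (MatSpace M N) := {α | ∀ q : Fin N → ℤ, q ≠ 0 → ∀ p : Fin M → ℤ,
    c * ‖zc q‖ ^ (-(N : ℝ) / M) ≤ ‖α *ᵥ zc q - zc p‖}

/-- the matrix attached to a similarity -/
def gw (s : Sim M N) : BMat M N := kap s.2.1⁻¹ * el M N s.1⁻¹ * Um s.2.2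

lemma Um_gw [NeZero M] (s : Sim M N) (hs : 0 < s.1) (α : MatSpace M N) :
    Um α * gw s = kap s.2.1⁻¹ * el M N s.1⁻¹ * Um (ap s α) := by
  have h1 : Um (ap s α) = Um (s.1 • act s.2.1 α) * Um s.2.2 := by rw [Um_mul, ap]
  have h2 := el_Um s.1⁻¹ (inv_pos.2 hs) (s.1 • act s.2.1 α)
  rw [smul_smul, inv_mul_cancel₀ hs.ne', one_smul] at h2
  have h3 := kap_Um s.2.1⁻¹ (act s.2.1 α)
  rw [act_inv_act] at h3
  rw [h1, gw]
  calc Um α * (kap s.2.1⁻¹ * el M N s.1⁻¹ * Um s.2.2)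
      = (Um α * kap s.2.1⁻¹) * el M N s.1⁻¹ * Um s.2.2 := by simp only [mul_assoc]
    _ = kap s.2.1⁻¹ * (Um (act s.2.1 α) * el M N s.1⁻¹) * Um s.2.2 := by
        rw [← h3]; simp only [mul_assoc]
    _ = _ := by rw [← h2]; simp only [mul_assoc]

lemma kap_Dg (k : KK M N) : kap k = Dg 1 1 (k.1 : Matrix (Fin M) (Fin M) ℝ) (k.2 : Matrix (Fin N) (Fin N) ℝ) := by
  simp [kap, Dg]

lemma nform_kel (k : KK M N) (r : ℝ) (hr : 0 < r) (x : Fin M ⊕ Fin N → ℝ) : nform ((kap k * el M N r) *ᵥ x) = nform x := by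
  rw [← Matrix.mulVec_mulVec, kap_Dg, nform_Dg (by simp) k.1.2 k.2.2, el,
    nform_Dg (el_pow_eq r hr) (one_mem _) (one_mem _)]

lemma det_kel (k : KK M N) (r : ℝ) (hr : 0 < r) : |(kap k * el M N r).det| = 1 := by
  rw [Matrix.det_mul, abs_mul, kap_Dg, det_Dg (by simp) k.1.2 k.2.2, el,
    det_Dg (el_pow_eq r hr) (one_mem _) (one_mem _), one_mul]

lemma det_gw (s : Sim M N) (hs : 0 < s.1) : |(gw s).det| = 1 := by
  rw [gw, Matrix.det_mul, abs_mul, det_kel _ _ (inv_pos.2 hs), Um_det, abs_one, one_mul]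

lemma norm_sq_le_dot {n : ℕ} (x : Fin n → ℝ) : ‖x‖ ^ 2 ≤ x ⬝ᵥ x := by
  have h0 : 0 ≤ x ⬝ᵥ x := by
    simp only [dotProduct]
    exact Finset.sum_nonneg fun i _ => mul_self_nonneg _
  have h : ‖x‖ ≤ √(x ⬝ᵥ x) := by
    refine (pi_norm_le_iff_of_nonneg (Real.sqrt_nonneg _)).2 fun i => ?_
    apply Real.le_sqrt_of_sq_le
    rw [Real.norm_eq_abs, sq_abs, sq]
    simp only [dotProduct]
    exact Finset.single_le_sum (f := fun i => x i * x i) (fun i _ => mul_self_nonneg _) (Finset.mem_univ i)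
  calc ‖x‖ ^ 2 ≤ √(x ⬝ᵥ x) ^ 2 := by gcongr
    _ = _ := Real.sq_sqrt h0

lemma dot_le_norm_sq {n : ℕ} (x : Fin n → ℝ) : x ⬝ᵥ x ≤ n * ‖x‖ ^ 2 := by
  have h := abs_dot_le x x (a := ‖x‖) (b := ‖x‖) (fun i => norm_le_pi_norm x i) (fun i => norm_le_pi_norm x i) (norm_nonneg _)
  rw [Fintype.card_fin] at h
  rw [sq]
  exact (le_abs_self _).trans h

lemma zc_norm_ge {n : ℕ} {q : Fin n → ℤ} (hq : q ≠ 0) : 1 ≤ ‖zc q‖ := by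
  obtain ⟨i, hi⟩ := Function.ne_iff.1 hq
  have h1 : (1 : ℝ) ≤ |(q i : ℝ)| := by
    rw [← Int.cast_abs]
    exact_mod_cast Int.one_le_abs hi
  exact h1.trans (norm_le_pi_norm (zc q) i)

lemma nf_BA [NeZero M] {c : ℝ} (hc : 0 < c) {α : MatSpace M N} (hα : α ∈ BAc M N c) (v : Fin M ⊕ Fin N → ℤ)
    (hv : v ∘ Sum.inr ≠ 0) : c ^ (2 * M) ≤ nform (Um α *ᵥ zc v) := by
  have h1 := hα (v ∘ Sum.inr) hv (-(v ∘ Sum.inl))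
  have hq := zc_norm_ge hv
  have hq0 : 0 < ‖zc (v ∘ Sum.inr)‖ := by linarith
  unfold nform Um
  rw [blk_mulVec_inl, blk_mulVec_inr]
  have e1 : zc v ∘ Sum.inl = zc (v ∘ Sum.inl) := rfl
  have e2 : zc v ∘ Sum.inr = zc (v ∘ Sum.inr) := rfl
  have e3 : zc (-(v ∘ Sum.inl)) = - zc (v ∘ Sum.inl) := by funext i; simp [zc]
  rw [e3, sub_neg_eq_add, add_comm] at h1
  rw [e1, e2, Matrix.one_mulVec, Matrix.one_mulVec, Matrix.zero_mulVec, zero_add]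
  set x := zc (v ∘ Sum.inl) + α *ᵥ zc (v ∘ Sum.inr)
  set y := zc (v ∘ Sum.inr)
  have hM : (M : ℝ) ≠ 0 := by exact_mod_cast NeZero.ne M
  calc c ^ (2 * M) = ((c * ‖y‖ ^ (-(N : ℝ) / M)) ^ 2) ^ M * (‖y‖ ^ 2) ^ N := by
        rw [← pow_mul, ← pow_mul, mul_pow, mul_assoc]
        have : (‖y‖ ^ (-(N : ℝ) / M)) ^ (2 * M) * ‖y‖ ^ (2 * N) = 1 := by
          rw [← Real.rpow_mul_natCast hq0.le, ← Real.rpow_natCast ‖y‖ (2 * N), ← Real.rpow_add hq0]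
          have : -(N : ℝ) / M * ((2 * M : ℕ) : ℝ) + ((2 * N : ℕ) : ℝ) = 0 := by
            push_cast; field_simp; ring
          rw [this, Real.rpow_zero]
        rw [this, mul_one]
    _ ≤ (‖x‖ ^ 2) ^ M * (‖y‖ ^ 2) ^ N := by
        have : 0 ≤ c * ‖y‖ ^ (-(N : ℝ) / M) := by positivity
        gcongr
    _ ≤ (x ⬝ᵥ x) ^ M * (y ⬝ᵥ y) ^ N := by
        have hx := norm_sq_le_dot x
        have hy := norm_sq_le_dot y
        have : 0 ≤ x ⬝ᵥ x := (sq_nonneg _).trans hx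
        gcongr

lemma norm_inl_le (x : Fin M ⊕ Fin N → ℝ) : ‖x ∘ Sum.inl‖ ≤ ‖x‖ :=
  (pi_norm_le_iff_of_nonneg (norm_nonneg _)).2 fun i => norm_le_pi_norm x (Sum.inl i)

lemma inl_big [NeZero M] (s : Sim M N) (hs : 0 < s.1) (α : MatSpace M N) (v : Fin M ⊕ Fin N → ℤ) (hv : v ≠ 0)
    (hv2 : v ∘ Sum.inr = 0) :
    ((s.1⁻¹) ^ ((N : ℝ) / (M + N))) ^ 2 ≤ M * ‖(Um α * gw s) *ᵥ zc v‖ ^ 2 := by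
  have hi : v ∘ Sum.inl ≠ 0 := by
    intro h
    apply hv
    funext i
    rcases i with i | i
    · exact congrFun h i
    · exact congrFun hv2 i
  rw [Um_gw s hs, ← Matrix.mulVec_mulVec, ← Matrix.mulVec_mulVec]
  set t := (s.1⁻¹) ^ ((N : ℝ) / (M + N)) with ht
  have e2 : zc v ∘ Sum.inr = 0 := by
    funext i
    have := congrFun hv2 i
    simp only [Function.comp] at this
    simp [zc, this]
  have h1 : (Um (ap s α) *ᵥ zc v) ∘ Sum.inl = zc (v ∘ Sum.inl) := by
    rw [Um, blk_mulVec_inl, e2, Matrix.mulVec_zero, add_zero, Matrix.one_mulVec]; rfl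
  have h2 : (kap s.2.1⁻¹ *ᵥ (el M N s.1⁻¹ *ᵥ (Um (ap s α) *ᵥ zc v))) ∘ Sum.inl
      = ((s.2.1⁻¹).1 : Matrix (Fin M) (Fin M) ℝ) *ᵥ (t • zc (v ∘ Sum.inl)) := by
    rw [kap, blk_mulVec_inl, Matrix.zero_mulVec, add_zero, el, Dg, blk_mulVec_inl, Matrix.zero_mulVec, add_zero, h1,
      Matrix.smul_mulVec, Matrix.one_mulVec]
  set X := kap s.2.1⁻¹ *ᵥ (el M N s.1⁻¹ *ᵥ (Um (ap s α) *ᵥ zc v))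
  have h3 : (X ∘ Sum.inl) ⬝ᵥ (X ∘ Sum.inl) = t ^ 2 * (zc (v ∘ Sum.inl) ⬝ᵥ zc (v ∘ Sum.inl)) := by
    rw [h2, orth_dot (s.2.1⁻¹).1.2]
    simp only [dotProduct_smul, smul_dotProduct, smul_eq_mul]
    ring
  have h4 := dot_le_norm_sq (X ∘ Sum.inl)
  have h5 := norm_sq_le_dot (zc (v ∘ Sum.inl))
  have h6 := zc_norm_ge hi
  have h7 : (1 : ℝ) ≤ zc (v ∘ Sum.inl) ⬝ᵥ zc (v ∘ Sum.inl) := by nlinarith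
  have h8 := norm_inl_le X
  have h9 : (M : ℝ) * ‖X ∘ Sum.inl‖ ^ 2 ≤ M * ‖X‖ ^ 2 := by gcongr
  nlinarith [sq_nonneg t]

lemma nf_gw [NeZero M] {c : ℝ} (hc : 0 < c) (s : Sim M N) (hs : 0 < s.1) {α : MatSpace M N} (hα : ap s α ∈ BAc M N c)
    (v : Fin M ⊕ Fin N → ℤ) (hv : v ∘ Sum.inr ≠ 0) : c ^ (2 * M) ≤ nform ((Um α * gw s) *ᵥ zc v) := by
  rw [Um_gw s hs, ← Matrix.mulVec_mulVec, nform_kel _ _ (inv_pos.2 hs)]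
  exact nf_BA hc hα v hv

theorem limit_lattice [NeZero M] [NeZero N] {c : ℝ} (hc : 0 < c) (s : ℕ → Sim M N) (hs : ∀ j, 0 < (s j).1)
    (hs0 : Tendsto (fun j => (s j).1) atTop (𝓝 0)) {C : Set (MatSpace M N)} (hne : C.Nonempty)
    (hC : ∀ x ∈ C, ∀ W ∈ 𝓝 x, ∀ᶠ j in atTop, ∃ α ∈ W, ap (s j) α ∈ BAc M N c) :
    ∃ c' > 0, ∃ g0 : BMat M N, ∀ x ∈ C, Good c' (Um x * g0) := by
  classical
  have hc' : 0 < c ^ (2 * M) := by positivity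
  have hM : (0 : ℝ) < M := by exact_mod_cast Nat.pos_of_ne_zero (NeZero.ne M)
  have hN : (0 : ℝ) < N := by exact_mod_cast Nat.pos_of_ne_zero (NeZero.ne N)
  obtain ⟨δ, hδ, hsm⟩ := nform_small (M := M) (N := N) _ hc'
  obtain ⟨R, hR⟩ := mahler_compact (n := Fin M ⊕ Fin N) δ hδ
  have ht : Tendsto (fun j => ((s j).1⁻¹) ^ ((N : ℝ) / (M + N))) atTop atTop := by
    refine (tendsto_rpow_atTop (by positivity)).comp ?_
    exact (tendsto_nhdsWithin_iff.2 ⟨hs0, Eventually.of_forall hs⟩).inv_tendsto_nhdsGT_zero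
  have hbig : ∀ B : ℝ, ∀ᶠ j in atTop, ∀ α v, v ≠ 0 → v ∘ Sum.inr = 0 → B < ‖(Um α * gw (s j)) *ᵥ zc v‖ := by
    intro B
    filter_upwards [ht.eventually_gt_atTop ((M + 1) * (|B| + 1))] with j hj α v hv hv2
    have h1 := inl_big (s j) (hs j) α v hv hv2
    by_contra hlt
    push Not at hlt
    have h2 : ‖(Um α * gw (s j)) *ᵥ zc v‖ ≤ |B| + 1 := by linarith [le_abs_self B]
    have h3 : ((M + 1 : ℝ) * (|B| + 1)) ^ 2 < ((s j).1⁻¹ ^ ((N : ℝ) / (M + N))) ^ 2 := by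
      have := abs_nonneg B
      gcongr
    have h4 : (M : ℝ) * ‖(Um α * gw (s j)) *ᵥ zc v‖ ^ 2 ≤ M * (|B| + 1) ^ 2 := by gcongr
    have h5 : (M : ℝ) * (|B| + 1) ^ 2 ≤ ((M + 1 : ℝ) * (|B| + 1)) ^ 2 := by
      rw [mul_pow]
      have : (M : ℝ) ≤ (M + 1) ^ 2 := by nlinarith
      gcongr
    linarith
  obtain ⟨α0, hα0⟩ := hne
  have hγ : ∀ᶠ j in atTop, ∃ α ∈ Metric.ball α0 1, ∃ γ : GLZ M N, ‖Um α * gw (s j) * zm γ‖ ≤ R := by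
    filter_upwards [hC α0 hα0 _ (Metric.ball_mem_nhds α0 one_pos), hbig δ] with j ⟨α, hα, hα'⟩ hj
    refine ⟨α, hα, hR _ ?_ fun v hv => ?_⟩
    · rw [Matrix.det_mul, abs_mul, Um_det, abs_one, one_mul, det_gw _ (hs j)]
    · by_cases hv2 : v ∘ Sum.inr = 0
      · exact (hj α v hv hv2).le
      · by_contra hlt
        push Not at hlt
        exact absurd (nf_gw hc (s j) (hs j) hα' v hv2) (not_le.2 (hsm _ hlt))
  set d : ℝ := (Fintype.card (Fin M ⊕ Fin N) : ℝ) with hd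
  obtain ⟨R', hR'⟩ : ∃ R', ∀ᶠ j in atTop, ∃ γ : GLZ M N, ‖gw (s j) * zm γ‖ ≤ R' := by
    obtain ⟨B, hB⟩ := (isCompact_closedBall α0 1).exists_bound_of_continuousOn
      (f := fun α => Um (-α)) (Um_cont.comp continuous_neg).continuousOn
    refine ⟨d * (B * R), ?_⟩
    filter_upwards [hγ] with j ⟨α, hα, γ, hg⟩
    refine ⟨γ, ?_⟩
    have e1 : gw (s j) * zm γ = Um (-α) * (Um α * gw (s j) * zm γ) := by
      rw [← mul_assoc, ← mul_assoc, Um_mul, neg_add_cancel, Um_zero, one_mul]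
    rw [e1]
    refine (norm_mul_le_card _ _).trans ?_
    have h1 := hB α (Metric.ball_subset_closedBall hα)
    have h2 : 0 ≤ B := (norm_nonneg _).trans h1
    exact mul_le_mul_of_nonneg_left (mul_le_mul h1 hg (norm_nonneg _) h2) (by positivity)
  have hγ' : ∀ j, ∃ γ : GLZ M N, (∃ γ : GLZ M N, ‖gw (s j) * zm γ‖ ≤ R') → ‖gw (s j) * zm γ‖ ≤ R' := by
    intro j
    by_cases h : ∃ γ : GLZ M N, ‖gw (s j) * zm γ‖ ≤ R'
    · obtain ⟨γ, h⟩ := h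
      exact ⟨γ, fun _ => h⟩
    · exact ⟨1, fun h' => absurd h' h⟩
  choose γ hγ' using hγ'
  let U : Ultrafilter ℕ := Ultrafilter.of atTop
  have hU : (U : Filter ℕ) ≤ atTop := Ultrafilter.of_le atTop
  have hRU : ∀ᶠ j in (U : Filter ℕ), ‖gw (s j) * zm (γ j)‖ ≤ R' := hU (hR'.mono fun j hj => hγ' j hj)
  obtain ⟨g0, -, hg0⟩ := uf_lim_norm U R' (fun j => gw (s j) * zm (γ j : Matrix (Fin M ⊕ Fin N) (Fin M ⊕ Fin N) ℤ)) hRU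
  refine ⟨_, hc', g0, fun x hx => ⟨?_, fun v hv => ?_⟩⟩
  · rw [Matrix.det_mul, abs_mul, Um_det, abs_one, one_mul]
    have hcl : IsClosed {g : BMat M N | |g.det| = 1} := isClosed_eq (continuous_id.matrix_det.abs) continuous_const
    refine hcl.mem_of_tendsto hg0 (Eventually.of_forall fun j => ?_)
    change |(gw (s j) * zm (γ j)).det| = 1
    rw [Matrix.det_mul, abs_mul, det_gw _ (hs j), zm_unit_det, one_mul]
  · by_contra hlt
    push Not at hlt
    have hct1 : Continuous fun p : MatSpace M N × BMat M N => (Um p.1 * p.2) *ᵥ zc v :=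
      (mulVec_cont (zc v)).comp ((Um_cont.comp continuous_fst).mul continuous_snd)
    set B := ‖(Um x * g0) *ᵥ zc v‖ + 1 with hB
    have hev : ∀ᶠ p in 𝓝 (x, g0), nform ((Um p.1 * p.2) *ᵥ zc v) < c ^ (2 * M) ∧ ‖(Um p.1 * p.2) *ᵥ zc v‖ < B := by
      refine Eventually.and ?_ ?_
      · exact ((nform_cont.comp hct1).tendsto (x, g0)).eventually (gt_mem_nhds hlt)
      · exact ((hct1.norm).tendsto (x, g0)).eventually (gt_mem_nhds (by rw [hB]; linarith))
    rw [nhds_prod_eq, eventually_prod_iff] at hev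
    obtain ⟨pW, hW, pG, hG, hev⟩ := hev
    have h1 := hg0.eventually hG
    have h2 : ∀ᶠ j in (U : Filter ℕ), ∃ α ∈ {x | pW x}, ap (s j) α ∈ BAc M N c := hU (hC x hx _ hW)
    have h3 : ∀ᶠ j in (U : Filter ℕ), ∀ α v, v ≠ 0 → v ∘ Sum.inr = 0 →
        B < ‖(Um α * gw (s j)) *ᵥ zc v‖ := hU (hbig B)
    obtain ⟨j, h1, ⟨α, hα, hα'⟩, h3⟩ := (h1.and (h2.and h3)).exists
    obtain ⟨h4, h5⟩ := hev hα h1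
    have hv' : ((γ j : Matrix (Fin M ⊕ Fin N) (Fin M ⊕ Fin N) ℤ) *ᵥ v) ≠ 0 := by
      intro h0
      apply hv
      have : ((γ j)⁻¹ : GLZ M N).val *ᵥ ((γ j : Matrix (Fin M ⊕ Fin N) (Fin M ⊕ Fin N) ℤ) *ᵥ v) = 0 := by
        rw [h0, Matrix.mulVec_zero]
      rwa [Matrix.mulVec_mulVec, Units.inv_mul, Matrix.one_mulVec] at this
    have e1 : (Um α * (gw (s j) * zm (γ j))) *ᵥ zc v
        = (Um α * gw (s j)) *ᵥ zc ((γ j : Matrix (Fin M ⊕ Fin N) (Fin M ⊕ Fin N) ℤ) *ᵥ v) := by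
      rw [← mul_assoc, ← Matrix.mulVec_mulVec, zm_mulVec]
    rw [e1] at h4 h5
    by_cases hv2 : ((γ j : Matrix (Fin M ⊕ Fin N) (Fin M ⊕ Fin N) ℤ) *ᵥ v) ∘ Sum.inr = 0
    · exact lt_asymm h5 (h3 α _ hv' hv2)
    · exact absurd (nf_gw hc (s j) (hs j) hα' _ hv2) (not_le.2 h4)

end

section

/-- splicing of two sequences -/
def Spl {E : Type*} (n : ℕ) (p : (ℕ → E) × (ℕ → E)) : ℕ → E := fun j => if j < n then p.1 j else p.2 (j - n)

lemma Spl_meas {E : Type*} [MeasurableSpace E] (n : ℕ) : Measurable (Spl (E := E) n) := by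
  refine measurable_pi_lambda _ fun j => ?_
  unfold Spl
  by_cases h : j < n
  · simp only [h, if_true]; exact (measurable_pi_apply j).comp measurable_fst
  · simp only [h, if_false]; exact (measurable_pi_apply (j - n)).comp measurable_snd

lemma Spl_pres {E : Type*} [MeasurableSpace E] {μ : Measure E} [IsProbabilityMeasure μ] {β : Measure (ℕ → E)}
    (hβ : IsBernoulli μ β) (n : ℕ) : MeasurePreserving (Spl n) (β.prod β) β := by
  haveI := hβ.1
  refine ⟨Spl_meas n, ?_⟩
  have e1 : β = Measure.infinitePi (fun _ : ℕ => μ) := by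
    apply Measure.eq_infinitePi
    intro F t ht
    rw [← hβ.2 F t (fun i _ => ht i)]
    rfl
  have e2 : (β.prod β).map (Spl n) = Measure.infinitePi (fun _ : ℕ => μ) := by
    apply Measure.eq_infinitePi
    intro F t ht
    rw [Measure.map_apply (Spl_meas n) (MeasurableSet.pi F.countable_toSet fun i _ => ht i)]
    have hset : Spl n ⁻¹' (Set.pi F t) = {b : ℕ → E | ∀ i ∈ F.filter (· < n), b i ∈ t i} ×ˢ
        {b : ℕ → E | ∀ i ∈ (F.filter (fun i => ¬ i < n)).image (· - n), b i ∈ t (i + n)} := by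
      ext ⟨b, b'⟩
      simp only [Set.mem_preimage, Set.mem_pi, Finset.mem_coe, Set.mem_prod, Set.mem_ofPred_eq, Finset.mem_filter,
        Finset.mem_image, Spl]
      constructor
      · intro h
        refine ⟨fun i hi => by simpa [hi.2] using h i hi.1, ?_⟩
        rintro _ ⟨i, hi, rfl⟩
        have := h i hi.1
        rw [if_neg hi.2] at this
        rwa [Nat.sub_add_cancel (not_lt.1 hi.2)]
      · rintro ⟨h1, h2⟩ i hi
        by_cases hn : i < n
        · rw [if_pos hn]; exact h1 i ⟨hi, hn⟩
        · rw [if_neg hn]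
          have := h2 (i - n) ⟨i, ⟨hi, hn⟩, rfl⟩
          rwa [Nat.sub_add_cancel (not_lt.1 hn)] at this
    rw [hset, Measure.prod_prod, hβ.2 _ _ (fun i _ => ht i), hβ.2 _ (fun i => t (i + n)) (fun i _ => ht _),
      Finset.prod_image, ← Finset.prod_filter_mul_prod_filter_not F (· < n)]
    · congr 1
      refine Finset.prod_congr rfl fun i hi => ?_
      rw [Nat.sub_add_cancel (not_lt.1 (Finset.mem_filter.1 hi).2)]
    · intro i hi j hj h
      have h1 := (Finset.mem_filter.1 hi).2
      have h2 := (Finset.mem_filter.1 hj).2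
      simp only at h
      omega
  rw [e2, ← e1]

open scoped symmDiff ENNReal in
lemma dens_splice {E : Type*} [MeasurableSpace E] {μ : Measure E} [IsProbabilityMeasure μ] {β : Measure (ℕ → E)}
    (hβ : IsBernoulli μ β) {B : Set (ℕ → E)} (hB : MeasurableSet B) (hB0 : β B ≠ 0) (n0 : ℕ) (ε : ℝ≥0∞)
    (hε : ε ≠ 0) (hε' : ε ≠ ⊤) : ∃ n ≥ n0, ∃ b, β {b' | Spl n (b, b') ∉ B} < ε := by
  haveI := hβ.1
  have h1ε : 1 + ε ≠ ⊤ := by finiteness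
  have h1ε0 : 1 + ε ≠ 0 := by simp
  set η := ε * β B / (1 + ε) with hη
  have hη0 : 0 < η := ENNReal.div_pos (mul_ne_zero hε hB0) h1ε
  obtain ⟨A, hA, hAB⟩ := exists_measure_symmDiff_lt_of_generateFrom_isSetRing (μ := β)
    (isSetRing_measurableCylinders (α := fun _ : ℕ => E))
    ⟨{Set.univ}, Set.countable_singleton _, by simpa using univ_mem_measurableCylinders (fun _ : ℕ => E), by simp⟩
    generateFrom_measurableCylinders.symm hB hη0
  have hAm : MeasurableSet A := MeasurableSet.of_mem_measurableCylinders hA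
  obtain ⟨F, S, hS, hAdef⟩ := (mem_measurableCylinders A).1 hA
  refine ⟨max n0 (F.sup id + 1), le_max_left _ _, ?_⟩
  set n := max n0 (F.sup id + 1)
  have hn : ∀ i ∈ F, i < n := fun i hi => by
    have : i ≤ F.sup id := Finset.le_sup (f := id) hi
    have h2 : F.sup id + 1 ≤ n := le_max_right _ _
    omega
  have hcyl : ∀ b b', Spl n (b, b') ∈ A ↔ b ∈ A := by
    intro b b'
    simp only [hAdef, mem_cylinder]
    have : F.restrict (Spl n (b, b')) = F.restrict b := by
      funext i
      simp [Finset.restrict, Spl, hn i i.2]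
    rw [this]
  by_contra hcon
  push Not at hcon
  have h1 : ε * β A ≤ β (A \ B) := by
    have hm : MeasurableSet (Spl n ⁻¹' (A \ B)) := Spl_meas n (hAm.diff hB)
    rw [← (Spl_pres hβ n).measure_preimage (hAm.diff hB).nullMeasurableSet, Measure.prod_apply hm]
    rw [← lintegral_indicator_const hAm]
    refine lintegral_mono fun b => ?_
    by_cases hb : b ∈ A
    · rw [Set.indicator_of_mem hb]
      refine (hcon b).trans (measure_mono fun b' hb' => ?_)
      exact ⟨(hcyl b b').2 hb, hb'⟩
    · rw [Set.indicator_of_notMem hb]; exact bot_le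
  have h2 : β (A \ B) < η := lt_of_le_of_lt (measure_mono (by rw [Set.symmDiff_def]; exact Set.subset_union_left)) hAB
  have h3 : β B ≤ β A + η := by
    calc β B ≤ β (A ∪ (B \ A)) := measure_mono (by intro x hx; by_cases h : x ∈ A <;> simp [h, hx])
      _ ≤ β A + β (B \ A) := measure_union_le _ _
      _ ≤ _ := by gcongr; exact (measure_mono (by rw [Set.symmDiff_def]; exact Set.subset_union_right)).trans hAB.le
  have hηt : η ≠ ⊤ := ENNReal.div_ne_top (ENNReal.mul_ne_top hε' (measure_ne_top β _)) h1ε0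
  have h4 : ε * β B < η + ε * η := by
    calc ε * β B ≤ ε * (β A + η) := by gcongr
      _ = ε * β A + ε * η := mul_add _ _ _
      _ < η + ε * η := ENNReal.add_lt_add_right (ENNReal.mul_ne_top hε' hηt) (h1.trans_lt h2)
  have h5 : η + ε * η = ε * β B := by
    rw [← one_add_mul, mul_comm, hη, ENNReal.div_mul_cancel h1ε0 h1ε]
  exact absurd h4 (by rw [h5]; exact lt_irrefl _)

end

section

variable {M N : ℕ}

lemma seqA_congr {E X : Type*} (φ : E → X → X) {b b' : ℕ → E} (n : ℕ) (h : ∀ j < n, b j = b' j) (x : X) :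
    seqApply φ b n x = seqApply φ b' n x := by
  induction n generalizing x with
  | zero => rfl
  | succ n ih =>
    change seqApply φ b n (φ (b n) x) = seqApply φ b' n (φ (b' n) x)
    rw [h n (Nat.lt_succ_self n), ih (fun j hj => h j (by omega))]

lemma seqA_add {E X : Type*} (φ : E → X → X) (b b' : ℕ → E) (n m : ℕ) (x : X) :
    seqApply φ (Spl n (b, b')) (n + m) x = seqApply φ b n (seqApply φ b' m x) := by
  induction m generalizing x with
  | zero => exact seqA_congr φ n (fun j hj => by simp [Spl, hj]) x
  | succ m ih =>
    change seqApply φ (Spl n (b, b')) (n + m) (φ (Spl n (b, b') (n + m)) x) = seqApply φ b n (seqApply φ b' m (φ (b' m) x))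
    rw [ih]
    simp [Spl]

lemma seqA_sim {E : Type*} {φ : E → MatSpace M N → MatSpace M N} {r : E → ℝ}
    (hsim : ∀ e, IsAlgebraicSimilarity (r e) (φ e)) (b : ℕ → E) (n : ℕ) :
    ∃ s : Sim M N, s.1 = ∏ i ∈ Finset.range n, r (b i) ∧ 0 < s.1 ∧ ∀ x, seqApply φ b n x = ap s x := by
  induction n with
  | zero => exact ⟨(1, 1, 0), by simp, one_pos, fun x => by simp [ap, act_one, seqApply]⟩
  | succ n ih =>
    obtain ⟨s, h1, h2, h3⟩ := ih
    obtain ⟨t, g1, g2, g3⟩ := sim_of_alg (hsim (b n))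
    refine ⟨sCmp s t, ?_, mul_pos h2 (by rw [g1]; exact g2), fun x => ?_⟩
    · rw [Finset.prod_range_succ, ← h1, ← g1]; rfl
    · rw [ap_cmp, ← g3, ← h3]; rfl

lemma seqA_limit {E : Type*} {φ : E → MatSpace M N → MatSpace M N} {r : E → ℝ}
    (hsim : ∀ e, IsAlgebraicSimilarity (r e) (φ e)) (b b' : ℕ → E) (n : ℕ) {y z : MatSpace M N}
    (h1 : ∀ α₀ : MatSpace M N, Tendsto (fun m => seqApply φ (Spl n (b, b')) m α₀) atTop (𝓝 y))
    (h2 : ∀ α₀ : MatSpace M N, Tendsto (fun m => seqApply φ b' m α₀) atTop (𝓝 z)) :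
    y = seqApply φ b n z := by
  obtain ⟨s, -, -, hs⟩ := seqA_sim hsim b n
  have e1 : Tendsto (fun m => ap s (seqApply φ b' m 0)) atTop (𝓝 (ap s z)) := ((ap_cont s).tendsto z).comp (h2 0)
  have e2 : Tendsto (fun m => seqApply φ (Spl n (b, b')) (n + m) 0) atTop (𝓝 y) := by
    have h := (tendsto_add_atTop_iff_nat n).2 (h1 0)
    simpa only [add_comm] using h
  have e3 : (fun m => seqApply φ (Spl n (b, b')) (n + m) 0) = fun m => ap s (seqApply φ b' m 0) := by
    funext m
    rw [seqA_add, hs]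
  rw [e3] at e2
  rw [hs]
  exact tendsto_nhds_unique e2 e1

lemma ratio_zero [NeZero M] [NeZero N] {E : Type*} {φ : E → MatSpace M N → MatSpace M N} {r : E → ℝ}
    (hsim : ∀ e, IsAlgebraicSimilarity (r e) (φ e)) (b : ℕ → E) {y : MatSpace M N}
    (h1 : ∀ α₀ : MatSpace M N, Tendsto (fun m => seqApply φ b m α₀) atTop (𝓝 y)) :
    Tendsto (fun n => ∏ i ∈ Finset.range n, r (b i)) atTop (𝓝 0) := by
  choose s e1 e2 e3 using seqA_sim hsim b
  let x : MatSpace M N := Matrix.of fun _ _ => 1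
  have hx : 1 ≤ ‖x‖ := by
    have h := Matrix.norm_entry_le_entrywise_sup_norm x (i := 0) (j := 0)
    simpa [x] using h
  have h2 : Tendsto (fun n => ‖seqApply φ b n x - seqApply φ b n 0‖) atTop (𝓝 0) := by
    have h := ((h1 x).sub (h1 0)).norm
    rwa [sub_self, norm_zero] at h
  have h3 : Tendsto (fun n => (M * N : ℝ) * ‖seqApply φ b n x - seqApply φ b n 0‖) atTop (𝓝 0) := by
    simpa using h2.const_mul (M * N : ℝ)
  refine squeeze_zero (fun n => ?_) (fun n => ?_) h3
  · rw [← e1]; exact (e2 n).le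
  · rw [← e1, e3, e3, ap_sub, norm_smul, Real.norm_eq_abs, abs_of_pos (e2 n), sub_zero]
    have h4 := norm_le_act (s n).2.1 x
    have := e2 n
    nlinarith

lemma BAc_closed (c : ℝ) : IsClosed (BAc M N c) := by
  have : BAc M N c = ⋂ (q : Fin N → ℤ) (_ : q ≠ 0) (p : Fin M → ℤ),
      {α | c * ‖zc q‖ ^ (-(N : ℝ) / M) ≤ ‖α *ᵥ zc q - zc p‖} := by
    ext α; simp [BAc]
  rw [this]
  refine isClosed_iInter fun q => isClosed_iInter fun _ => isClosed_iInter fun p => ?_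
  refine isClosed_le continuous_const ?_
  refine Continuous.norm ?_
  refine Continuous.sub ?_ continuous_const
  refine continuous_pi fun i => ?_
  simp only [Matrix.mulVec, dotProduct]
  refine continuous_finsetSum _ fun j _ => Continuous.mul ?_ continuous_const
  have h : Continuous fun α : MatSpace M N => α i j := continuous_id.matrix_elem i j
  exact h

lemma BA_subset : badlyApproximableMat M N ⊆ ⋃ k : ℕ, BAc M N (1 / ((k : ℝ) + 1)) := by
  rintro α ⟨c, hc, h⟩
  obtain ⟨k, hk⟩ := exists_nat_one_div_lt hc
  refine Set.mem_iUnion.2 ⟨k, fun q hq p => ?_⟩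
  refine le_trans ?_ (h q hq p)
  have : (0 : ℝ) ≤ ‖zc q‖ ^ (-(N : ℝ) / M) := by positivity
  exact mul_le_mul_of_nonneg_right hk.le this

end

section

variable {M N : ℕ}

open scoped ENNReal in
lemma find_sim [NeZero M] [NeZero N] {E : Type*} [MetricSpace E] [CompactSpace E]
    [MeasurableSpace E] [BorelSpace E]
    {φ : E → MatSpace M N → MatSpace M N} {r : E → ℝ}
    (hsim : ∀ e, IsAlgebraicSimilarity (r e) (φ e)) (hrcont : Continuous r)
    {μ : Measure E} [IsProbabilityMeasure μ] {β : Measure (ℕ → E)} (hβ : IsBernoulli μ β)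
    {π : (ℕ → E) → MatSpace M N} (hπmeas : AEMeasurable π β)
    (hπ : ∀ᵐ b ∂β, ∀ α₀ : MatSpace M N, Tendsto (fun n => seqApply φ b n α₀) atTop (𝓝 (π b)))
    {c : ℝ} (hc : β (π ⁻¹' BAc M N c) ≠ 0) (δ : ℝ) (hδ : 0 < δ) (ε : ℝ≥0∞) (hε : ε ≠ 0) (hε1 : ε ≤ 1) :
    ∃ s : Sim M N, 0 < s.1 ∧ s.1 ≤ δ ∧ β {b | ap s (π b) ∉ BAc M N c} < ε := by
  haveI := hβ.1
  let nice : Set (ℕ → E) := {b | ∀ α₀ : MatSpace M N, Tendsto (fun n => seqApply φ b n α₀) atTop (𝓝 (π b))}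
  let Dn : ℕ → Set (ℕ → E) := fun n0 => {b | ∀ k, n0 ≤ k → ∏ i ∈ Finset.range k, r (b i) ≤ δ}
  have hnice : NullMeasurableSet nice β := by
    refine NullMeasurableSet.of_compl ?_
    exact NullMeasurableSet.of_null hπ
  have hDn : ∀ n0, MeasurableSet (Dn n0) := by
    intro n0
    have : Dn n0 = ⋂ (k : ℕ) (_ : n0 ≤ k), {b | ∏ i ∈ Finset.range k, r (b i) ≤ δ} := by
      ext b; simp [Dn]
    rw [this]
    refine MeasurableSet.iInter fun k => MeasurableSet.iInter fun _ => measurableSet_le ?_ measurable_const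
    exact Finset.measurable_fun_prod _ fun i _ => hrcont.measurable.comp (measurable_pi_apply i)
  have hBA : NullMeasurableSet (π ⁻¹' BAc M N c) β := hπmeas.nullMeasurable (BAc_closed c).measurableSet
  have hex : ∃ n0, β ((π ⁻¹' BAc M N c ∩ Dn n0) ∩ nice) ≠ 0 := by
    by_contra hno
    push Not at hno
    have h1 := measure_iUnion_null hno
    apply hc
    refine measure_mono_null_ae ?_ h1
    filter_upwards [hπ] with b hb hbB
    have h2 := ratio_zero hsim b hb
    obtain ⟨n0, hn0⟩ := eventually_atTop.1 (h2.eventually (ge_mem_nhds hδ))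
    exact Set.mem_iUnion.2 ⟨n0, ⟨hbB, fun k hk => hn0 k hk⟩, hb⟩
  obtain ⟨n0, hn0⟩ := hex
  obtain ⟨B, hBsub, hBm, hBeq⟩ := ((hBA.inter (hDn n0).nullMeasurableSet).inter hnice).exists_measurable_subset_ae_eq
  have hB0 : β B ≠ 0 := by rwa [measure_congr hBeq]
  obtain ⟨n, hn, b, hb⟩ := dens_splice hβ hBm hB0 n0 ε hε (ne_top_of_le_ne_top ENNReal.one_ne_top hε1)
  obtain ⟨s, s1, s2, s3⟩ := seqA_sim hsim b n
  refine ⟨s, s2, ?_, ?_⟩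
  · have hne : ∃ b', Spl n (b, b') ∈ B := by
      by_contra hno
      push Not at hno
      have : {b' | Spl n (b, b') ∉ B} = Set.univ := Set.eq_univ_of_forall hno
      rw [this, measure_univ] at hb
      exact absurd hε1 (not_le.2 hb)
    obtain ⟨b', hb'⟩ := hne
    have h := (hBsub hb').1.2 n hn
    rw [s1]
    refine le_trans (le_of_eq ?_) h
    refine Finset.prod_congr rfl fun i hi => ?_
    simp [Spl, Finset.mem_range.1 hi]
  · refine lt_of_le_of_lt (measure_mono_ae ?_) hb
    filter_upwards [hπ] with b' hb' hnot hmem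
    apply hnot
    have h := hBsub hmem
    have e := seqA_limit hsim b b' n h.2 hb'
    rw [← s3, ← e]
    exact h.1.1

lemma supp_inv [NeZero M] [NeZero N] {E : Type*} [MetricSpace E] [CompactSpace E]
    [MeasurableSpace E] [BorelSpace E]
    {φ : E → MatSpace M N → MatSpace M N} {r : E → ℝ}
    (hsim : ∀ e, IsAlgebraicSimilarity (r e) (φ e))
    (hcont : Continuous fun p : E × MatSpace M N => φ p.1 p.2)
    {μ : Measure E} [IsProbabilityMeasure μ]
    (hsupp : ∀ U : Set E, IsOpen U → U.Nonempty → μ U ≠ 0)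
    {β : Measure (ℕ → E)} (hβ : IsBernoulli μ β)
    {π : (ℕ → E) → MatSpace M N}
    (hπ : ∀ᵐ b ∂β, ∀ α₀ : MatSpace M N, Tendsto (fun n => seqApply φ b n α₀) atTop (𝓝 (π b)))
    {x : MatSpace M N} (hx : ∀ W ∈ 𝓝 x, β (π ⁻¹' W) ≠ 0) (e : E) : ∀ U ∈ 𝓝 (φ e x), β (π ⁻¹' U) ≠ 0 := by
  intro U hU h0
  haveI := hβ.1
  have h1 : ∀ᶠ p in 𝓝 (e, x), φ p.1 p.2 ∈ U := (hcont.tendsto (e, x)).eventually hU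
  rw [nhds_prod_eq, eventually_prod_iff] at h1
  obtain ⟨pV, hV, pW, hW, h1⟩ := h1
  obtain ⟨V, hVs, hVo, heV⟩ := mem_nhds_iff.1 hV
  have hq := (Spl_pres hβ 1).quasiMeasurePreserving
  have a1 := hq.ae hπ
  have a2 : ∀ᵐ p ∂(β.prod β), ∀ α₀ : MatSpace M N,
      Tendsto (fun n => seqApply φ p.2 n α₀) atTop (𝓝 (π p.2)) := Measure.quasiMeasurePreserving_snd.ae hπ
  have h0' : ∀ᵐ b ∂β, b ∉ π ⁻¹' U := measure_eq_zero_iff_ae_notMem.1 h0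
  have a3 := hq.ae h0'
  have a4 : ∀ᵐ p ∂(β.prod β), p ∉ {b : ℕ → E | ∀ i ∈ ({0} : Finset ℕ), b i ∈ V} ×ˢ (π ⁻¹' {x | pW x}) := by
    filter_upwards [a1, a2, a3] with p p1 p2 p3 hp
    apply p3
    have e1 := seqA_limit hsim p.1 p.2 1 p1 p2
    change π (Spl 1 p) ∈ U
    rw [show π (Spl 1 p) = _ from e1]
    exact h1 (hVs (hp.1 0 (by simp))) hp.2
  rw [← measure_eq_zero_iff_ae_notMem, Measure.prod_prod, hβ.2 _ (fun _ => V) (fun _ _ => hVo.measurableSet)] at a4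
  rcases mul_eq_zero.1 a4 with h | h
  · rw [Finset.prod_singleton] at h
    exact hsupp V hVo ⟨e, heV⟩ h
  · exact hx _ hW h

end

/-- **Theorem.** If `ν` is a general algebraic self-similar measure on the space of `M × N`
real matrices (i.e. `ν = π_*β` where `π` is the a.e. defined coding map of an irreducible
compact algebraic similarity IFS and `β` is the Bernoulli power of a contracting-on-average
full-support measure), then `ν(BA) = 0`. -/
theorem self_similar_measure_badlyApproximableMat_eq_zero
    (M N : ℕ) (hM : 1 ≤ M) (hN : 1 ≤ N)
    {E : Type*} [MetricSpace E] [CompactSpace E] [Nonempty E]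
    [MeasurableSpace E] [BorelSpace E]
    (φ : E → MatSpace M N → MatSpace M N) (r : E → ℝ)
    (hsim : ∀ e, IsAlgebraicSimilarity (r e) (φ e))
    (hcont : Continuous fun p : E × MatSpace M N => φ p.1 p.2)
    (hrcont : Continuous r)
    (hirr : IrreducibleMatIFS φ)
    (μ : Measure E) [IsProbabilityMeasure μ]
    (hsupp : ∀ U : Set E, IsOpen U → U.Nonempty → μ U ≠ 0)
    (havg : ∫ e, Real.log (r e) ∂μ < 0)
    (β : Measure (ℕ → E)) (hβ : IsBernoulli μ β)
    (π : (ℕ → E) → MatSpace M N) (hπmeas : AEMeasurable π β)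
    (hπ : ∀ᵐ b ∂β, ∀ α₀ : MatSpace M N,
      Tendsto (fun n => seqApply φ b n α₀) atTop (𝓝 (π b)))
    (ν : Measure (MatSpace M N)) (hν : ν = β.map π) :
    ν (badlyApproximableMat M N) = 0 := by
  haveI : NeZero M := ⟨by omega⟩
  haveI : NeZero N := ⟨by omega⟩
  haveI := hβ.1
  by_contra hBA
  have hνprob : IsProbabilityMeasure ν := by rw [hν]; exact Measure.isProbabilityMeasure_map hπmeas
  have hex : ∃ k : ℕ, ν (BAc M N (1 / ((k : ℝ) + 1))) ≠ 0 := by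
    by_contra hno
    push Not at hno
    exact hBA (measure_mono_null BA_subset (measure_iUnion_null hno))
  obtain ⟨k, hk⟩ := hex
  set c : ℝ := 1 / ((k : ℝ) + 1) with hcdef
  have hc : 0 < c := by positivity
  have hk' : β (π ⁻¹' BAc M N c) ≠ 0 := by
    rwa [hν, Measure.map_apply_of_aemeasurable hπmeas (BAc_closed c).measurableSet] at hk
  have hfs : ∀ j : ℕ, ∃ s : Sim M N, 0 < s.1 ∧ s.1 ≤ 1 / ((j : ℝ) + 1) ∧
      β {b | ap s (π b) ∉ BAc M N c} < ENNReal.ofReal (1 / ((j : ℝ) + 1)) := fun j =>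
    find_sim hsim hrcont hβ hπmeas hπ hk' _ (by positivity) _
      (by rw [Ne, ENNReal.ofReal_eq_zero, not_le]; positivity)
      (by
        rw [ENNReal.ofReal_le_one, div_le_one (by positivity)]
        have : (0 : ℝ) ≤ j := Nat.cast_nonneg j
        linarith)
  choose s s1 s2 s3 using hfs
  have hz := tendsto_one_div_add_atTop_nhds_zero_nat (𝕜 := ℝ)
  have hs0 : Tendsto (fun j => (s j).1) atTop (𝓝 0) := squeeze_zero (fun j => (s1 j).le) s2 hz
  have hz' : Tendsto (fun j : ℕ => ENNReal.ofReal (1 / ((j : ℝ) + 1))) atTop (𝓝 0) := by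
    simpa using ENNReal.tendsto_ofReal hz
  let C : Set (MatSpace M N) := {x | ∀ W ∈ 𝓝 x, β (π ⁻¹' W) ≠ 0}
  have hcl : IsClosed C := by
    rw [← isOpen_compl_iff, isOpen_iff_mem_nhds]
    intro x hx
    simp only [C, Set.mem_compl_iff, Set.mem_ofPred_eq, not_forall, not_not] at hx
    obtain ⟨W, hW, hW0⟩ := hx
    obtain ⟨V, hVW, hVo, hxV⟩ := mem_nhds_iff.1 hW
    refine mem_of_superset (hVo.mem_nhds hxV) fun y hy hyC => ?_
    exact hyC V (hVo.mem_nhds hy) (measure_mono_null (Set.preimage_mono hVW) hW0)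
  have hne : C.Nonempty := by
    by_contra hemp
    rw [Set.not_nonempty_iff_eq_empty] at hemp
    have h1 : ∀ x : MatSpace M N, ∃ W ∈ 𝓝 x, β (π ⁻¹' W) = 0 := by
      intro x
      by_contra hno
      push Not at hno
      have hxC : x ∈ C := hno
      rw [hemp] at hxC
      exact hxC
    choose W hW hW0 using h1
    haveI : SecondCountableTopology (MatSpace M N) :=
      inferInstanceAs (SecondCountableTopology (Fin M → Fin N → ℝ))
    obtain ⟨S, hS, hSu⟩ := TopologicalSpace.countable_cover_nhds hW
    have h2 : β (⋃ x ∈ S, π ⁻¹' W x) = 0 := (measure_biUnion_null_iff hS).2 fun x _ => hW0 x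
    have h3 : (⋃ x ∈ S, π ⁻¹' W x) = Set.univ := by
      rw [← Set.preimage_iUnion₂, hSu, Set.preimage_univ]
    rw [h3, measure_univ] at h2
    exact one_ne_zero h2
  have hC : ∀ e, ∀ x ∈ C, φ e x ∈ C := fun e x hx => supp_inv hsim hcont hsupp hβ hπ hx e
  obtain ⟨c', hc', g0, hg0⟩ := limit_lattice hc s s1 hs0 hne (by
    intro x hx W hW
    have hpos := pos_iff_ne_zero.2 (hx W hW)
    filter_upwards [hz'.eventually (gt_mem_nhds hpos)] with j hj
    by_contra hno
    push Not at hno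
    have hsub : π ⁻¹' W ⊆ {b | ap (s j) (π b) ∉ BAc M N c} := fun b hb => hno _ hb
    exact absurd ((measure_mono hsub).trans_lt ((s3 j).trans hj)) (lt_irrefl _))
  have he0 : ∃ e0, r e0 < 1 := by
    by_contra hno
    push Not at hno
    exact absurd havg (not_lt.2 (integral_nonneg fun e => Real.log_nonneg (hno e)))
  obtain ⟨e0, he0⟩ := he0
  exact no_good hsim hirr e0 he0 hcl hne hC c' hc' g0 hg0
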